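/- arXiv:1009.0689 — 3 statements merged into one kernel-verified Lean document; each statement's English description precedes it below -/
import Mathlib

section
/- (Proposition 3.3) Suppose V ∈ C^2(ℝ) satisfies: (i) the (possibly empty) set {φ : V(φ) < 0} is bounded; (ii) the (possibly empty) set of critical points of V is finite. Let φ_* be a strict local minimum of V (possibly degenerate) with V(φ_*) ≥ 0. Then p_* := (φ_*, 0, 0, 0, √(V(φ_*)/3)) is an asymptotically stable equilibrium point of the coupled scalar field–matter–radiation system restricted to the physical set: p_* is an equilibrium, and for every ε > 0 there exists δ > 0 such that every solution (φ, y, ρ, ρ_r, H) defined for t ≥ 0, satisfying the Friedmann constraint 3H^2 = (1/2)y^2 + V(φ) + ρ + ρ_r, with ρ(0) ≥ 0, ρ_r(0) ≥ 0, H(0) > 0 and initial data within distance δ of p_*, remains within distance ε of p_* for all t ≥ 0 and converges to p_* as t → +∞. -/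
open Set Filter Topology

lemma aux_mono (f f' : ℝ → ℝ) (a b : ℝ) (hab : a ≤ b)
    (hd : ∀ t, a ≤ t → t ≤ b → HasDerivAt f (f' t) t)
    (h : ∀ t, a < t → t < b → 0 ≤ f' t) : f a ≤ f b := by
  have := monotoneOn_of_hasDerivWithinAt_nonneg (f := f) (f' := f') (convex_Icc a b)
    (fun t ht => (hd t ht.1 ht.2).continuousAt.continuousWithinAt)
    (fun t ht => by
      rw [interior_Icc] at ht
      exact (hd t ht.1.le ht.2.le).hasDerivWithinAt)
    (fun t ht => by
      rw [interior_Icc] at ht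
      exact h t ht.1 ht.2)
  exact this (left_mem_Icc.2 hab) (right_mem_Icc.2 hab) hab

lemma aux_anti (f f' : ℝ → ℝ) (a b : ℝ) (hab : a ≤ b)
    (hd : ∀ t, a ≤ t → t ≤ b → HasDerivAt f (f' t) t)
    (h : ∀ t, a < t → t < b → f' t ≤ 0) : f b ≤ f a := by
  have := aux_mono (fun t => - f t) (fun t => - f' t) a b hab
    (fun t h1 h2 => (hd t h1 h2).neg) (fun t h1 h2 => by have := h t h1 h2; linarith)
  linarith

/-- first crossing -/
lemma aux_first (f : ℝ → ℝ) (a b : ℝ) (hab : a ≤ b)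
    (hc : ∀ t, a ≤ t → t ≤ b → ContinuousAt f t) (ha : f a < 0) (hb : 0 ≤ f b) :
    ∃ c, a < c ∧ c ≤ b ∧ f c = 0 ∧ ∀ s, a ≤ s → s < c → f s < 0 := by
  have hcon : ContinuousOn f (Icc a b) := fun t ht => (hc t ht.1 ht.2).continuousWithinAt
  have hcl : IsClosed (Icc a b ∩ f ⁻¹' (Ici 0)) :=
    hcon.preimage_isClosed_of_isClosed isClosed_Icc isClosed_Ici
  have hne : (Icc a b ∩ f ⁻¹' (Ici 0)).Nonempty := ⟨b, ⟨hab, le_rfl⟩, hb⟩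
  have hbd : BddBelow (Icc a b ∩ f ⁻¹' (Ici 0)) := ⟨a, fun x hx => hx.1.1⟩
  have hm := hcl.csInf_mem hne hbd
  set c := sInf (Icc a b ∩ f ⁻¹' (Ici 0)) with hcdef
  have hlt : ∀ s, a ≤ s → s < c → f s < 0 := by
    intro s h1 h2
    by_contra h3
    have : c ≤ s := csInf_le hbd ⟨⟨h1, h2.le.trans hm.1.2⟩, not_lt.1 h3⟩
    linarith
  have hac : a < c := by
    rcases eq_or_lt_of_le hm.1.1 with h | h
    · exfalso
      have h2 : 0 ≤ f c := hm.2
      rw [← h] at h2; linarith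
    · exact h
  refine ⟨c, hac, hm.1.2, le_antisymm ?_ hm.2, hlt⟩
  have ht : Tendsto f (𝓝[<] c) (𝓝 (f c)) := (hc c hm.1.1 hm.1.2).tendsto.mono_left nhdsWithin_le_nhds
  refine le_of_tendsto ht ?_
  filter_upwards [Ioo_mem_nhdsLT hac] with s hs
  exact (hlt s hs.1.le hs.2).le

lemma aux_last (f : ℝ → ℝ) (a b : ℝ) (hab : a ≤ b)
    (hc : ∀ t, a ≤ t → t ≤ b → ContinuousAt f t) (ha : f a ≤ 0) (hb : 0 < f b) :
    ∃ c, a ≤ c ∧ c < b ∧ f c = 0 ∧ ∀ s, c < s → s ≤ b → 0 < f s := by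
  obtain ⟨c, h1, h2, h3, h4⟩ := aux_first (fun t => - f (-t)) (-b) (-a) (by linarith)
    (fun t h1 h2 => ((hc (-t) (by linarith) (by linarith)).comp continuous_neg.continuousAt).neg)
    (by simpa using hb) (by simpa using ha)
  refine ⟨-c, by linarith, by linarith, by linarith, fun s h5 h6 => ?_⟩
  have := h4 (-s) (by linarith) (by linarith)
  simpa using this

/-- antiderivative on the half line and solution of the linear equation -/
lemma aux_antider (H : ℝ → ℝ) (hH : ∀ t, 0 ≤ t → ContinuousAt H t) :
    ∃ K : ℝ → ℝ, K 0 = 0 ∧ ∀ t, 0 ≤ t → HasDerivAt K (H t) t := by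
  have hc : Continuous (fun s => H (max s 0)) := by
    rw [continuous_iff_continuousAt]
    intro s
    exact ContinuousAt.comp (f := fun s : ℝ => max s 0) (hH (max s 0) (le_max_right _ _)) (by fun_prop)
  refine ⟨fun t => ∫ s in (0:ℝ)..t, H (max s 0), by simp, fun t ht => ?_⟩
  have := intervalIntegral.integral_hasDerivAt_right (hc.intervalIntegrable 0 t)
    (hc.stronglyMeasurableAtFilter _ _) hc.continuousAt
  simpa [max_eq_left ht] using this

lemma aux_lin (H K f : ℝ → ℝ) (k : ℝ) (hK0 : K 0 = 0) (hK : ∀ t, 0 ≤ t → HasDerivAt K (H t) t)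
    (hf : ∀ t, 0 ≤ t → HasDerivAt f (-k * H t * f t) t) (t : ℝ) (ht : 0 ≤ t) :
    f t = f 0 * Real.exp (-k * K t) := by
  have hd : ∀ s, 0 ≤ s → HasDerivAt (fun s => f s * Real.exp (k * K s)) 0 s := by
    intro s hs
    refine ((hf s hs).mul (((hK s hs).const_mul k).exp)).congr_deriv ?_
    ring
  have h1 := aux_mono _ (fun _ => 0) 0 t ht (fun s h _ => hd s h) (fun _ _ _ => le_rfl)
  have h2 := aux_anti _ (fun _ => 0) 0 t ht (fun s h _ => hd s h) (fun _ _ _ => le_rfl)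
  have h3 : f t * Real.exp (k * K t) = f 0 := by
    have := le_antisymm h2 h1
    simpa [hK0] using this
  rw [← h3, mul_assoc, ← Real.exp_add]
  simp

/-- energy lower bound -/
lemma core_lower (γ C : ℝ) (hγ : 0 < γ) (x y σ H U P g w : ℝ → ℝ) (T X : ℝ)
    (hy : ∀ t, T ≤ t → HasDerivAt y (-3 * H t * y t - P t - σ t * w t) t)
    (hU : ∀ t, T ≤ t → HasDerivAt U (P t * y t) t)
    (hg : ∀ t, T ≤ t → HasDerivAt g (w t * y t) t)
    (hσ : ∀ t, T ≤ t → HasDerivAt σ (-3 * γ * H t * σ t) t)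
    (hgb : ∀ t, T ≤ t → |g t| ≤ C * X)
    (hσ0 : ∀ t, T ≤ t → 0 ≤ σ t) (hH : ∀ t, T ≤ t → 0 < H t)
    (hyl : Tendsto y atTop (𝓝 0)) (hσl : Tendsto σ atTop (𝓝 0)) (hUl : Tendsto U atTop (𝓝 0))
    (hgl : Tendsto g atTop (𝓝 0)) :
    0 ≤ (y T)^2/2 + U T + σ T * g T + C * X * σ T := by
  have hlim : Tendsto (fun t => (y t)^2/2 + U t + σ t * g t + C * X * σ t) atTop (𝓝 0) := by
    have := (((hyl.pow 2).div_const 2).add hUl).add (hσl.mul hgl) |>.add (hσl.const_mul (C * X))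
    simpa using this
  refine le_of_tendsto hlim ?_
  filter_upwards [eventually_ge_atTop T] with s hs
  refine aux_anti (fun t => (y t)^2/2 + U t + σ t * g t + C * X * σ t)
    (fun t => -3 * H t * (y t)^2 - 3 * γ * H t * σ t * (g t + C * X)) T s hs ?_ ?_
  · intro t h1 _
    refine (((((hy t h1).pow 2).div_const 2).add (hU t h1)).add ((hσ t h1).mul (hg t h1)) |>.add
      ((hσ t h1).const_mul (C * X))).congr_deriv ?_
    simp
    ring
  · intro t h1 _
    have h2 := abs_le.1 (hgb t h1.le)
    have h3 := hH t h1.le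
    have h4 := hσ0 t h1.le
    have h5 : 0 ≤ 3 * γ * H t * σ t * (g t + C * X) :=
      mul_nonneg (by positivity) (by linarith)
    have h6 : 0 ≤ H t * (y t)^2 := by positivity
    nlinarith

/-- if `y ≤ 0` at the time `T`, the position is already at the limit. -/
lemma core_main (γ C v h0 : ℝ) (hγ : 0 < γ) (hC : 0 < C) (hv : 0 < v) (hh0 : 0 < h0)
    (x y σ H U P g w : ℝ → ℝ) (T X : ℝ)
    (hy : ∀ t, T ≤ t → HasDerivAt y (-3 * H t * y t - P t - σ t * w t) t)
    (hU : ∀ t, T ≤ t → HasDerivAt U (P t * y t) t)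
    (hg : ∀ t, T ≤ t → HasDerivAt g (w t * y t) t)
    (hσ : ∀ t, T ≤ t → HasDerivAt σ (-3 * γ * H t * σ t) t)
    (hX : 0 ≤ X)
    (hgb : ∀ t, T ≤ t → |g t| ≤ C * X)
    (hσ0 : ∀ t, T ≤ t → 0 ≤ σ t) (hH : ∀ t, T ≤ t → 0 < H t) (hHb : ∀ t, T ≤ t → H t ≤ h0)
    (hP : ∀ t, T ≤ t → v / 2 ≤ P t)
    (hy1 : ∀ t, T ≤ t → 3 * h0 * |y t| ≤ v / 8)
    (hy2 : ∀ t, T ≤ t → 3 * γ * h0 * |y t| ≤ v / 8)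
    (hUX : v / 2 * X ≤ |U T|)
    (hσs : (4 * C / γ + 4 * C) * σ T ≤ v / 4)
    (hyl : Tendsto y atTop (𝓝 0)) (hσl : Tendsto σ atTop (𝓝 0)) (hUl : Tendsto U atTop (𝓝 0))
    (hgl : Tendsto g atTop (𝓝 0)) (hyT : y T ≤ 0) : X = 0 := by
  set R : ℝ → ℝ := fun t => (y t)^2/2 + σ t * (g t - C * X) with hR
  have hRd : ∀ t, T ≤ t → HasDerivAt R
      (-(y t) * (P t + 3 * H t * y t) - 3 * γ * H t * (R t - (y t)^2/2)) t := by
    intro t h1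
    refine ((((hy t h1).pow 2).div_const 2).add ((hσ t h1).mul ((hg t h1).sub_const (C * X)))).congr_deriv ?_
    simp [hR]
    ring
  have hRle : ∀ t, T ≤ t → R t ≤ (y t)^2/2 := by
    intro t h1
    have h2 := abs_le.1 (hgb t h1)
    have h4 := hσ0 t h1
    have : σ t * (g t - C * X) ≤ 0 := mul_nonpos_of_nonneg_of_nonpos h4 (by linarith)
    simp only [hR]; linarith
  have hPy : ∀ t, T ≤ t → v / 4 ≤ P t + 3 * H t * y t := by
    intro t h1
    have a1 := hP t h1
    have a2 := hy1 t h1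
    have a3 : |3 * H t * y t| ≤ 3 * h0 * |y t| := by
      rw [abs_mul, abs_of_pos (by have := hH t h1; positivity)]
      have := hHb t h1
      gcongr
    have := abs_le.1 a3
    linarith
  have hmono : ∀ a b, T ≤ a → a ≤ b → (∀ t, a < t → t < b → y t ≤ 0) → R a ≤ R b := by
    intro a b ha hab hneg
    refine aux_mono R _ a b hab (fun t h1 _ => hRd t (ha.trans h1)) ?_
    intro t h1 h2
    have a1 := hneg t h1 h2
    have a2 := hPy t (ha.trans h1.le)
    have a3 := hRle t (ha.trans h1.le)
    have a4 := hH t (ha.trans h1.le)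
    have a5 : 0 ≤ -(y t) * (P t + 3 * H t * y t) := mul_nonneg (by linarith) (by linarith)
    have a6 : 0 ≤ 3 * γ * H t * ((y t)^2/2 - R t) := mul_nonneg (by positivity) (by linarith)
    linarith
  have hyc : ∀ t, T ≤ t → ContinuousAt y t := fun t h => (hy t h).continuousAt
  -- claim 1
  have hcl1 : ∀ s, T ≤ s → y s ≤ 0 → R s ≤ 0 := by
    intro s hs hys
    by_contra hpos
    push Not at hpos
    have hys' : y s < 0 := by
      rcases eq_or_lt_of_le hys with h | h
      · have := hRle s hs
        rw [h] at this; norm_num at this; linarith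
      · exact h
    have hall : ∀ t, s ≤ t → y t < 0 := by
      intro t ht
      by_contra hcon
      push Not at hcon
      obtain ⟨c, c1, c2, c3, c4⟩ := aux_first y s t ht
        (fun u h1 _ => hyc u (hs.trans h1)) hys' hcon
      have e1 := hmono s c hs c1.le (fun u h1 h2 => (c4 u h1.le h2).le)
      have e2 := hRle c (hs.trans c1.le)
      rw [c3] at e2; norm_num at e2; linarith
    have hlim : Tendsto (fun t => (y t)^2/2) atTop (𝓝 0) := by
      simpa using (hyl.pow 2).div_const 2
    have : R s ≤ 0 := by
      refine ge_of_tendsto hlim ?_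
      filter_upwards [eventually_ge_atTop s] with t ht
      exact (hmono s t hs ht (fun u h1 _ => (hall u h1.le).le)).trans (hRle t (hs.trans ht))
    linarith
  -- claim 2
  have hcl2 : ∀ s, T ≤ s → R s ≤ 0 := by
    intro s hs
    by_contra hpos
    push Not at hpos
    obtain ⟨c, c1, c2, c3, c4⟩ := aux_last R T s hs
      (fun u h1 _ => (hRd u h1).continuousAt) (hcl1 T le_rfl hyT) hpos
    have : R s ≤ R c := by
      refine aux_anti R _ c s c2.le (fun t h1 _ => hRd t (c1.trans h1)) ?_
      intro t h1 h2
      have b0 : T ≤ t := c1.trans h1.le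
      have b1 := c4 t h1 h2.le
      have b2 : 0 < y t := by
        by_contra hh
        have := hcl1 t b0 (not_lt.1 hh)
        linarith
      have b3 := hPy t b0
      have b4 := hy2 t b0
      rw [abs_of_pos b2] at b4
      have b5 := hH t b0
      have b6 := hHb t b0
      have b7 : 3 * γ * H t * y t ≤ 3 * γ * h0 * y t := by gcongr
      have b8 : 0 ≤ 3 * γ * H t * R t := by positivity
      have b9 : y t * (3 * γ * H t * y t) ≤ y t * (v / 8) := by
        apply mul_le_mul_of_nonneg_left _ b2.le; linarith
      have b10 : y t * (v / 4) ≤ y t * (P t + 3 * H t * y t) := by gcongr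
      have b11 : 0 < y t * v := by positivity
      linarith
    linarith
  have hy4 : ∀ s, T ≤ s → (y s)^2 ≤ 4 * C * X * σ s := by
    intro s hs
    have h1 := hcl2 s hs
    have h2 := abs_le.1 (hgb s hs)
    have h3 := hσ0 s hs
    have h4 : σ s * (C * X - g s) ≤ σ s * (2 * C * X) := by gcongr; linarith
    simp only [hR] at h1
    linarith
  have hlow := core_lower γ C hγ x y σ H U P g w T X hy hU hg hσ hgb hσ0 hH hyl hσl hUl hgl
  have hup : (y T)^2/2 + U T + σ T * g T - (4 * C / γ + C) * X * σ T ≤ 0 := by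
    have hlim : Tendsto (fun t => (y t)^2/2 + U t + σ t * g t - (4 * C / γ + C) * X * σ t) atTop (𝓝 0) := by
      have := (((hyl.pow 2).div_const 2).add hUl).add (hσl.mul hgl) |>.sub (hσl.const_mul ((4 * C / γ + C) * X))
      simpa using this
    refine ge_of_tendsto hlim ?_
    filter_upwards [eventually_ge_atTop T] with s hs
    refine aux_mono (fun t => (y t)^2/2 + U t + σ t * g t - (4 * C / γ + C) * X * σ t)
      (fun t => 3 * H t * ((4 * C * X * σ t - (y t)^2) + γ * (σ t * (C * X - g t)))) T s hs ?_ ?_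
    · intro t h1 _
      refine (((((hy t h1).pow 2).div_const 2).add (hU t h1)).add ((hσ t h1).mul (hg t h1)) |>.sub
        ((hσ t h1).const_mul ((4 * C / γ + C) * X))).congr_deriv ?_
      simp
      field_simp
      ring
    · intro t h1 _
      have h2 := abs_le.1 (hgb t h1.le)
      have h3 := hH t h1.le
      have h4 := hσ0 t h1.le
      have h5 := hy4 t h1.le
      have h6 : 0 ≤ γ * (σ t * (C * X - g t)) :=
        mul_nonneg hγ.le (mul_nonneg h4 (by linarith))
      exact mul_nonneg (by positivity) (by linarith)
  have hσT := hσ0 T le_rfl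
  have hgT := abs_le.1 (hgb T le_rfl)
  have hyT4 := hy4 T le_rfl
  have q1 : σ T * g T ≤ σ T * (C * X) := by gcongr; linarith
  have q2 : σ T * (-(C * X)) ≤ σ T * g T := by gcongr; linarith
  have q0 : 0 ≤ 4 * C / γ * X * σ T := by positivity
  have q00 : 0 ≤ C * X * σ T := by positivity
  have q3 : |U T| ≤ (4 * C / γ + 4 * C) * σ T * X := by
    rw [abs_le]
    constructor
    · nlinarith
    · nlinarith [sq_nonneg (y T)]
  have q4 : (4 * C / γ + 4 * C) * σ T * X ≤ v / 4 * X := by gcongr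
  have q5 : v * X ≤ 0 := by linarith
  have : X ≤ 0 := by
    by_contra hh
    push Not at hh
    have : 0 < v * X := by positivity
    linarith
  linarith

/-- maximum over the future -/
lemma aux_max (x : ℝ → ℝ) (T : ℝ) (hc : ∀ t, T ≤ t → ContinuousAt x t)
    (hl : Tendsto x atTop (𝓝 0)) : ∃ s, T ≤ s ∧ ∀ t, T ≤ t → |x t| ≤ |x s| := by
  by_cases h : ∀ t, T ≤ t → x t = 0
  · exact ⟨T, le_rfl, fun t ht => by rw [h t ht, h T le_rfl]⟩
  · push Not at h
    obtain ⟨t0, h0, h1⟩ := h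
    have hev : ∀ᶠ t in atTop, |x t| < |x t0| := by
      have := hl.abs
      rw [abs_zero] at this
      exact this.eventually_lt_const (abs_pos.2 h1)
    obtain ⟨T1, hT1⟩ := eventually_atTop.1 hev
    have hle : t0 ≤ max T1 t0 := le_max_right _ _
    obtain ⟨s, hs, hmax⟩ := isCompact_Icc.exists_isMaxOn (s := Icc T (max T1 t0))
      ⟨t0, h0, hle⟩ (f := fun t => |x t|)
      (fun t ht => (hc t ht.1).abs.continuousWithinAt)
    refine ⟨s, hs.1, fun t ht => ?_⟩
    by_cases h2 : t ≤ max T1 t0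
    · exact hmax ⟨ht, h2⟩
    · push Not at h2
      have a1 := hT1 t ((le_max_left _ _).trans h2.le)
      have a2 : |x t0| ≤ |x s| := hmax ⟨h0, hle⟩
      linarith

lemma core_zero (γ C v h0 : ℝ) (hγ : 0 < γ) (hC : 0 < C) (hv : 0 < v) (hh0 : 0 < h0)
    (x y σ H U P g w : ℝ → ℝ) (T : ℝ)
    (hx : ∀ t, T ≤ t → HasDerivAt x (y t) t)
    (hy : ∀ t, T ≤ t → HasDerivAt y (-3 * H t * y t - P t - σ t * w t) t)
    (hU : ∀ t, T ≤ t → HasDerivAt U (P t * y t) t)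
    (hg : ∀ t, T ≤ t → HasDerivAt g (w t * y t) t)
    (hσ : ∀ t, T ≤ t → HasDerivAt σ (-3 * γ * H t * σ t) t)
    (hgb : ∀ t, T ≤ t → |g t| ≤ C * |x t|)
    (hσ0 : ∀ t, T ≤ t → 0 ≤ σ t) (hH : ∀ t, T ≤ t → 0 < H t) (hHb : ∀ t, T ≤ t → H t ≤ h0)
    (hP : ∀ t, T ≤ t → v / 2 ≤ P t)
    (hy1 : ∀ t, T ≤ t → 3 * h0 * |y t| ≤ v / 8)
    (hy2 : ∀ t, T ≤ t → 3 * γ * h0 * |y t| ≤ v / 8)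
    (hUX : ∀ t, T ≤ t → |U t - v * x t| ≤ v / 2 * |x t|)
    (hσs : ∀ t, T ≤ t → (4 * C / γ + 4 * C) * σ t ≤ v / 4)
    (hxl : Tendsto x atTop (𝓝 0))
    (hyl : Tendsto y atTop (𝓝 0)) (hσl : Tendsto σ atTop (𝓝 0)) (hUl : Tendsto U atTop (𝓝 0))
    (hgl : Tendsto g atTop (𝓝 0)) : ∃ T', T ≤ T' ∧ ∀ t, T' ≤ t → x t = 0 := by
  by_contra hno
  push Not at hno
  have hxc : ∀ t, T ≤ t → ContinuousAt x t := fun t h => (hx t h).continuousAt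
  have hgood : ∀ s, T ≤ s → (∀ t, s ≤ t → |x t| ≤ |x s|) → 0 < y s := by
    intro s hs hm
    by_contra hys
    push Not at hys
    have := core_main γ C v h0 hγ hC hv hh0 x y σ H U P g w s (|x s|)
      (fun t h => hy t (hs.trans h)) (fun t h => hU t (hs.trans h)) (fun t h => hg t (hs.trans h))
      (fun t h => hσ t (hs.trans h)) (abs_nonneg _)
      (fun t h => (hgb t (hs.trans h)).trans (by have := hm t h; gcongr))
      (fun t h => hσ0 t (hs.trans h)) (fun t h => hH t (hs.trans h)) (fun t h => hHb t (hs.trans h))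
      (fun t h => hP t (hs.trans h)) (fun t h => hy1 t (hs.trans h)) (fun t h => hy2 t (hs.trans h))
      (by
        have h1 := hUX s hs
        have h2 : |v * x s| ≤ |U s| + |U s - v * x s| := by
          have := abs_sub_abs_le_abs_sub (v * x s) (U s)
          rw [abs_sub_comm] at this; linarith
        rw [abs_mul, abs_of_pos hv] at h2
        linarith)
      (hσs s hs) hyl hσl hUl hgl hys
    obtain ⟨t, ht, hne⟩ := hno s hs
    have h3 := hm t ht
    rw [this] at h3
    exact hne (abs_eq_zero.1 (le_antisymm h3 (abs_nonneg _)))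
  have hbad : ∀ s, T ≤ s → (∀ t, s ≤ t → |x t| ≤ |x s|) ∧ x s < 0 ∧ 0 < y s := by
    intro s hs
    obtain ⟨r, hr, hmax⟩ := aux_max x s (fun t h => hxc t (hs.trans h)) hxl
    have hyr := hgood r (hs.trans hr) (fun t ht => hmax t (hr.trans ht))
    have hd2 : HasDerivAt (fun t => (x t)^2) (2 * x r * y r) r := by
      refine ((hx r (hs.trans hr)).pow 2).congr_deriv ?_
      simp
    have hxr : x r ≠ 0 := by
      intro h
      obtain ⟨t, ht, hne⟩ := hno r (hs.trans hr)
      have := hmax t (hr.trans ht)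
      rw [h, abs_zero] at this
      exact hne (abs_eq_zero.1 (le_antisymm this (abs_nonneg _)))
    have hrs : r = s := by
      by_contra hne
      have hlt : s < r := lt_of_le_of_ne hr (Ne.symm hne)
      have hloc : IsLocalMax (fun t => (x t)^2) r := by
        filter_upwards [Ioi_mem_nhds hlt] with t ht
        exact sq_le_sq.2 (hmax t (le_of_lt ht))
      have := hloc.hasDerivAt_eq_zero hd2
      rcases mul_eq_zero.1 this with h | h
      · exact hxr (by linarith)
      · linarith
    subst hrs
    refine ⟨hmax, ?_, hyr⟩
    rcases lt_or_gt_of_ne hxr with h | h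
    · exact h
    · exfalso
      have hpos : 0 < y r := hyr
      -- x increases to the right
      have hs1 : ∀ᶠ t in 𝓝[>] r, 0 < slope x r t :=
        ((hasDerivAt_iff_tendsto_slope.1 (hx r hs)).mono_left
          (nhdsWithin_mono _ (fun t ht => ne_of_gt ht))).eventually_const_lt hpos
      obtain ⟨t, ht1, ht2⟩ := (hs1.and self_mem_nhdsWithin).exists
      have ht2' : r < t := ht2
      have : x r < x t := by
        rw [slope_def_field] at ht1
        have := (div_pos_iff_of_pos_right (sub_pos.2 ht2')).1 ht1
        linarith
      have h5 := hmax t ht2'.le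
      rw [abs_of_pos h, abs_of_pos (by linarith)] at h5
      linarith
  -- finite time contradiction
  have hyz : ∀ s, T ≤ s → v / 2 * (- x s) ≤ (y s)^2 := by
    intro s hs
    obtain ⟨b1, b2, b3⟩ := hbad s hs
    have hlow := core_lower γ C hγ x y σ H U P g w s (|x s|)
      (fun t h => hy t (hs.trans h)) (fun t h => hU t (hs.trans h)) (fun t h => hg t (hs.trans h))
      (fun t h => hσ t (hs.trans h))
      (fun t h => (hgb t (hs.trans h)).trans (by have := b1 t h; gcongr))
      (fun t h => hσ0 t (hs.trans h)) (fun t h => hH t (hs.trans h)) hyl hσl hUl hgl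
    have c1 := abs_le.1 (hUX s hs)
    have c2 := abs_le.1 (hgb s hs)
    have c3 := hσs s hs
    have c4 := hσ0 s hs
    rw [abs_of_neg b2] at c1 c2 hlow
    have c5 : σ s * g s ≤ σ s * (C * -x s) := by gcongr; linarith
    have c6 : (4 * C / γ + 4 * C) * σ s * (-x s) ≤ v / 4 * (-x s) := by
      apply mul_le_mul_of_nonneg_right c3; linarith
    have c7 : 0 ≤ 4 * C / γ * σ s * (-x s) :=
      mul_nonneg (by positivity) (by linarith)
    have c8 : 0 ≤ v * (-x s) := mul_nonneg hv.le (by linarith)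
    nlinarith
  set c := Real.sqrt (v / 2) / 2 with hc
  have hcpos : 0 < c := by positivity
  have hz : ∀ s, T ≤ s → Real.sqrt (-x s) + c * s ≤ Real.sqrt (-x T) + c * T := by
    intro s hs
    refine aux_anti (fun s => Real.sqrt (-x s) + c * s) (fun s => -y s / (2 * Real.sqrt (-x s)) + c) T s hs ?_ ?_
    · intro t h1 _
      obtain ⟨b1, b2, b3⟩ := hbad t h1
      refine (((hx t h1).neg.sqrt (by simp; linarith)).add ((hasDerivAt_id t).const_mul c)).congr_deriv ?_
      simp
    · intro t h1 _
      obtain ⟨b1, b2, b3⟩ := hbad t h1.le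
      have d1 : 0 < Real.sqrt (-x t) := Real.sqrt_pos.2 (by linarith)
      have d2 : Real.sqrt (v / 2) * Real.sqrt (-x t) ≤ y t := by
        rw [← Real.sqrt_mul (by positivity)]
        exact Real.sqrt_le_iff.2 ⟨b3.le, hyz t h1.le⟩
      have : c ≤ y t / (2 * Real.sqrt (-x t)) := by
        rw [le_div_iff₀ (by positivity), hc]; linarith
      rw [neg_div]; linarith
  have hS := hz (T + (Real.sqrt (-x T) + 1) / c) (by
    have : 0 ≤ (Real.sqrt (-x T) + 1) / c := by positivity
    linarith)
  have e1 := Real.sqrt_nonneg (-x (T + (Real.sqrt (-x T) + 1) / c))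
  have e2 : c * (T + (Real.sqrt (-x T) + 1) / c) = c * T + (Real.sqrt (-x T) + 1) := by
    field_simp
  linarith

lemma key_pos (γ h0 φ1 : ℝ) (hγ : 0 < γ) (hh0 : 0 < h0)
    (V V' W W' : ℝ → ℝ) (hV : ∀ x, HasDerivAt V (V' x) x) (hW : ∀ x, HasDerivAt W (W' x) x)
    (hVc : ContinuousAt V' φ1) (hv : 0 < V' φ1) (φ y σ H : ℝ → ℝ)
    (hφ : ∀ t, 0 ≤ t → HasDerivAt φ (y t) t)
    (hy : ∀ t, 0 ≤ t → HasDerivAt y (-3 * H t * y t - V' (φ t) - σ t * W' (φ t)) t)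
    (hσ : ∀ t, 0 ≤ t → HasDerivAt σ (-3 * γ * H t * σ t) t)
    (hσ0 : ∀ t, 0 ≤ t → 0 ≤ σ t) (hH : ∀ t, 0 ≤ t → 0 < H t) (hHb : ∀ t, 0 ≤ t → H t ≤ h0)
    (hφl : Tendsto φ atTop (𝓝 φ1))
    (hyl : Tendsto y atTop (𝓝 0)) (hσl : Tendsto σ atTop (𝓝 0)) : False := by
  set v := V' φ1 with hvdef
  set C := |W' φ1| + 1 with hC
  have hCpos : 0 < C := by positivity
  have hxl : Tendsto (fun t => φ t - φ1) atTop (𝓝 0) := by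
    simpa using hφl.sub_const φ1
  have e1 : ∀ᶠ t in atTop, |W (φ t) - W φ1| ≤ C * |φ t - φ1| := by
    have h := (hasDerivAt_iff_isLittleO.1 (hW φ1)).bound (c := 1) one_pos
    filter_upwards [hφl.eventually h] with t ht
    simp only [smul_eq_mul, Real.norm_eq_abs] at ht
    have h2 : |W (φ t) - W φ1| ≤ |W (φ t) - W φ1 - (φ t - φ1) * W' φ1| + |(φ t - φ1) * W' φ1| := by
      have := abs_add_le (W (φ t) - W φ1 - (φ t - φ1) * W' φ1) ((φ t - φ1) * W' φ1)
      simpa using this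
    rw [abs_mul] at h2
    rw [hC]; linarith
  have e2 : ∀ᶠ t in atTop, |V (φ t) - V φ1 - v * (φ t - φ1)| ≤ v / 2 * |φ t - φ1| := by
    have h := (hasDerivAt_iff_isLittleO.1 (hV φ1)).bound (c := v / 2) (by positivity)
    filter_upwards [hφl.eventually h] with t ht
    simp only [smul_eq_mul, Real.norm_eq_abs] at ht
    rw [mul_comm v]; exact ht
  have e3 : ∀ᶠ t in atTop, v / 2 ≤ V' (φ t) := by
    have := (hVc.tendsto.comp hφl).eventually_const_lt (show v / 2 < V' φ1 by rw [← hvdef]; linarith)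
    filter_upwards [this] with t ht using le_of_lt ht
  have hya : Tendsto (fun t => |y t|) atTop (𝓝 0) := by simpa using hyl.abs
  have e4 : ∀ᶠ t in atTop, 3 * h0 * |y t| ≤ v / 8 := by
    have h : Tendsto (fun t => 3 * h0 * |y t|) atTop (𝓝 0) := by simpa using hya.const_mul (3 * h0)
    exact h.eventually_le_const (by positivity)
  have e5 : ∀ᶠ t in atTop, 3 * γ * h0 * |y t| ≤ v / 8 := by
    have h : Tendsto (fun t => 3 * γ * h0 * |y t|) atTop (𝓝 0) := by
      simpa using hya.const_mul (3 * γ * h0)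
    exact h.eventually_le_const (by positivity)
  have e6 : ∀ᶠ t in atTop, (4 * C / γ + 4 * C) * σ t ≤ v / 4 := by
    have h : Tendsto (fun t => (4 * C / γ + 4 * C) * σ t) atTop (𝓝 0) := by
      simpa using hσl.const_mul (4 * C / γ + 4 * C)
    exact h.eventually_le_const (by positivity)
  obtain ⟨T, hT⟩ := eventually_atTop.1
    (e1.and (e2.and (e3.and (e4.and (e5.and (e6.and (eventually_ge_atTop (0:ℝ))))))))
  have hT0 : ∀ t, T ≤ t → 0 ≤ t := fun t h => (hT t h).2.2.2.2.2.2
  obtain ⟨T', hT', hz⟩ := core_zero γ C v h0 hγ hCpos hv hh0 (fun t => φ t - φ1) y σ H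
    (fun t => V (φ t) - V φ1) (fun t => V' (φ t)) (fun t => W (φ t) - W φ1) (fun t => W' (φ t)) T
    (fun t h => (hφ t (hT0 t h)).sub_const φ1)
    (fun t h => hy t (hT0 t h))
    (fun t h => ((hV (φ t)).comp t (hφ t (hT0 t h))).sub_const (V φ1))
    (fun t h => ((hW (φ t)).comp t (hφ t (hT0 t h))).sub_const (W φ1))
    (fun t h => hσ t (hT0 t h))
    (fun t h => (hT t h).1)
    (fun t h => hσ0 t (hT0 t h)) (fun t h => hH t (hT0 t h)) (fun t h => hHb t (hT0 t h))
    (fun t h => (hT t h).2.2.1) (fun t h => (hT t h).2.2.2.1) (fun t h => (hT t h).2.2.2.2.1)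
    (fun t h => (hT t h).2.1) (fun t h => (hT t h).2.2.2.2.2.1) hxl hyl hσl
    (by simpa using ((hV φ1).continuousAt.tendsto.comp hφl).sub_const (V φ1))
    (by simpa using ((hW φ1).continuousAt.tendsto.comp hφl).sub_const (W φ1))
  have hy0 : ∀ t, T' < t → y t = 0 := by
    intro t ht
    have h1 : φ =ᶠ[𝓝 t] fun _ => φ1 := by
      filter_upwards [Ioi_mem_nhds ht] with s hs
      have := hz s (le_of_lt hs)
      linarith
    exact (hφ t (hT0 t (hT'.trans ht.le))).unique ((hasDerivAt_const t φ1).congr_of_eventuallyEq h1)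
  have ht1 : T' < T' + 1 := by linarith
  have hTt : T ≤ T' + 1 := by linarith
  have h2 : y =ᶠ[𝓝 (T' + 1)] fun _ => 0 := by
    filter_upwards [Ioi_mem_nhds ht1] with s hs using hy0 s hs
  have h3 := (hy (T' + 1) (hT0 _ hTt)).unique ((hasDerivAt_const _ (0:ℝ)).congr_of_eventuallyEq h2)
  have h4 : φ (T' + 1) = φ1 := by
    have := hz (T' + 1) ht1.le
    linarith
  rw [hy0 _ ht1, h4, ← hvdef] at h3
  have h5 := (hT _ hTt).2.2.2.2.2.1
  have h6 := hσ0 _ (hT0 _ hTt)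
  have h7 : σ (T' + 1) * (-W' φ1) ≤ σ (T' + 1) * C := by
    gcongr; rw [hC]; have := neg_le_abs (W' φ1); linarith
  have h8 : 0 ≤ 4 * C / γ * σ (T' + 1) := by positivity
  nlinarith

lemma key (γ h0 φ1 : ℝ) (hγ : 0 < γ) (hh0 : 0 < h0)
    (V V' W W' : ℝ → ℝ) (hV : ∀ x, HasDerivAt V (V' x) x) (hW : ∀ x, HasDerivAt W (W' x) x)
    (hVc : ContinuousAt V' φ1) (hv : V' φ1 ≠ 0) (φ y σ H : ℝ → ℝ)
    (hφ : ∀ t, 0 ≤ t → HasDerivAt φ (y t) t)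
    (hy : ∀ t, 0 ≤ t → HasDerivAt y (-3 * H t * y t - V' (φ t) - σ t * W' (φ t)) t)
    (hσ : ∀ t, 0 ≤ t → HasDerivAt σ (-3 * γ * H t * σ t) t)
    (hσ0 : ∀ t, 0 ≤ t → 0 ≤ σ t) (hH : ∀ t, 0 ≤ t → 0 < H t) (hHb : ∀ t, 0 ≤ t → H t ≤ h0)
    (hφl : Tendsto φ atTop (𝓝 φ1))
    (hyl : Tendsto y atTop (𝓝 0)) (hσl : Tendsto σ atTop (𝓝 0)) : False := by
  rcases lt_or_gt_of_ne hv with h | h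
  · have hr : ∀ (F F' : ℝ → ℝ), (∀ x, HasDerivAt F (F' x) x) →
        ∀ x, HasDerivAt (fun x => F (-x)) (-F' (-x)) x := by
      intro F F' hF x
      have := (hF (-x)).comp x (hasDerivAt_neg x)
      simpa [Function.comp_def] using this
    refine key_pos γ h0 (-φ1) hγ hh0 (fun x => V (-x)) (fun x => - V' (-x)) (fun x => W (-x))
      (fun x => - W' (-x)) (hr V V' hV) (hr W W' hW) ?_ ?_ (fun t => - φ t) (fun t => - y t) σ H
      (fun t ht => (hφ t ht).neg) ?_ hσ hσ0 hH hHb hφl.neg (by simpa using hyl.neg) hσl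
    · refine ContinuousAt.neg ?_
      refine ContinuousAt.comp (g := V') (f := fun x : ℝ => -x) ?_ continuous_neg.continuousAt
      simpa using hVc
    · simpa using h
    · intro t ht
      refine (hy t ht).neg.congr_deriv ?_
      simp only [neg_neg]; ring
  · exact key_pos γ h0 φ1 hγ hh0 V V' W W' hV hW hVc h φ y σ H hφ hy hσ hσ0 hH hHb hφl hyl hσl

/-- vanishing of the velocity -/
lemma vel_zero (V φ y H q : ℝ → ℝ) (a b L h : ℝ) (hVc : Continuous V)
    (hφ : ∀ t, 0 ≤ t → HasDerivAt φ (y t) t)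
    (hφK : ∀ t, 0 ≤ t → φ t ∈ Icc a b)
    (hH : ∀ t, 0 ≤ t → HasDerivAt H (-(1/2) * (q t + (y t)^2)) t)
    (hq : ∀ t, 0 ≤ t → 0 ≤ q t)
    (hHl : Tendsto H atTop (𝓝 h))
    (he : Tendsto (fun t => (y t)^2/2 + V (φ t)) atTop (𝓝 L)) : Tendsto y atTop (𝓝 0) := by
  have huc : UniformContinuousOn V (Icc a b) :=
    isCompact_Icc.uniformContinuousOn_of_continuous hVc.continuousOn
  rw [Metric.tendsto_atTop]
  intro ε hε
  -- bounds
  obtain ⟨d, hd, hdV⟩ := Metric.uniformContinuousOn_iff.1 huc (ε^2/16) (by positivity)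
  obtain ⟨T1, hT1⟩ := Metric.tendsto_atTop.1 he (ε^2/32) (by positivity)
  obtain ⟨T2, hT2⟩ := Metric.tendsto_atTop.1 hHl (min (ε^2/16) (d^2/8)) (by positivity)
  refine ⟨max (max T1 T2) 0, fun t ht => ?_⟩
  have ht0 : 0 ≤ t := (le_max_right _ _).trans ht
  have ht1 : T1 ≤ t := ((le_max_left _ _).trans (le_max_left _ _)).trans ht
  have ht2 : T2 ≤ t := ((le_max_right _ _).trans (le_max_left _ _)).trans ht
  -- H difference
  have hHd : ∀ s, t ≤ s → H t - H s < ε^2/8 ∧ H t - H s < d^2/4 := by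
    intro s hs
    have a1 := hT2 t ht2
    have a2 := hT2 s (ht2.trans hs)
    rw [Real.dist_eq] at a1 a2
    have b1 := abs_lt.1 (a1.trans_le (min_le_left _ _))
    have b2 := abs_lt.1 (a2.trans_le (min_le_left _ _))
    have b3 := abs_lt.1 (a1.trans_le (min_le_right _ _))
    have b4 := abs_lt.1 (a2.trans_le (min_le_right _ _))
    constructor <;> linarith
  -- mean value
  obtain ⟨s, hs, hsd⟩ := exists_hasDerivAt_eq_slope H (fun t => -(1/2) * (q t + (y t)^2))
    (show t < t + 1 by linarith)
    (fun u hu => (hH u (ht0.trans hu.1)).continuousAt.continuousWithinAt)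
    (fun u hu => hH u (ht0.trans hu.1.le))
  have hs0 : 0 ≤ s := ht0.trans hs.1.le
  have hys : (y s)^2 < ε^2/4 := by
    have h1 := (hHd (t+1) (by linarith)).1
    have h2 := hq s hs0
    simp at hsd
    linarith
  -- displacement
  have hmv : ∀ sg : ℝ, sg^2 = 1 → sg * (φ s - φ t) < d := by
    intro sg hsg
    have := aux_anti (fun u => sg * φ u - d/2 * u + 2 / d * H u)
      (fun u => sg * y u - d/2 + 2/d * (-(1/2) * (q u + (y u)^2))) t s hs.1.le
      (fun u h1 _ => by
        refine ((((hφ u (ht0.trans h1)).const_mul sg).sub ((hasDerivAt_id u).const_mul (d/2))).add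
          ((hH u (ht0.trans h1)).const_mul (2/d))).congr_deriv ?_
        simp)
      (fun u h1 _ => by
        have h2 := hq u (ht0.trans h1.le)
        have h3 : sg * y u - d/2 + 2/d * (-(1/2) * (q u + (y u)^2))
            = -((y u - sg * d / 2)^2 + q u + d^2/4 * (2 - sg^2)) / d := by
          field_simp; ring
        rw [h3, hsg]
        apply div_nonpos_of_nonpos_of_nonneg _ hd.le
        nlinarith [sq_nonneg (y u - sg * d / 2), sq_nonneg d])
    have h4 := (hHd s hs.1.le).2
    have h5 : 2 / d * (H t - H s) < 2 / d * (d^2/4) := by gcongr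
    have h6 : 2 / d * (d^2/4) = d / 2 := by field_simp; norm_num
    have h7 : d/2 * (s - t) ≤ d/2 * 1 := by
      have := hs.2; gcongr; linarith
    linarith
  have hdist : dist (φ s) (φ t) < d := by
    rw [Real.dist_eq, abs_lt]
    have h1 := hmv 1 (by norm_num)
    have h2 := hmv (-1) (by norm_num)
    constructor <;> linarith
  have hVd := hdV _ (hφK s hs0) _ (hφK t ht0) hdist
  have g1 := hT1 t ht1
  have g2 := hT1 s (ht1.trans hs.1.le)
  rw [Real.dist_eq] at hVd g1 g2
  have k1 := abs_lt.1 hVd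
  have k2 := abs_lt.1 g1
  have k3 := abs_lt.1 g2
  rw [Real.dist_eq, sub_zero]
  apply abs_lt_of_sq_lt_sq _ hε.le
  nlinarith

/-- convergence of the field -/
lemma field_conv (V V' φ : ℝ → ℝ) (φs r L : ℝ) (hV : ∀ x, HasDerivAt V (V' x) x)
    (hcrit : ∀ x, x ≠ φs → |x - φs| ≤ r → V' x ≠ 0) (hL : V φs < L)
    (hφc : ∀ t, 0 ≤ t → ContinuousAt φ t)
    (hφK : ∀ t, 0 ≤ t → |φ t - φs| ≤ r)
    (hl : Tendsto (fun t => V (φ t)) atTop (𝓝 L)) :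
    ∃ φ1, V' φ1 ≠ 0 ∧ Tendsto φ atTop (𝓝 φ1) := by
  have hVc : Continuous V := continuous_iff_continuousAt.2 fun x => (hV x).continuousAt
  have hne : ∀ᶠ t in atTop, V ((V φs + L)/2) = V ((V φs + L)/2) ∧ (V φs + L)/2 < V (φ t) := by
    filter_upwards [hl.eventually_const_lt (show (V φs + L)/2 < L by linarith)] with t ht
    exact ⟨rfl, ht⟩
  obtain ⟨T, hT⟩ := eventually_atTop.1 (hne.and (eventually_ge_atTop (0:ℝ)))
  have hT0 : ∀ t, T ≤ t → 0 ≤ t := fun t h => (hT t h).2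
  have hTV : ∀ t, T ≤ t → (V φs + L)/2 < V (φ t) := fun t h => (hT t h).1.2
  have hTne : ∀ t, T ≤ t → φ t ≠ φs := by
    intro t h1 h2
    have := hTV t h1
    rw [h2] at this; linarith
  -- a compact interval on one side
  obtain ⟨a, b, hab, hK⟩ : ∃ a b : ℝ, (∀ x ∈ Icc a b, |x - φs| ≤ r ∧ (x = φs ∨ V' x ≠ 0)) ∧
      ((∀ x ∈ Ioo a b, V' x ≠ 0) ∧ ∀ t, T ≤ t → φ t ∈ Icc a b) := by
    rcases lt_or_gt_of_ne (hTne T le_rfl) with h | h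
    · refine ⟨φs - r, φs, ?_, ?_, ?_⟩
      · intro x hx
        have : |x - φs| ≤ r := abs_le.2 ⟨by linarith [hx.1], by linarith [hx.1, hx.2]⟩
        exact ⟨this, or_iff_not_imp_left.2 fun hh => hcrit x hh this⟩
      · intro x hx
        exact hcrit x (ne_of_lt hx.2) (abs_le.2 ⟨by linarith [hx.1], by linarith [hx.1, hx.2]⟩)
      · intro t ht
        have h1 := abs_le.1 (hφK t (hT0 t ht))
        refine ⟨by linarith, ?_⟩
        by_contra h2
        push Not at h2
        obtain ⟨c, c1, c2, c3, _⟩ := aux_first (fun t => φ t - φs) T t ht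
          (fun u h1 _ => (hφc u (hT0 u h1)).sub continuousAt_const) (by linarith) (by linarith)
        exact hTne c c1.le (by linarith)
    · refine ⟨φs, φs + r, ?_, ?_, ?_⟩
      · intro x hx
        have : |x - φs| ≤ r := abs_le.2 ⟨by linarith [hx.1, hx.2], by linarith [hx.1, hx.2]⟩
        exact ⟨this, or_iff_not_imp_left.2 fun hh => hcrit x hh this⟩
      · intro x hx
        exact hcrit x (ne_of_gt hx.1) (abs_le.2 ⟨by linarith [hx.1, hx.2], by linarith [hx.1, hx.2]⟩)
      · intro t ht
        have h1 := abs_le.1 (hφK t (hT0 t ht))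
        refine ⟨?_, by linarith⟩
        by_contra h2
        push Not at h2
        obtain ⟨c, c1, c2, c3, _⟩ := aux_first (fun t => φs - φ t) T t ht
          (fun u h1 _ => continuousAt_const.sub (hφc u (hT0 u h1))) (by linarith) (by linarith)
        exact hTne c c1.le (by linarith)
  obtain ⟨hK1, hK2⟩ := hK
  have hinj : ∀ x ∈ Icc a b, ∀ z ∈ Icc a b, x < z → V x ≠ V z := by
    intro x hx z hz hxz heq
    obtain ⟨c, hc, hc0⟩ := exists_hasDerivAt_eq_zero hxz hVc.continuousOn heq
      (fun u _ => hV u)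
    exact hK1 c ⟨lt_of_le_of_lt hx.1 hc.1, lt_of_lt_of_le hc.2 hz.2⟩ hc0
  have hinj' : ∀ x ∈ Icc a b, ∀ z ∈ Icc a b, V x = V z → x = z := by
    intro x hx z hz h
    rcases lt_trichotomy x z with h1 | h1 | h1
    · exact absurd h (hinj x hx z hz h1)
    · exact h1
    · exact absurd h.symm (hinj z hz x hx h1)
  have hmem : ∀ᶠ t in atTop, φ t ∈ Icc a b := by
    filter_upwards [eventually_ge_atTop T] with t ht using hK2 t ht
  have hcl : ∀ z, MapClusterPt z atTop φ → V z = L := by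
    intro z hz
    have h1 : MapClusterPt (V z) atTop (V ∘ φ) := hz.continuousAt_comp hVc.continuousAt
    have h2 : ClusterPt (V z) (𝓝 L) := ClusterPt.mono h1 hl
    exact eq_of_nhds_neBot h2
  obtain ⟨φ1, h1, h2⟩ := isCompact_Icc.exists_mapClusterPt_of_frequently (s := Icc a b) (f := φ)
    (l := atTop) hmem.frequently
  refine ⟨φ1, ?_, ?_⟩
  · have h3 := hcl φ1 h2
    rcases (hab φ1 h1).2 with h4 | h4
    · rw [h4] at h3; linarith
    · exact h4
  · refine isCompact_Icc.tendsto_nhds_of_unique_mapClusterPt hmem ?_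
    intro z hz hzc
    exact hinj' z hz φ1 h1 ((hcl z hzc).trans (hcl φ1 h2).symm)

lemma hub_limit (H : ℝ → ℝ) (hanti : ∀ a b, 0 ≤ a → a ≤ b → H b ≤ H a) (m : ℝ)
    (hm : ∀ t, 0 ≤ t → m ≤ H t) :
    ∃ h, Tendsto H atTop (𝓝 h) ∧ m ≤ h ∧ ∀ t, 0 ≤ t → h ≤ H t := by
  have hA : Antitone (fun t => H (max t 0)) := fun a b hab =>
    hanti _ _ (le_max_right _ _) (max_le_max_right 0 hab)
  have hB : BddBelow (range (fun t => H (max t 0))) :=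
    ⟨m, by rintro _ ⟨t, rfl⟩; exact hm _ (le_max_right _ _)⟩
  have h1 := tendsto_atTop_ciInf hA hB
  have h2 : Tendsto H atTop (𝓝 (⨅ t, H (max t 0))) := by
    refine h1.congr' ?_
    filter_upwards [eventually_ge_atTop (0:ℝ)] with t ht
    rw [max_eq_left ht]
  refine ⟨_, h2, le_ciInf fun t => hm _ (le_max_right _ _), fun t ht => ?_⟩
  have := ciInf_le hB t
  simpa [max_eq_left ht] using this

/-- positivity of the Hubble function on an interval where the potential is nonnegative -/
lemma hub_pos (γ : ℝ) (hγ0 : 0 < γ) (H y v ρ ρr : ℝ → ℝ) (T : ℝ) (hT : 0 ≤ T)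
    (hH : ∀ t, 0 ≤ t → HasDerivAt H (-(1/2) * (γ * ρ t + (4/3) * ρr t + (y t)^2)) t)
    (hF : ∀ t, 0 ≤ t → 3 * (H t)^2 = (1/2) * (y t)^2 + v t + ρ t + ρr t)
    (hρ : ∀ t, 0 ≤ t → 0 ≤ ρ t) (hρr : ∀ t, 0 ≤ t → 0 ≤ ρr t)
    (hanti : ∀ a b, 0 ≤ a → a ≤ b → H b ≤ H a) (hH0 : 0 < H 0)
    (hpos : ∀ t, 0 ≤ t → t < T → 0 < H t) (hv : ∀ t, 0 ≤ t → t < T → 0 ≤ v t) : 0 < H T := by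
  set M := (3 * γ + 10) * H 0 with hM
  have h := aux_mono (fun t => H t * Real.exp (M * t))
    (fun t => (-(1/2) * (γ * ρ t + (4/3) * ρr t + (y t)^2) + M * H t) * Real.exp (M * t)) 0 T hT
    (fun t h1 _ => by
      refine ((hH t h1).mul (((hasDerivAt_id t).const_mul M).exp)).congr_deriv ?_
      simp; ring)
    (fun t h1 h2 => by
      refine mul_nonneg ?_ (Real.exp_pos _).le
      have a1 := hρ t h1.le
      have a2 := hρr t h1.le
      have a3 := hF t h1.le
      have a4 := hv t h1.le h2
      have a5 := hpos t h1.le h2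
      have a6 := hanti 0 t le_rfl h1.le
      have a7 : (H t)^2 ≤ H 0 * H t := by nlinarith
      have a8 : γ * ρ t ≤ γ * (3 * (H t)^2) := by
        gcongr; nlinarith [sq_nonneg (y t)]
      have a9 : γ * (H t)^2 ≤ γ * (H 0 * H t) := by gcongr
      have a10 : (y t)^2 ≤ 6 * (H t)^2 := by linarith
      have a11 : ρr t ≤ 3 * (H t)^2 := by nlinarith [sq_nonneg (y t)]
      have a12 : 0 ≤ γ * (H 0 * H t) := by positivity
      rw [hM]
      nlinarith)
  simp only [mul_zero, Real.exp_zero, mul_one] at h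
  exact (mul_pos_iff_of_pos_right (Real.exp_pos _)).1 (lt_of_lt_of_le hH0 h)

set_option maxHeartbeats 2000000 in
/-- (Proposition 3.3) If `V ∈ C²` has bounded negativity set and finitely many critical
points, and `φ_*` is a strict local minimum of `V` with `V(φ_*) ≥ 0`, then
`p_* = (φ_*, 0, 0, 0, √(V(φ_*)/3))` is an asymptotically stable equilibrium point of the
coupled scalar field–matter–radiation system restricted to the physical set. -/
theorem stmt_3
    (χ χ' : ℝ → ℝ)
    (hχder : ∀ x, HasDerivAt χ (χ' x) x)
    (hχpos : ∀ x, 0 < χ x)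
    (γ : ℝ) (hγ0 : 0 < γ) (hγ2 : γ < 2) (hγ43 : γ ≠ 4/3)
    (V : ℝ → ℝ) (hVC2 : ContDiff ℝ 2 V)
    (hVbdd : Bornology.IsBounded {x : ℝ | V x < 0})
    (hVcrit : Set.Finite {x : ℝ | deriv V x = 0})
    (φs : ℝ)
    (hmin : ∃ r > 0, ∀ x, x ≠ φs → |x - φs| < r → V φs < V x)
    (hV0 : 0 ≤ V φs) :
    -- `p_*` is an equilibrium point: all five components of the vector field vanish there
    ((0:ℝ) = 0 ∧
     -3 * Real.sqrt (V φs / 3) * 0 - deriv V φs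
        + (1/2) * (4 - 3*γ) * 0 * (χ' φs / χ φs) = 0 ∧
     -3 * γ * Real.sqrt (V φs / 3) * 0
        - (1/2) * (4 - 3*γ) * 0 * 0 * (χ' φs / χ φs) = 0 ∧
     -4 * Real.sqrt (V φs / 3) * 0 = 0 ∧
     -(1/2) * (γ * 0 + (4/3) * 0 + (0:ℝ)^2) = 0) ∧
    -- stability and attractivity
    (∀ ε > 0, ∃ δ > 0, ∀ φ y ρ ρr H : ℝ → ℝ,
      (∀ t, 0 ≤ t → HasDerivAt φ (y t) t) →
      (∀ t, 0 ≤ t → HasDerivAt y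
        (-3 * H t * y t - deriv V (φ t)
          + (1/2) * (4 - 3*γ) * ρ t * (χ' (φ t) / χ (φ t))) t) →
      (∀ t, 0 ≤ t → HasDerivAt ρ
        (-3 * γ * H t * ρ t
          - (1/2) * (4 - 3*γ) * ρ t * y t * (χ' (φ t) / χ (φ t))) t) →
      (∀ t, 0 ≤ t → HasDerivAt ρr (-4 * H t * ρr t) t) →
      (∀ t, 0 ≤ t → HasDerivAt H
        (-(1/2) * (γ * ρ t + (4/3) * ρr t + (y t)^2)) t) →
      (∀ t, 0 ≤ t → 3 * (H t)^2 = (1/2) * (y t)^2 + V (φ t) + ρ t + ρr t) →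
      0 ≤ ρ 0 → 0 ≤ ρr 0 → 0 < H 0 →
      |φ 0 - φs| < δ → |y 0| < δ → |ρ 0| < δ → |ρr 0| < δ →
      |H 0 - Real.sqrt (V φs / 3)| < δ →
      (∀ t, 0 ≤ t →
        |φ t - φs| ≤ ε ∧ |y t| ≤ ε ∧ |ρ t| ≤ ε ∧ |ρr t| ≤ ε ∧
        |H t - Real.sqrt (V φs / 3)| ≤ ε) ∧
      Tendsto φ atTop (𝓝 φs) ∧ Tendsto y atTop (𝓝 0) ∧
      Tendsto ρ atTop (𝓝 0) ∧ Tendsto ρr atTop (𝓝 0) ∧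
      Tendsto H atTop (𝓝 (Real.sqrt (V φs / 3)))) := by
  have hVd : Differentiable ℝ V := hVC2.differentiable (by norm_num)
  have hV : ∀ x, HasDerivAt V (deriv V x) x := fun x => (hVd x).hasDerivAt
  have hVc : Continuous V := hVC2.continuous
  have hV'c : Continuous (deriv V) := hVC2.continuous_deriv (by norm_num)
  obtain ⟨r, hr, hmin⟩ := hmin
  have hcrit0 : deriv V φs = 0 := by
    have : IsLocalMin V φs := by
      filter_upwards [Metric.ball_mem_nhds φs hr] with x hx
      by_cases h : x = φs
      · rw [h]
      · exact (hmin x h (by simpa [Real.dist_eq] using hx)).le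
    exact this.deriv_eq_zero
  refine ⟨⟨rfl, by rw [hcrit0]; ring, by ring, by ring, by ring⟩, ?_⟩
  intro ε hε
  -- the radius of the well
  obtain ⟨r1, hr1, hr1r, hr1ε, hcr⟩ : ∃ r1 > 0, r1 < r ∧ r1 ≤ ε ∧
      ∀ x, x ≠ φs → |x - φs| ≤ r1 → deriv V x ≠ 0 := by
    have hfin : ({x : ℝ | deriv V x = 0} \ {φs}).Finite := hVcrit.sdiff
    have hop : ({x : ℝ | deriv V x = 0} \ {φs})ᶜ ∈ 𝓝 φs :=
      hfin.isClosed.isOpen_compl.mem_nhds (by simp)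
    obtain ⟨d, hd, hball⟩ := Metric.mem_nhds_iff.1 hop
    refine ⟨min (min (d/2) (r/2)) ε, by positivity, ?_, min_le_right _ _, ?_⟩
    · have : min (min (d/2) (r/2)) ε ≤ r/2 := (min_le_left _ _).trans (min_le_right _ _)
      linarith
    · intro x hx hxr hx0
      have h1 : |x - φs| ≤ d/2 := hxr.trans ((min_le_left _ _).trans (min_le_left _ _))
      have h2 : x ∈ Metric.ball φs d := by
        rw [Metric.mem_ball, Real.dist_eq]; linarith
      exact hball h2 ⟨hx0, hx⟩
  have hVle : ∀ x, |x - φs| ≤ r1 → V φs ≤ V x := by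
    intro x hx
    by_cases h : x = φs
    · rw [h]
    · exact (hmin x h (by linarith)).le
  set Hs := Real.sqrt (V φs / 3) with hHs
  have hHs0 : 0 ≤ Hs := Real.sqrt_nonneg _
  have hHs2 : 3 * Hs^2 = V φs := by
    rw [hHs, Real.sq_sqrt (by positivity)]; ring
  have hm1 : V φs < V (φs + r1) :=
    hmin _ (by linarith) (by rw [add_sub_cancel_left, abs_of_pos hr1]; exact hr1r)
  have hm2 : V φs < V (φs - r1) :=
    hmin _ (by linarith) (by rw [show φs - r1 - φs = -r1 by ring, abs_neg, abs_of_pos hr1]; exact hr1r)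
  set η := min (min (V (φs + r1) - V φs) (V (φs - r1) - V φs)) (min ε (ε^2/2)) with hη
  have hηpos : 0 < η := by
    have h1 : 0 < V (φs + r1) - V φs := by linarith
    have h2 : 0 < V (φs - r1) - V φs := by linarith
    positivity
  have hη1 : η ≤ V (φs + r1) - V φs := (min_le_left _ _).trans (min_le_left _ _)
  have hη2 : η ≤ V (φs - r1) - V φs := (min_le_left _ _).trans (min_le_right _ _)
  have hη3 : η ≤ ε := (min_le_right _ _).trans (min_le_left _ _)
  have hη4 : η ≤ ε^2/2 := (min_le_right _ _).trans (min_le_right _ _)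
  obtain ⟨δ0, hδ0, hδη⟩ : ∃ δ0 > 0, 3 * (Hs + δ0)^2 < V φs + η := by
    have hc : ContinuousAt (fun d : ℝ => 3 * (Hs + d)^2) 0 := by fun_prop
    have h1 : ∀ᶠ d in 𝓝 (0:ℝ), 3 * (Hs + d)^2 < V φs + η :=
      hc.tendsto.eventually_lt_const (by simp only [add_zero]; linarith)
    obtain ⟨d, hd, hball⟩ := Metric.eventually_nhds_iff.1 h1
    refine ⟨d/2, by positivity, hball ?_⟩
    rw [Real.dist_eq, sub_zero, abs_of_pos (by positivity)]; linarith
  refine ⟨min (min δ0 r1) ε, by positivity, ?_⟩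
  intro φ y ρ ρr H hφ hy hρ hρr hH hF hρ0 hρr0 hH0 iφ iy iρ iρr iH
  have iφ' : |φ 0 - φs| < r1 := iφ.trans_le ((min_le_left _ _).trans (min_le_right _ _))
  have iH1 : |H 0 - Hs| < δ0 := iH.trans_le ((min_le_left _ _).trans (min_le_left _ _))
  have iH2 : |H 0 - Hs| < ε := iH.trans_le (min_le_right _ _)
  have hE0 : 3 * (H 0)^2 < V φs + η := by
    have h1 := (abs_lt.1 iH1).2
    have h2 : H 0 ≤ Hs + δ0 := by linarith
    have h3 : (H 0)^2 ≤ (Hs + δ0)^2 := by gcongr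
    linarith
  -- antiderivative of H, explicit matter densities
  obtain ⟨K, hK0, hK⟩ := aux_antider H (fun t ht => (hH t ht).continuousAt)
  set a : ℝ := (1/2) * (4 - 3*γ) with ha
  set σ : ℝ → ℝ := fun t => ρ t * (χ (φ t)) ^ a with hσdef
  set W : ℝ → ℝ := fun x => (χ x) ^ (-a) with hWdef
  set W' : ℝ → ℝ := fun x => -a * (χ' x / χ x) * W x with hW'def
  have hWpos : ∀ x, 0 < W x := fun x => Real.rpow_pos_of_pos (hχpos x) _
  have hWd : ∀ x, HasDerivAt W (W' x) x := by
    intro x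
    refine ((hχder x).rpow_const (p := -a) (Or.inl (hχpos x).ne')).congr_deriv ?_
    rw [hW'def, hWdef]
    simp only
    rw [Real.rpow_sub_one (hχpos x).ne']
    have := (hχpos x).ne'
    field_simp
  have hWc : Continuous W := continuous_iff_continuousAt.2 fun x => (hWd x).continuousAt
  have hρσ : ∀ t, ρ t = σ t * W (φ t) := by
    intro t
    simp only [hσdef, hWdef]
    rw [mul_assoc, ← Real.rpow_add (hχpos _)]
    simp
  have hσd : ∀ t, 0 ≤ t → HasDerivAt σ (-(3 * γ) * H t * σ t) t := by
    intro t ht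
    have h1 : HasDerivAt (fun t => χ (φ t)) (χ' (φ t) * y t) t := (hχder (φ t)).comp t (hφ t ht)
    refine ((hρ t ht).mul (h1.rpow_const (p := a) (Or.inl (hχpos _).ne'))).congr_deriv ?_
    rw [Real.rpow_sub_one (hχpos _).ne']
    simp only [hσdef]
    have := (hχpos (φ t)).ne'
    field_simp
    ring
  have hσe := aux_lin H K σ (3 * γ) hK0 hK hσd
  have hρre := aux_lin H K ρr 4 hK0 hK hρr
  have hσ00 : 0 ≤ σ 0 := mul_nonneg hρ0 (Real.rpow_nonneg (hχpos _).le _)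
  have hσ0 : ∀ t, 0 ≤ t → 0 ≤ σ t := by
    intro t ht
    rw [hσe t ht]; exact mul_nonneg hσ00 (Real.exp_pos _).le
  have hρn : ∀ t, 0 ≤ t → 0 ≤ ρ t := by
    intro t ht
    rw [hρσ t]; exact mul_nonneg (hσ0 t ht) (hWpos _).le
  have hρrn : ∀ t, 0 ≤ t → 0 ≤ ρr t := by
    intro t ht
    rw [hρre t ht]; exact mul_nonneg hρr0 (Real.exp_pos _).le
  have hanti : ∀ a b, 0 ≤ a → a ≤ b → H b ≤ H a := by
    intro a b ha hab
    refine aux_anti H _ a b hab (fun t h _ => hH t (ha.trans h)) ?_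
    intro t h1 _
    have a1 := hρn t (ha.trans h1.le)
    have a2 := hρrn t (ha.trans h1.le)
    have a3 := mul_nonneg hγ0.le a1
    linarith [sq_nonneg (y t)]
  -- trapping
  have htrap : ∀ t, 0 ≤ t → 0 < H t ∧ |φ t - φs| < r1 := by
    by_contra hcon
    push Not at hcon
    obtain ⟨b, hb, hbad⟩ := hcon
    set f : ℝ → ℝ := fun t => max (- H t) (|φ t - φs| - r1) with hf
    have hfc : ∀ t, 0 ≤ t → t ≤ b → ContinuousAt f t := by
      intro t ht _
      exact (hH t ht).continuousAt.neg.max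
        (((hφ t ht).continuousAt.sub continuousAt_const).abs.sub continuousAt_const)
    have hfb : 0 ≤ f b := by
      by_cases h : 0 < H b
      · exact le_max_of_le_right (by linarith [hbad h])
      · exact le_max_of_le_left (by linarith)
    obtain ⟨c, c1, c2, c3, c4⟩ := aux_first f 0 b hb hfc
      (max_lt (by linarith) (by linarith)) hfb
    have d1 : ∀ t, 0 ≤ t → t < c → 0 < H t := by
      intro t h1 h2
      have := (max_lt_iff.1 (c4 t h1 h2)).1
      linarith
    have d2 : ∀ t, 0 ≤ t → t < c → |φ t - φs| < r1 := by
      intro t h1 h2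
      have := (max_lt_iff.1 (c4 t h1 h2)).2
      linarith
    have d3 : 0 < H c := hub_pos γ hγ0 H y (fun t => V (φ t)) ρ ρr c c1.le hH hF hρn hρrn hanti hH0
      d1 (fun t h1 h2 => hV0.trans (hVle _ (d2 t h1 h2).le))
    have d4 : |φ c - φs| = r1 := by
      have e1 : |φ c - φs| - r1 ≤ 0 := by rw [← c3]; exact le_max_right _ _
      by_contra hne
      have : f c < 0 := max_lt (by linarith) (lt_of_le_of_ne e1 (fun h => hne (by linarith)))
      linarith
    have d5 : V φs + η ≤ V (φ c) := by
      rcases (abs_eq hr1.le).1 d4 with h | h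
      · rw [show φ c = φs + r1 by linarith]; linarith
      · rw [show φ c = φs - r1 by linarith]; linarith
    have d6 := hF c c1.le
    have d7 := hρn c c1.le
    have d8 := hρrn c c1.le
    have d9 : (H c)^2 ≤ (H 0)^2 := by
      have := hanti 0 c le_rfl c1.le
      gcongr
    linarith [sq_nonneg (y c)]
  have hHpos : ∀ t, 0 ≤ t → 0 < H t := fun t ht => (htrap t ht).1
  have hφb : ∀ t, 0 ≤ t → |φ t - φs| ≤ r1 := fun t ht => (htrap t ht).2.le
  have hVφ : ∀ t, 0 ≤ t → V φs ≤ V (φ t) := fun t ht => hVle _ (hφb t ht)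
  have hHsle : ∀ t, 0 ≤ t → Hs ≤ H t := by
    intro t ht
    apply le_of_sq_le_sq _ (hHpos t ht).le
    linarith [hF t ht, hρn t ht, hρrn t ht, hVφ t ht, sq_nonneg (y t)]
  constructor
  · intro t ht
    have a1 := hF t ht
    have a2 := hρn t ht
    have a3 := hρrn t ht
    have a4 := hVφ t ht
    have a5 := hanti 0 t le_rfl ht
    have a6 := hHpos t ht
    have a7 : (H t)^2 ≤ (H 0)^2 := by gcongr
    have a8 := hHsle t ht
    refine ⟨(hφb t ht).trans hr1ε, ?_, ?_, ?_, ?_⟩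
    · apply abs_le_of_sq_le_sq _ hε.le
      linarith
    · rw [abs_of_nonneg a2]; linarith [sq_nonneg (y t)]
    · rw [abs_of_nonneg a3]; linarith [sq_nonneg (y t)]
    · rw [abs_of_nonneg (by linarith)]
      have := (abs_lt.1 iH2).2
      linarith
  -- convergence
  obtain ⟨h, hHl, hsh, hhle⟩ := hub_limit H hanti Hs hHsle
  have hEl : Tendsto (fun t => 3 * (H t)^2) atTop (𝓝 (3 * h^2)) := (hHl.pow 2).const_mul 3
  have hHseq : h = Hs := by
    by_contra hne
    have hlt : Hs < h := lt_of_le_of_ne hsh (Ne.symm hne)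
    have hhpos : 0 < h := lt_of_le_of_lt hHs0 hlt
    have hKge : ∀ t, 0 ≤ t → h * t ≤ K t := by
      intro t ht
      have := aux_mono (fun t => K t - h * t) (fun t => H t - h) 0 t ht
        (fun s h1 _ => by
          refine ((hK s h1).sub ((hasDerivAt_id s).const_mul h)).congr_deriv ?_
          simp)
        (fun s h1 _ => by linarith [hhle s h1.le])
      simp only [hK0, mul_zero, sub_zero] at this
      linarith
    have hKtop : Tendsto K atTop atTop := by
      refine tendsto_atTop_mono' atTop ?_ (tendsto_id.const_mul_atTop hhpos)
      filter_upwards [eventually_ge_atTop (0:ℝ)] with t ht using hKge t ht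
    have hexp : ∀ k : ℝ, 0 < k → Tendsto (fun t => Real.exp (-k * K t)) atTop (𝓝 0) := by
      intro k hk
      refine Real.tendsto_exp_atBot.comp ?_
      exact hKtop.const_mul_atTop_of_neg (by linarith)
    have hσl : Tendsto σ atTop (𝓝 0) := by
      have h1 : Tendsto (fun t => σ 0 * Real.exp (-(3 * γ) * K t)) atTop (𝓝 0) := by
        simpa using (hexp (3 * γ) (by positivity)).const_mul (σ 0)
      refine h1.congr' ?_
      filter_upwards [eventually_ge_atTop (0:ℝ)] with t ht using (hσe t ht).symm
    have hρrl : Tendsto ρr atTop (𝓝 0) := by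
      have h1 : Tendsto (fun t => ρr 0 * Real.exp (-4 * K t)) atTop (𝓝 0) := by
        simpa using (hexp 4 (by positivity)).const_mul (ρr 0)
      refine h1.congr' ?_
      filter_upwards [eventually_ge_atTop (0:ℝ)] with t ht using (hρre t ht).symm
    have hφI : ∀ t, 0 ≤ t → φ t ∈ Icc (φs - r1) (φs + r1) := by
      intro t ht
      have := abs_le.1 (hφb t ht)
      exact ⟨by linarith, by linarith⟩
    have hρl : Tendsto ρ atTop (𝓝 0) := by
      obtain ⟨M, hM⟩ := (isCompact_Icc (a := φs - r1) (b := φs + r1)).exists_bound_of_continuousOn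
        hWc.continuousOn
      have h1 : Tendsto (fun t => σ t * M) atTop (𝓝 0) := by simpa using hσl.mul_const M
      refine tendsto_of_tendsto_of_tendsto_of_le_of_le' tendsto_const_nhds h1 ?_ ?_
      · filter_upwards [eventually_ge_atTop (0:ℝ)] with t ht using hρn t ht
      · filter_upwards [eventually_ge_atTop (0:ℝ)] with t ht
        rw [hρσ t]
        have := (le_abs_self _).trans (hM _ (hφI t ht))
        exact mul_le_mul_of_nonneg_left this (hσ0 t ht)
    have hel : Tendsto (fun t => (y t)^2/2 + V (φ t)) atTop (𝓝 (3 * h^2)) := by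
      have h1 : Tendsto (fun t => 3 * (H t)^2 - ρ t - ρr t) atTop (𝓝 (3 * h^2)) := by
        simpa using (hEl.sub hρl).sub hρrl
      refine h1.congr' ?_
      filter_upwards [eventually_ge_atTop (0:ℝ)] with t ht
      rw [hF t ht]; ring
    have hyl : Tendsto y atTop (𝓝 0) :=
      vel_zero V φ y H (fun t => γ * ρ t + (4/3) * ρr t) _ _ _ h hVc hφ hφI hH
        (fun t ht => by have := hρn t ht; have := hρrn t ht; positivity) hHl hel
    have hVl : Tendsto (fun t => V (φ t)) atTop (𝓝 (3 * h^2)) := by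
      have := hel.sub ((hyl.pow 2).div_const 2)
      simpa using this
    obtain ⟨φ1, hv1, hφl⟩ := field_conv V (deriv V) φ φs r1 (3 * h^2) hV hcr
      (by rw [← hHs2]; gcongr) (fun t ht => (hφ t ht).continuousAt) hφb hVl
    refine key γ (H 0) φ1 hγ0 hH0 V (deriv V) W W' hV hWd hV'c.continuousAt hv1 φ y σ H hφ ?_ ?_
      hσ0 hHpos (fun t ht => hanti 0 t le_rfl ht) hφl hyl hσl
    · intro t ht
      refine (hy t ht).congr_deriv ?_
      rw [hρσ t, hW'def]; simp only; ring
    · intro t ht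
      refine (hσd t ht).congr_deriv ?_
      ring
  rw [hHseq] at hHl hEl
  rw [hHs2] at hEl
  have hsq : ∀ f : ℝ → ℝ, (∀ t, 0 ≤ t → 0 ≤ f t) → (∀ t, 0 ≤ t → f t ≤ 3 * (H t)^2 - V φs) →
      Tendsto f atTop (𝓝 0) := by
    intro f h1 h2
    have h3 : Tendsto (fun t => 3 * (H t)^2 - V φs) atTop (𝓝 0) := by
      simpa using hEl.sub_const (V φs)
    refine tendsto_of_tendsto_of_tendsto_of_le_of_le' tendsto_const_nhds h3 ?_ ?_
    · filter_upwards [eventually_ge_atTop (0:ℝ)] with t ht using h1 t ht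
    · filter_upwards [eventually_ge_atTop (0:ℝ)] with t ht using h2 t ht
  refine ⟨?_, ?_, ?_, ?_, hHl⟩
  · have hVl : Tendsto (fun t => V (φ t) - V φs) atTop (𝓝 0) := by
      apply hsq
      · intro t ht; linarith [hVφ t ht]
      · intro t ht; linarith [hF t ht, hρn t ht, hρrn t ht, sq_nonneg (y t)]
    refine (isCompact_Icc (a := φs - r1) (b := φs + r1)).tendsto_nhds_of_unique_mapClusterPt ?_ ?_
    · filter_upwards [eventually_ge_atTop (0:ℝ)] with t ht
      have := abs_le.1 (hφb t ht)
      exact ⟨by linarith, by linarith⟩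
    · intro z hz hzc
      have h1 : MapClusterPt (V z - V φs) atTop ((fun x => V x - V φs) ∘ φ) :=
        hzc.continuousAt_comp (f := fun x => V x - V φs) (by fun_prop)
      have h2 : ClusterPt (V z - V φs) (𝓝 0) := ClusterPt.mono h1 hVl
      have h3 : V z - V φs = 0 := eq_of_nhds_neBot h2
      by_contra hne
      have := hmin z hne (lt_of_le_of_lt (abs_le.2 ⟨by linarith [hz.1], by linarith [hz.2]⟩) hr1r)
      linarith
  · have h1 : Tendsto (fun t => (y t)^2/2) atTop (𝓝 0) := by
      apply hsq
      · intro t ht; positivity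
      · intro t ht; linarith [hF t ht, hρn t ht, hρrn t ht, hVφ t ht]
    have h2 : Tendsto (fun t => Real.sqrt (2 * ((y t)^2/2))) atTop (𝓝 0) := by
      have := (h1.const_mul 2).sqrt
      simpa using this
    rw [tendsto_zero_iff_abs_tendsto_zero]
    refine h2.congr fun t => ?_
    rw [mul_div_cancel₀ _ (two_ne_zero), Real.sqrt_sq_eq_abs]
    rfl
  · apply hsq ρ hρn
    intro t ht; linarith [hF t ht, hρn t ht, hρrn t ht, hVφ t ht, sq_nonneg (y t)]
  · apply hsq ρr hρrn
    intro t ht; linarith [hF t ht, hρn t ht, hρrn t ht, hVφ t ht, sq_nonneg (y t)]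
end

section
/- (Theorem 3.6) Assume χ and V are positive C^3 functions on ℝ, χ has at most a finite number of stationary points and is bounded away from zero on every compact subset of ℝ, and γ ∈ (0, 4/3) ∪ (4/3, 2). For p ∈ Σ_+, let σ_p denote the maximal solution of the Hubble-normalized system with σ_p(0) = p, defined on its maximal interval of existence (a_p, b_p) ∋ 0. Then the set of points p ∈ Σ_+ for which the first component τ ↦ σ_1(τ) of σ_p is bounded on (a_p, 0] has four-dimensional Hausdorff measure zero in ℝ^5; i.e., for almost all p ∈ Σ_+, the scalar field σ_1 is unbounded on the past orbit of p. -/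
open Set MeasureTheory

/-- The vector field of the Hubble-normalized system on
`(σ₁, σ₂, σ₃, σ₄, σ₅) ∈ ℝ⁵`, viewed as `EuclideanSpace ℝ (Fin 5)`. -/
noncomputable def hubbleField (γ : ℝ) (V χ : ℝ → ℝ)
    (x : EuclideanSpace ℝ (Fin 5)) : EuclideanSpace ℝ (Fin 5) :=
  (WithLp.equiv 2 (Fin 5 → ℝ)).symm
    ![Real.sqrt (2/3) * x 1,
      (x 1)^3 + (1/6) * (3*γ*(x 2)^2 + 4*(x 4)^2 - 6) * x 1
        - ((x 3)^2 / Real.sqrt 6) * (deriv V (x 0) / V (x 0))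
        + ((4 - 3*γ) * (x 2)^2 / (2 * Real.sqrt 6)) * (deriv χ (x 0) / χ (x 0)),
      (1/6) * x 2 * (6*(x 1)^2 + 3*γ*((x 2)^2 - 1) + 4*(x 4)^2)
        - ((4 - 3*γ) * x 1 * x 2 / (2 * Real.sqrt 6)) * (deriv χ (x 0) / χ (x 0)),
      (1/6) * x 3 * (6*(x 1)^2 + 3*γ*(x 2)^2 + 4*(x 4)^2)
        + (Real.sqrt 6 / 6) * x 1 * x 3 * (deriv V (x 0) / V (x 0)),
      (1/6) * x 4 * (6*(x 1)^2 + 3*γ*(x 2)^2 + 4*(x 4)^2 - 4)]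

namespace Hub

open Filter Topology

/-- Five dimensional Euclidean space. -/
abbrev E5 := EuclideanSpace ℝ (Fin 5)

/-- Logarithmic derivative. -/
noncomputable def ld (f : ℝ → ℝ) (x : ℝ) : ℝ := deriv f x / f x

/-- `1/√6`. -/
noncomputable def r6 : ℝ := 1 / Real.sqrt 6

lemma r6_pos : 0 < r6 := by unfold r6; positivity

lemma sqrt23 : Real.sqrt (2/3) = 2 * r6 := by
  unfold r6
  rw [Real.sqrt_eq_iff_mul_self_eq (by norm_num) (by positivity)]
  have h : Real.sqrt 6 * Real.sqrt 6 = 6 := Real.mul_self_sqrt (by norm_num)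
  field_simp
  nlinarith

lemma sqrt66 : Real.sqrt 6 / 6 = r6 := by
  unfold r6
  have h : Real.sqrt 6 * Real.sqrt 6 = 6 := Real.mul_self_sqrt (by norm_num)
  field_simp
  nlinarith

variable (γ : ℝ) (V χ : ℝ → ℝ)

lemma G0 (x : E5) : hubbleField γ V χ x 0 = 2 * r6 * x 1 := by
  simp [hubbleField, ← sqrt23]

lemma G1 (x : E5) : hubbleField γ V χ x 1 =
    (x 1)^3 + (1/6) * (3*γ*(x 2)^2 + 4*(x 4)^2 - 6) * x 1
        - r6 * (x 3)^2 * ld V (x 0) + (4 - 3*γ) / 2 * r6 * (x 2)^2 * ld χ (x 0) := by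
  simp [hubbleField, ld, r6]; ring

lemma G2 (x : E5) : hubbleField γ V χ x 2 =
    (1/6) * x 2 * (6*(x 1)^2 + 3*γ*((x 2)^2 - 1) + 4*(x 4)^2)
        - (4 - 3*γ) / 2 * r6 * x 1 * x 2 * ld χ (x 0) := by
  have : hubbleField γ V χ x 2 = (1/6) * x 2 * (6*(x 1)^2 + 3*γ*((x 2)^2 - 1) + 4*(x 4)^2)
        - ((4 - 3*γ) * x 1 * x 2 / (2 * Real.sqrt 6)) * (deriv χ (x 0) / χ (x 0)) := rfl
  rw [this]
  unfold ld r6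
  ring

lemma G3 (x : E5) : hubbleField γ V χ x 3 =
    (1/6) * x 3 * (6*(x 1)^2 + 3*γ*(x 2)^2 + 4*(x 4)^2) + r6 * x 1 * x 3 * ld V (x 0) := by
  rw [← sqrt66]
  simp [hubbleField, ld]

lemma G4 (x : E5) : hubbleField γ V χ x 4 =
    (1/6) * x 4 * (6*(x 1)^2 + 3*γ*(x 2)^2 + 4*(x 4)^2 - 4) := by
  simp [hubbleField]

variable {γ V χ}

lemma ld_contDiff {f : ℝ → ℝ} (hf : ContDiff ℝ 3 f) (h : ∀ x, 0 < f x) : ContDiff ℝ 2 (ld f) := by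
  have h3 : ContDiff ℝ (2 + 1) f := by simpa [show (2:WithTop ℕ∞) + 1 = 3 by norm_num] using hf
  have := (contDiff_succ_iff_deriv.1 h3).2.2
  exact this.div (hf.of_le (by norm_num)) (fun x => (h x).ne')

lemma G_contDiff (hV : ContDiff ℝ 3 V) (hχ : ContDiff ℝ 3 χ)
    (hVpos : ∀ x, 0 < V x) (hχpos : ∀ x, 0 < χ x) : ContDiff ℝ 1 (hubbleField γ V χ) := by
  rw [contDiff_euclidean]
  have hv := (ld_contDiff hV hVpos).of_le (show (1:WithTop ℕ∞) ≤ 2 by norm_num)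
  have hh := (ld_contDiff hχ hχpos).of_le (show (1:WithTop ℕ∞) ≤ 2 by norm_num)
  have hc : ∀ i : Fin 5, ContDiff ℝ 1 (fun x : E5 => x i) := fun i => by fun_prop
  have hv' : ContDiff ℝ 1 (fun x : E5 => ld V (x 0)) := hv.comp (hc 0)
  have hh' : ContDiff ℝ 1 (fun x : E5 => ld χ (x 0)) := hh.comp (hc 0)
  intro i
  fin_cases i
  · change ContDiff ℝ 1 (fun x => hubbleField γ V χ x 0)
    simp only [G0]
    fun_prop
  · change ContDiff ℝ 1 (fun x => hubbleField γ V χ x 1)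
    simp only [G1]
    fun_prop
  · change ContDiff ℝ 1 (fun x => hubbleField γ V χ x 2)
    simp only [G2]
    fun_prop
  · change ContDiff ℝ 1 (fun x => hubbleField γ V χ x 3)
    simp only [G3]
    fun_prop
  · change ContDiff ℝ 1 (fun x => hubbleField γ V χ x 4)
    simp only [G4]
    fun_prop

/-- Linear scalar ODE. -/
lemma lin_ode {f g : ℝ → ℝ} (hg : Continuous g) (hf : ∀ t, HasDerivAt f (g t * f t) t) (t : ℝ) :
    f t = f 0 * Real.exp (∫ s in (0:ℝ)..t, g s) := by
  have hI : ∀ t, HasDerivAt (fun t => ∫ s in (0:ℝ)..t, g s) (g t) t := fun t =>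
    intervalIntegral.integral_hasDerivAt_right (hg.intervalIntegrable _ _)
      (hg.stronglyMeasurableAtFilter _ _) hg.continuousAt
  have hd : ∀ t, HasDerivAt (fun t => f t * Real.exp (-∫ s in (0:ℝ)..t, g s)) 0 t := fun t => by
    have := (hf t).mul ((hI t).neg.exp)
    refine this.congr_deriv ?_
    ring
  have hc := is_const_of_deriv_eq_zero (fun t => (hd t).differentiableAt) (fun t => (hd t).deriv) t 0
  simp only [intervalIntegral.integral_same, neg_zero, Real.exp_zero, mul_one] at hc
  rw [← hc, mul_assoc, ← Real.exp_add]; simp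

lemma integral_curve_glue {g : E5 → E5} (hg : ContDiff ℝ 1 g) (p : E5)
    (h : ∀ T : ℝ, ∃ σ : ℝ → E5, σ 0 = p ∧ ∀ t ∈ Ioo (-T) T, HasDerivAt σ (g (σ t)) t) :
    ∃ σ : ℝ → E5, σ 0 = p ∧ ∀ t, HasDerivAt σ (g (σ t)) t := by
  have hv : ContMDiff (modelWithCornersSelf ℝ E5) (modelWithCornersSelf ℝ E5).tangent 1
      (fun x ↦ (⟨x, g x⟩ : TangentBundle (modelWithCornersSelf ℝ E5) E5)) :=
    contMDiff_vectorSpace_iff_contDiff.2 hg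
  obtain ⟨σ, h0, hσ⟩ := (exists_isMIntegralCurve_iff_exists_isMIntegralCurveOn_Ioo hv p).2 (by
    intro T
    obtain ⟨σ, h0, hσ⟩ := h T
    refine ⟨σ, h0, fun t ht => ?_⟩
    exact (hasMFDerivWithinAt_iff_hasFDerivWithinAt.2
      (hσ t ht).hasFDerivAt.hasFDerivWithinAt))
  refine ⟨σ, h0, fun t => ?_⟩
  have h1 : HasFDerivAt σ ((1 : ℝ →L[ℝ] ℝ).smulRight (g (σ t))) t :=
    hasMFDerivAt_iff_hasFDerivAt.1 (hσ t)
  simpa using h1.hasDerivAt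

lemma exists_of_compactSupport {g : E5 → E5} (hg : ContDiff ℝ 1 g) (hs : HasCompactSupport g)
    (p : E5) : ∃ σ : ℝ → E5, σ 0 = p ∧ ∀ t, HasDerivAt σ (g (σ t)) t := by
  apply integral_curve_glue hg
  intro T
  by_cases hT : 0 < T
  swap
  · exact ⟨fun _ => p, rfl, fun t ht => by exfalso; linarith [ht.1, ht.2]⟩
  obtain ⟨K, hK⟩ := hg.lipschitzWith_of_hasCompactSupport hs one_ne_zero
  obtain ⟨L, hL⟩ := hs.exists_bound_of_continuous hg.continuous
  have hL0 : 0 ≤ L := (norm_nonneg _).trans (hL p)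
  have hpl : IsPicardLindelof (fun _ ↦ g) (tmin := -T) (tmax := T) ⟨0, by constructor <;> linarith⟩
      p ⟨L * T, by positivity⟩ 0 ⟨L, hL0⟩ K := by
    apply IsPicardLindelof.of_time_independent (fun x _ => hL x) hK.lipschitzOnWith
    simp
    exact le_refl (L * T)
  obtain ⟨σ, h0, hσ⟩ := hpl.exists_eq_forall_mem_Icc_hasDerivWithinAt₀
  exact ⟨σ, h0, fun t ht => (hσ t (Ioo_subset_Icc_self ht)).hasDerivAt (Icc_mem_nhds ht.1 ht.2)⟩

/-- Squared norm of the last four components. -/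
def ss (x : E5) : ℝ := x 1^2 + x 2^2 + x 3^2 + x 4^2

lemma hasDerivAt_coord {σ : ℝ → E5} {w : E5} {t : ℝ} (h : HasDerivAt σ w t) (i : Fin 5) :
    HasDerivAt (fun t => σ t i) (w i) t := by
  exact hasDerivAt_pi.1 ((PiLp.hasStrictFDerivAt_ofLp (𝕜 := ℝ) 2 (σ t)).hasFDerivAt.comp_hasDerivAt t h) i

lemma exists_global (hV : ContDiff ℝ 3 V) (hχ : ContDiff ℝ 3 χ)
    (hVpos : ∀ x, 0 < V x) (hχpos : ∀ x, 0 < χ x) (p : E5) (hp : ss p = 1) :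
    ∃ σ : ℝ → E5, σ 0 = p ∧ ∀ t, HasDerivAt σ (hubbleField γ V χ (σ t)) t := by
  have hG := G_contDiff (γ := γ) hV hχ hVpos hχpos
  apply integral_curve_glue hG
  intro T
  by_cases hT : 0 < T
  swap
  · exact ⟨fun _ => p, rfl, fun t ht => by exfalso; linarith [ht.1, ht.2]⟩
  set R : ℝ := |p 0| + 2 * r6 * T + 2 with hR
  have hr6 := r6_pos
  have hRpos : 0 < R := by positivity
  let ρ : ContDiffBump (0 : E5) := ⟨R, R + 1, hRpos, by linarith⟩
  have hρ : ContDiff ℝ 1 ρ := ρ.contDiff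
  obtain ⟨σ, h0, hσ⟩ := exists_of_compactSupport (g := fun x => ρ x • hubbleField γ V χ x)
    (hρ.smul hG) ρ.hasCompactSupport.smul_right p
  have hσc : Continuous σ := continuous_iff_continuousAt.2 fun t => (hσ t).continuousAt
  have hcoord : ∀ i : Fin 5, Continuous fun t => σ t i := fun i => by fun_prop
  have hρc : Continuous fun t => ρ (σ t) := hρ.continuous.comp hσc
  have hss : ∀ t, ss (σ t) = 1 := by
    have hd : ∀ t, HasDerivAt (fun t => ss (σ t) - 1)
        ((ρ (σ t) * ((6*(σ t 1)^2 + 3*γ*(σ t 2)^2 + 4*(σ t 4)^2) / 3)) * (ss (σ t) - 1)) t := by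
      intro t
      have h1 := hasDerivAt_coord (hσ t) 1
      have h2 := hasDerivAt_coord (hσ t) 2
      have h3 := hasDerivAt_coord (hσ t) 3
      have h4 := hasDerivAt_coord (hσ t) 4
      have := ((((h1.pow 2).add (h2.pow 2)).add (h3.pow 2)).add (h4.pow 2)).sub_const 1
      refine this.congr_deriv ?_
      simp only [PiLp.smul_apply, smul_eq_mul, G1, G2, G3, G4, ss]
      push_cast
      ring
    intro t
    have := lin_ode (by fun_prop) hd t
    rw [h0, hp] at this
    linarith
  have hy : ∀ t, |σ t 1| ≤ 1 := fun t => by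
    rw [← sq_le_one_iff_abs_le_one]
    have := hss t
    unfold ss at this
    nlinarith [sq_nonneg (σ t 2), sq_nonneg (σ t 3), sq_nonneg (σ t 4)]
  have hφ : ∀ t, |σ t 0 - p 0| ≤ 2 * r6 * |t| := by
    intro t
    have := (convex_univ (𝕜 := ℝ) (E := ℝ)).norm_image_sub_le_of_norm_hasDerivWithin_le (C := 2 * r6)
      (f := fun t => σ t 0) (f' := fun t => (ρ (σ t) • hubbleField γ V χ (σ t)) 0)
      (fun t _ => (hasDerivAt_coord (hσ t) 0).hasDerivWithinAt) (fun t _ => ?_)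
      (mem_univ 0) (mem_univ t)
    · simpa [h0] using this
    · simp only [PiLp.smul_apply, smul_eq_mul, G0, Real.norm_eq_abs, abs_mul]
      have a1 : |ρ (σ t)| ≤ 1 := by rw [abs_of_nonneg ρ.nonneg]; exact ρ.le_one
      have a2 : |r6| = r6 := abs_of_pos hr6
      rw [a2, abs_two]
      have := mul_le_mul a1 (hy t) (abs_nonneg _) zero_le_one
      nlinarith
  refine ⟨σ, h0, fun t ht => ?_⟩
  have hmem : σ t ∈ Metric.closedBall (0:E5) ρ.rIn := by
    rw [mem_closedBall_zero_iff, EuclideanSpace.norm_eq, Fin.sum_univ_five]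
    change _ ≤ R
    rw [Real.sqrt_le_left hRpos.le]
    simp only [Real.norm_eq_abs, sq_abs]
    have h1 := hss t
    unfold ss at h1
    have h2 : |σ t 0| ≤ |p 0| + 2 * r6 * T := by
      have := abs_sub_abs_le_abs_sub (σ t 0) (p 0)
      have := hφ t
      have h3 : |t| ≤ T := (abs_lt.2 ht).le
      have : 2 * r6 * |t| ≤ 2 * r6 * T := by gcongr
      linarith
    have h3 : (σ t 0)^2 ≤ (R - 2)^2 := by
      rw [← sq_abs]
      exact pow_le_pow_left₀ (abs_nonneg _) (by linarith) 2
    have : 0 ≤ R - 2 := le_trans (abs_nonneg _) (h2.trans (by linarith))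
    nlinarith
  have := hσ t
  rwa [ρ.one_of_mem_closedBall hmem, one_smul] at this

end Hub

namespace Hub

open Filter Topology

lemma null_of_antilip {S : Set E5} (g : E5 → Fin 3 → ℝ) (K : ℝ)
    (h : ∀ p ∈ S, ∀ q ∈ S, dist p q ≤ K * dist (g p) (g q)) : μH[4] S = 0 := by
  classical
  let f := Function.invFunOn g S
  have hf : ∀ y ∈ g '' S, f y ∈ S ∧ g (f y) = y := fun y hy =>
    ⟨Function.invFunOn_mem hy, Function.invFunOn_eq hy⟩
  have hl : LipschitzOnWith (Real.toNNReal K) f (g '' S) := by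
    apply LipschitzOnWith.of_dist_le_mul
    intro a ha b hb
    have := h _ (hf a ha).1 _ (hf b hb).1
    rw [(hf a ha).2, (hf b hb).2] at this
    refine this.trans ?_
    gcongr
    exact Real.le_coe_toNNReal K
  have hsub : S ⊆ f '' (g '' S) := by
    intro p hp
    refine ⟨g p, ⟨p, hp, rfl⟩, ?_⟩
    have h1 := hf (g p) ⟨p, hp, rfl⟩
    have h2 := h _ h1.1 _ hp
    rw [h1.2, dist_self, mul_zero] at h2
    exact dist_le_zero.1 h2
  have hz : μH[4] (g '' S) = 0 := by
    apply bot_unique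
    have h0 : μH[((4:NNReal):ℝ)] (univ : Set (Fin 3 → ℝ)) = 0 := by
      apply hausdorffMeasure_of_dimH_lt
      rw [Real.dimH_univ_pi_fin]
      norm_cast
    have h4 : ((4:NNReal):ℝ) = 4 := by norm_num
    rw [h4] at h0
    rw [bot_eq_zero, ← h0]
    exact measure_mono (subset_univ _)
  have := hl.hausdorffMeasure_image_le (d := 4) (by norm_num)
  rw [hz, mul_zero] at this
  exact measure_mono_null hsub (bot_unique this)

lemma exists_form_one (d n : ℝ) (hd : 0 < d) : ∃ p r s μ ε : ℝ, 0 < p ∧ 0 < μ ∧ 0 < ε ∧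
    ∀ x y : ℝ, 2*μ*(p*y^2 + 2*r*x*y + s*x^2) + ε*(x^2+y^2) ≤
      2*p*y*(d*y+n*x) + 2*r*(-y*y + x*(d*y+n*x)) + 2*s*x*(-y) := by
  rcases le_or_gt n 0 with hn | hn
  · obtain ⟨α, hα0, hα⟩ : ∃ α : ℝ, α ≤ 0 ∧ α * (d - α) = n := by
      have h1 : 0 ≤ d^2 - 4*n := by nlinarith
      have h2 := Real.sq_sqrt h1
      refine ⟨(d - Real.sqrt (d^2-4*n))/2, ?_, by nlinarith⟩
      have : d ≤ Real.sqrt (d^2-4*n) := Real.le_sqrt_of_sq_le (by linarith)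
      linarith
    set κ := min 1 (d^2/4) with hκ
    have hκ0 : 0 < κ := by positivity
    have hκ1 : κ ≤ 1 := min_le_left _ _
    have hκ2 : κ ≤ d^2/4 := min_le_right _ _
    refine ⟨1, α, α^2 - d^2/4, d/2, (d/2) * κ / (3 + 2*α^2), one_pos, by linarith, by positivity, ?_⟩
    intro x y
    have h1 : (d/2) * κ / (3 + 2*α^2) * (x^2+y^2) ≤ (d/2) * ((y+α*x)^2 + d^2/4*x^2) := by
      rw [div_mul_eq_mul_div, div_le_iff₀ (by positivity)]
      have h3 : x^2+y^2 ≤ (3+2*α^2) * ((y+α*x)^2 + x^2) := by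
        nlinarith [sq_nonneg (y + 2*α*x), sq_nonneg (y+α*x), sq_nonneg x, mul_nonneg (sq_nonneg α) (sq_nonneg (y+α*x)), mul_nonneg (sq_nonneg α) (sq_nonneg x)]
      have h4 : κ * ((y+α*x)^2 + x^2) ≤ (y+α*x)^2 + d^2/4*x^2 := by
        nlinarith [sq_nonneg (y+α*x), sq_nonneg x]
      calc d/2*κ*(x^2+y^2) ≤ d/2*κ*((3+2*α^2) * ((y+α*x)^2 + x^2)) := by gcongr
        _ = d/2*(3+2*α^2) * (κ * ((y+α*x)^2 + x^2)) := by ring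
        _ ≤ d/2*(3+2*α^2) * ((y+α*x)^2 + d^2/4*x^2) := by gcongr
        _ = _ := by ring
    have h2 : 0 ≤ (-2*α) * ((y+α*x)^2 + d^2/4*x^2) := by
      apply mul_nonneg (by linarith); positivity
    have h5 : 0 ≤ (d/2) * ((y+α*x) + d/2*x)^2 := by positivity
    subst hα
    nlinarith
  · set e := min (d/2) (n/(2*d)) with he
    have he0 : 0 < e := by positivity
    have he1 : e ≤ d/2 := min_le_left _ _
    have he2 : e ≤ n/(2*d) := min_le_right _ _
    have he3 : 2*d*e ≤ n := by
      rw [le_div_iff₀ (by positivity)] at he2; linarith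
    set δ := min (d/2) (e*n) with hδ
    have hδ0 : 0 < δ := by positivity
    have hδ1 : δ ≤ d/2 := min_le_left _ _
    have hδ2 : δ ≤ e*n := min_le_right _ _
    refine ⟨1, e, n, δ/4/(n+1+e), δ/2, one_pos, by positivity, by positivity, ?_⟩
    intro x y
    have h1 : 2*(δ/4/(n+1+e)) * (1*y^2+2*e*x*y+n*x^2) ≤ δ/2 * (x^2+y^2) := by
      have : 1*y^2+2*e*x*y+n*x^2 ≤ (n+1+e) * (x^2+y^2) := by
        nlinarith [mul_nonneg he0.le (sq_nonneg (x-y)), sq_nonneg x, sq_nonneg y]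
      calc _ ≤ 2*(δ/4/(n+1+e)) * ((n+1+e) * (x^2+y^2)) := by gcongr
        _ = _ := by field_simp; ring
    have h2 : δ * (x^2+y^2) ≤ d/2*y^2 + e*n*x^2 := by nlinarith [sq_nonneg x, sq_nonneg y]
    have h3 : 0 ≤ 2*e*d*x*y + e*n*x^2 + d/2*y^2 := by
      have h4 : 0 ≤ e * (n * x^2 - 2*d*e*x^2) := by
        apply mul_nonneg he0.le; nlinarith [sq_nonneg x]
      nlinarith [mul_nonneg hd.le (sq_nonneg (2*e*x + y))]
    nlinarith [sq_nonneg y]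

lemma exists_form (k d m : ℝ) (hk : 0 < k) (hd : 0 < d) : ∃ p r s μ ε : ℝ, 0 < p ∧ 0 < μ ∧ 0 < ε ∧
    ∀ x y : ℝ, 2*μ*(p*y^2 + 2*r*x*y + s*x^2) + ε*(x^2+y^2) ≤
      2*p*y*(d*y+m*x) + 2*r*(-(k*y)*y + x*(d*y+m*x)) + 2*s*x*(-(k*y)) := by
  obtain ⟨p, r, s, μ, ε, hp, hμ, hε, H⟩ := exists_form_one d (k*m) hd
  have hκ0 : 0 < min 1 (k^2) := by positivity
  refine ⟨p*k^2, r*k, s, μ, ε * min 1 (k^2), by positivity, hμ, by positivity, fun x y => ?_⟩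
  have h := H x (k*y)
  have h1 : min 1 (k^2) * (x^2+y^2) ≤ x^2 + (k*y)^2 := by
    nlinarith [min_le_left 1 (k^2), min_le_right 1 (k^2), sq_nonneg x, sq_nonneg y]
  have h2 := mul_le_mul_of_nonneg_left h1 hε.le
  nlinarith

lemma antitone_past {f f' : ℝ → ℝ} {T : ℝ} (hf : ∀ t ≤ T, HasDerivAt f (f' t) t)
    (h : ∀ t ≤ T, f' t ≤ 0) : AntitoneOn f (Iic T) := by
  apply antitoneOn_of_deriv_nonpos (convex_Iic T)
  · exact fun t ht => (hf t ht).continuousAt.continuousWithinAt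
  · intro t ht
    rw [interior_Iic] at ht
    exact (hf t (le_of_lt ht)).differentiableAt.differentiableWithinAt
  · intro t ht
    rw [interior_Iic] at ht
    rw [(hf t (le_of_lt ht)).deriv]
    exact h t (le_of_lt ht)

set_option maxHeartbeats 1000000 in
lemma cone (k d m a b : ℝ) (hk : 0 < k) (hd : 0 < d) (ha : 0 < a) (hb : 0 < b) :
    ∃ ε > 0, ∃ C ≥ 0, ∀ (x y A B e1 e2 e3 : ℝ → ℝ) (T D : ℝ),
      (∀ t ≤ T, HasDerivAt x (k * y t) t) →
      (∀ t ≤ T, HasDerivAt y (-d * y t - m * x t + e1 t) t) →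
      (∀ t ≤ T, HasDerivAt A (a * A t + e2 t) t) →
      (∀ t ≤ T, HasDerivAt B (b * B t + e3 t) t) →
      (∀ t ≤ T, |e1 t| ≤ ε * (|x t| + |y t| + |A t| + |B t|)) →
      (∀ t ≤ T, |e2 t| ≤ ε * (|x t| + |y t| + |A t| + |B t|)) →
      (∀ t ≤ T, |e3 t| ≤ ε * (|x t| + |y t| + |A t| + |B t|)) →
      (∀ t ≤ T, |x t| + |y t| + |A t| + |B t| ≤ D) →
      |y T| ≤ C * (|x T| + |A T| + |B T|) := by
  obtain ⟨p, r, s, μ, ε₀, hp, hμ, hε₀, H⟩ := exists_form k d m hk hd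
  set δ := min ε₀ (min (2*a) (2*b)) with hδ
  have hδ0 : 0 < δ := by positivity
  have hδ1 : δ ≤ ε₀ := min_le_left _ _
  have hδ2 : δ ≤ 2*a := (min_le_right _ _).trans (min_le_left _ _)
  have hδ3 : δ ≤ 2*b := (min_le_right _ _).trans (min_le_right _ _)
  set W := 2*p+2*|r|+4 with hW
  have hW0 : 0 < W := by positivity
  refine ⟨δ/(4*W), by positivity, (2*|r|+|s|+1)/p + 1, by positivity, ?_⟩
  intro x y A B e1 e2 e3 T D hx hy hA hB h1 h2 h3 hD
  set ε := δ/(4*W) with hε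
  have hεW : 4 * W * ε = δ := by rw [hε]; field_simp
  let Q : ℝ → ℝ := fun t => p*(y t)^2 + 2*r*(x t)*(y t) + s*(x t)^2 - (A t)^2 - (B t)^2
  let Q' : ℝ → ℝ := fun t => 2*p*y t*(-d * y t - m * x t + e1 t)
    + 2*r*(k*y t*y t + x t*(-d * y t - m * x t + e1 t)) + 2*s*x t*(k*y t)
    - 2*A t*(a*A t+e2 t) - 2*B t*(b*B t+e3 t)
  have hQ : ∀ t ≤ T, HasDerivAt Q (Q' t) t := by
    intro t ht
    have hx := hx t ht
    have hy := hy t ht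
    have := ((((hy.pow 2).const_mul p).add ((hx.const_mul (2*r)).mul hy)).add
      ((hx.pow 2).const_mul s)).sub ((hA t ht).pow 2) |>.sub ((hB t ht).pow 2)
    refine this.congr_deriv ?_
    simp only [Q']
    push_cast
    ring
  have hQ' : ∀ t ≤ T, Q' t ≤ -(2*μ) * Q t := by
    intro t ht
    have H := H (x t) (y t)
    have h1 := h1 t ht
    have h2 := h2 t ht
    have h3 := h3 t ht
    set N := |x t| + |y t| + |A t| + |B t| with hN
    have hx0 := abs_nonneg (x t)
    have hy0 := abs_nonneg (y t)
    have hA0 := abs_nonneg (A t)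
    have hB0 := abs_nonneg (B t)
    have hN0 : 0 ≤ N := by positivity
    have hN2 : N^2 ≤ 4*((x t)^2+(y t)^2+(A t)^2+(B t)^2) := by
      rw [← sq_abs (x t), ← sq_abs (y t), ← sq_abs (A t), ← sq_abs (B t), hN]
      nlinarith [sq_nonneg (|x t| - |y t|), sq_nonneg (|x t| - |A t|), sq_nonneg (|x t| - |B t|),
        sq_nonneg (|y t| - |A t|), sq_nonneg (|y t| - |B t|), sq_nonneg (|A t| - |B t|)]
    have prod : ∀ f e : ℝ, |f| ≤ N → |e| ≤ ε * N → |f * e| ≤ ε * N^2 := by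
      intro f e hf he
      rw [abs_mul]
      calc |f| * |e| ≤ N * (ε * N) := mul_le_mul hf he (abs_nonneg _) hN0
        _ = _ := by ring
    have b1 := abs_le.1 (prod (y t) (e1 t) (by linarith) h1)
    have b2 := prod (x t) (e1 t) (by linarith) h1
    have b3 := abs_le.1 (prod (A t) (e2 t) (by linarith) h2)
    have b4 := abs_le.1 (prod (B t) (e3 t) (by linarith) h3)
    have b2' : r * (x t * e1 t) ≤ |r| * (ε * N^2) := by
      refine (le_abs_self _).trans ?_
      rw [abs_mul]
      gcongr
    have b1' : p * (y t * e1 t) ≤ p * (ε * N^2) :=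
      mul_le_mul_of_nonneg_left b1.2 hp.le
    have tot : W * (ε * N^2) ≤ δ * ((x t)^2+(y t)^2+(A t)^2+(B t)^2) := by
      rw [← hεW]
      have hε0 : 0 < ε := by positivity
      have := mul_le_mul_of_nonneg_left hN2 (by positivity : 0 ≤ W * ε)
      linarith
    have c1 := mul_le_mul_of_nonneg_right hδ1 (by positivity : 0 ≤ (x t)^2+(y t)^2)
    have c2 := mul_le_mul_of_nonneg_right hδ2 (sq_nonneg (A t))
    have c3 := mul_le_mul_of_nonneg_right hδ3 (sq_nonneg (B t))
    have c4 : 0 ≤ μ * ((A t)^2 + (B t)^2) := by positivity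
    simp only [Q, Q']
    rw [hW] at tot
    linarith
  have hanti : AntitoneOn (fun t => Real.exp (2*μ*t) * Q t) (Iic T) := by
    apply antitone_past (f' := fun t => Real.exp (2*μ*t) * (2*μ) * Q t + Real.exp (2*μ*t) * Q' t)
    · intro t ht
      have : HasDerivAt (fun t => Real.exp (2*μ*t)) (Real.exp (2*μ*t) * (2*μ)) t := by
        simpa using ((hasDerivAt_id t).const_mul (2*μ)).exp
      exact this.mul (hQ t ht)
    · intro t ht
      have := mul_le_mul_of_nonneg_left (hQ' t ht) (Real.exp_pos (2*μ*t)).le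
      linarith
  have hQT : Q T ≤ 0 := by
    have hbd : ∀ t ≤ T, Q t ≤ (p + 2*|r| + |s|) * D^2 := by
      intro t ht
      have hD := hD t ht
      have hx0 := abs_nonneg (x t)
      have hy0 := abs_nonneg (y t)
      have hA0 := abs_nonneg (A t)
      have hB0 := abs_nonneg (B t)
      have i1 : (y t)^2 ≤ D^2 := by rw [← sq_abs]; gcongr; linarith
      have i2 : (x t)^2 ≤ D^2 := by rw [← sq_abs]; gcongr; linarith
      have i3 : |x t * y t| ≤ D^2 := by
        rw [abs_mul, sq]
        exact mul_le_mul (by linarith) (by linarith) hy0 (by linarith)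
      have i4 : r * (x t * y t) ≤ |r| * D^2 := by
        refine (le_abs_self _).trans ?_
        rw [abs_mul]; gcongr
      have i5 : s * (x t)^2 ≤ |s| * D^2 := by
        have : s * (x t)^2 ≤ |s| * (x t)^2 := by gcongr; exact le_abs_self s
        refine this.trans ?_
        gcongr
      have i6 : p * (y t)^2 ≤ p * D^2 := by gcongr
      simp only [Q]
      nlinarith [sq_nonneg (A t), sq_nonneg (B t)]
    have hlim : Tendsto (fun t => Real.exp (2*μ*t) * ((p + 2*|r| + |s|) * D^2)) atBot (𝓝 0) := by
      have : Tendsto (fun t => Real.exp (2*μ*t)) atBot (𝓝 0) :=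
        Real.tendsto_exp_atBot.comp (tendsto_id.const_mul_atBot (by positivity))
      simpa using this.mul_const ((p + 2*|r| + |s|) * D^2)
    have hle : Real.exp (2*μ*T) * Q T ≤ 0 := by
      apply ge_of_tendsto hlim
      filter_upwards [eventually_le_atBot T] with t ht
      refine (hanti (mem_Iic.2 ht) (mem_Iic.2 le_rfl) ht).trans ?_
      exact mul_le_mul_of_nonneg_left (hbd t ht) (Real.exp_pos _).le
    by_contra hcon
    push Not at hcon
    have := mul_pos (Real.exp_pos (2*μ*T)) hcon
    linarith
  set M := |x T| + |A T| + |B T| with hM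
  have hx0 := abs_nonneg (x T)
  have hA0 := abs_nonneg (A T)
  have hB0 := abs_nonneg (B T)
  have hM0 : 0 ≤ M := by positivity
  by_contra hcon
  push Not at hcon
  have hC : 0 ≤ (2*|r|+|s|+1)/p := by positivity
  have g1 : M < |y T| := by nlinarith
  have g2 : (2*|r|+|s|+1) * M < p * |y T| := by
    have : (2*|r|+|s|+1)/p * M < |y T| := by nlinarith
    rw [div_mul_eq_mul_div, div_lt_iff₀ hp] at this
    linarith
  have g3 : -(|r| * (M * |y T|)) ≤ r * (x T * y T) := by
    have : |r * (x T * y T)| ≤ |r| * (M * |y T|) := by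
      rw [abs_mul, abs_mul]; gcongr; linarith
    exact (abs_le.1 this).1
  have g4 : -(|s| * M^2) ≤ s * (x T)^2 := by
    have : |s * (x T)^2| ≤ |s| * M^2 := by
      rw [abs_mul, abs_pow]; gcongr; linarith
    exact (abs_le.1 this).1
  have g5 : (A T)^2 + (B T)^2 ≤ M^2 := by
    rw [← sq_abs (A T), ← sq_abs (B T), hM]
    nlinarith [mul_nonneg hA0 hB0, mul_nonneg hx0 hA0, mul_nonneg hx0 hB0]
  have g6 : (|s|+1)*M^2 ≤ (|s|+1) * (M * |y T|) := by
    rw [sq]; gcongr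
  have g7 : (2*|r|+|s|+1) * M * |y T| < p * |y T| * |y T| := by
    apply mul_lt_mul_of_pos_right g2; linarith
  have g8 : p * |y T| * |y T| = p * (y T)^2 := by rw [mul_assoc, ← sq, sq_abs]
  simp only [Q] at hQT
  linarith

end Hub

namespace Hub

open Filter Topology

lemma exp_tendsto {α : ℝ} (hα : 0 < α) : Tendsto (fun t => Real.exp (α*t)) atBot (𝓝 0) :=
  Real.tendsto_exp_atBot.comp (tendsto_id.const_mul_atBot hα)

lemma hasDerivAt_exp_mul (α C : ℝ) (hα : 0 < α) (t : ℝ) :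
    HasDerivAt (fun t => C/α * Real.exp (α*t)) (C * Real.exp (α*t)) t := by
  have : HasDerivAt (fun t => Real.exp (α*t)) (Real.exp (α*t) * α) t := by
    simpa using ((hasDerivAt_id t).const_mul α).exp
  refine (this.const_mul (C/α)).congr_deriv ?_
  field_simp

lemma conv_past {f f' : ℝ → ℝ} {C α D : ℝ} (hα : 0 < α) (hC : 0 ≤ C)
    (hf : ∀ t ≤ 0, HasDerivAt f (f' t) t) (h : ∀ t ≤ 0, f' t ≤ C * Real.exp (α*t))
    (hD : ∀ t ≤ 0, f t ≤ D) : ∃ L, Tendsto f atBot (𝓝 L) := by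
  set F : ℝ → ℝ := fun t => f t - C/α * Real.exp (α*t) with hF
  have hanti : AntitoneOn F (Iic 0) :=
    antitone_past (fun t ht => (hf t ht).sub (hasDerivAt_exp_mul α C hα t))
      (fun t ht => by linarith [h t ht])
  have ha : Antitone (fun t => F (min t 0)) := fun s t hst =>
    hanti (mem_Iic.2 (min_le_right _ _)) (mem_Iic.2 (min_le_right _ _)) (min_le_min_right 0 hst)
  have hb : BddAbove (range (fun t => F (min t 0))) := by
    refine ⟨D, ?_⟩
    rintro _ ⟨t, rfl⟩
    have := hD _ (min_le_right t 0)
    have h2 : 0 ≤ C/α * Real.exp (α*(min t 0)) := by positivity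
    simp only [hF]; linarith
  have hl := tendsto_atBot_ciSup ha hb
  have hl' : Tendsto F atBot (𝓝 (⨆ t, F (min t 0))) := hl.congr' (by
    filter_upwards [eventually_le_atBot 0] with t ht
    rw [min_eq_left ht])
  refine ⟨_, (hl'.add ((exp_tendsto hα).const_mul (C/α))).congr (fun t => ?_)⟩
  simp [hF]

lemma barbalat {f f' y y' : ℝ → ℝ} {C α D c D' : ℝ} (hα : 0 < α) (hC : 0 ≤ C) (hc : 0 < c)
    (hf : ∀ t ≤ 0, HasDerivAt f (f' t) t) (h : ∀ t ≤ 0, f' t ≤ -c * (y t)^2 + C * Real.exp (α*t))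
    (hD : ∀ t ≤ 0, f t ≤ D) (hy : ∀ t ≤ 0, HasDerivAt y (y' t) t) (hy' : ∀ t ≤ 0, |y' t| ≤ D') :
    Tendsto y atBot (𝓝 0) := by
  obtain ⟨L, hL⟩ := conv_past hα hC hf (fun t ht => (h t ht).trans (by nlinarith [sq_nonneg (y t)])) hD
  set F : ℝ → ℝ := fun t => f t - C/α * Real.exp (α*t) with hF
  have hFL : Tendsto F atBot (𝓝 L) := by
    simpa using hL.sub ((exp_tendsto hα).const_mul (C/α))
  have hFd : ∀ t ≤ 0, HasDerivAt F (f' t - C * Real.exp (α*t)) t :=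
    fun t ht => (hf t ht).sub (hasDerivAt_exp_mul α C hα t)
  have hD'0 : 0 ≤ D' := (abs_nonneg _).trans (hy' 0 le_rfl)
  rw [Metric.tendsto_nhds]
  intro ε hε
  set r := ε / (2 * (D' + 1)) with hr
  have hr0 : 0 < r := by positivity
  have hrD : D' * r ≤ ε / 2 := by
    have : (D'+1) * r = ε/2 := by rw [hr]; field_simp
    nlinarith
  have hdiff : Tendsto (fun t => F (t - r) - F t) atBot (𝓝 0) := by
    have : Tendsto (fun t : ℝ => t - r) atBot atBot := tendsto_atBot_add_const_right _ (-r) tendsto_id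
    simpa using (hFL.comp this).sub hFL
  have hev : ∀ᶠ t in atBot, F (t - r) - F t < c * (ε/2)^2 * r :=
    hdiff.eventually (gt_mem_nhds (by positivity))
  filter_upwards [hev, eventually_le_atBot 0] with t ht ht0
  rw [dist_zero_right, Real.norm_eq_abs]
  by_contra hcon
  push Not at hcon
  have hlow : ∀ s ∈ Icc (t - r) t, ε/2 ≤ |y s| := by
    intro s hs
    have := (convex_Iic (𝕜 := ℝ) (0:ℝ)).norm_image_sub_le_of_norm_hasDerivWithin_le (C := D') (f := y)
      (f' := y') (fun t ht => (hy t ht).hasDerivWithinAt) (fun t ht => hy' t ht)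
      (mem_Iic.2 (hs.2.trans ht0)) (mem_Iic.2 ht0)
    rw [Real.norm_eq_abs, Real.norm_eq_abs, abs_of_nonneg (by linarith [hs.2] : 0 ≤ t - s)] at this
    have h2 : D' * (t - s) ≤ D' * r := by gcongr; linarith [hs.1]
    have h3 := abs_sub_abs_le_abs_sub (y t) (y s)
    linarith
  have hanti : AntitoneOn (fun s => F s + c * (ε/2)^2 * s) (Icc (t-r) t) := by
    apply antitoneOn_of_deriv_nonpos (convex_Icc _ _)
    · intro s hs
      exact ((hFd s (hs.2.trans ht0)).add ((hasDerivAt_id s).const_mul _)).continuousAt.continuousWithinAt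
    · intro s hs
      rw [interior_Icc] at hs
      exact ((hFd s (hs.2.le.trans ht0)).add
        ((hasDerivAt_id s).const_mul _)).differentiableAt.differentiableWithinAt
    · intro s hs
      rw [interior_Icc] at hs
      have hd := ((hFd s (hs.2.le.trans ht0)).add ((hasDerivAt_id s).const_mul (c * (ε/2)^2))).deriv
      have e1 : deriv (fun s => F s + c * (ε/2)^2 * s) s = f' s - C * Real.exp (α*s) + c * (ε/2)^2 * 1 := hd
      rw [e1]
      have h1 := h s (hs.2.le.trans ht0)
      have h2 := hlow s ⟨hs.1.le, hs.2.le⟩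
      have h3 : (ε/2)^2 ≤ (y s)^2 := by rw [← sq_abs (y s)]; gcongr
      have := mul_le_mul_of_nonneg_left h3 hc.le
      linarith
  have := hanti (left_mem_Icc.2 (by linarith)) (right_mem_Icc.2 (by linarith)) (by linarith)
  simp only at this
  linarith

lemma no_escape_aux {φ y : ℝ → ℝ} {k M T : ℝ} (hk : 0 < k) (hφ : ∀ t, HasDerivAt φ (k * y t) t)
    (hM : ∀ t ≤ T, |φ t| ≤ M) (h : ∀ t ≤ T, 1/2 ≤ y t) : False := by
  have hanti : AntitoneOn (fun t => k/2*t - φ t) (Iic T) :=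
    antitone_past (f' := fun t => k/2*1 - k * y t)
      (fun t _ => ((hasDerivAt_id t).const_mul (k/2)).sub (hφ t))
      (fun t ht => by nlinarith [h t ht])
  set s := T - (4*|M| + 1)/k with hs
  have hsT : s ≤ T := by rw [hs]; have : 0 ≤ (4*|M| + 1)/k := by positivity
                         linarith
  have h1 := hanti (mem_Iic.2 hsT) (mem_Iic.2 le_rfl) hsT
  have h2 := abs_le.1 (hM s hsT)
  have h3 := abs_le.1 (hM T le_rfl)
  have h4 : k/2*s = k/2*T - (4*|M|+1)/2 := by rw [hs]; field_simp
  have := le_abs_self M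
  simp only at h1
  linarith

lemma no_escape {φ y : ℝ → ℝ} {k M T : ℝ} (hk : 0 < k) (hφ : ∀ t, HasDerivAt φ (k * y t) t)
    (hy : Continuous y)
    (hM : ∀ t ≤ T, |φ t| ≤ M) (h : ∀ t ≤ T, 1/4 ≤ (y t)^2) : False := by
  have hab : ∀ t ≤ T, 1/2 ≤ |y t| := fun t ht => by
    have := h t ht
    rw [← sq_abs] at this
    nlinarith [abs_nonneg (y t)]
  have hnz : ∀ t ≤ T, y t ≠ 0 := fun t ht h0 => by
    have := hab t ht
    rw [h0, abs_zero] at this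
    linarith
  rcases lt_or_gt_of_ne (hnz T le_rfl) with hT | hT
  · apply no_escape_aux (φ := fun t => -φ t) (y := fun t => -y t) hk (M := M) (T := T)
    · intro t; exact (hφ t).neg.congr_deriv (by ring)
    · simpa using hM
    · intro t ht
      have : y t < 0 := by
        by_contra hcon
        push Not at hcon
        obtain ⟨s, hs, hs0⟩ := intermediate_value_Icc' ht hy.continuousOn ⟨hT.le, hcon⟩
        exact hnz s hs.2 hs0
      have h2 := hab t ht
      rwa [abs_of_neg this] at h2
  · apply no_escape_aux hk hφ hM
    intro t ht
    have : 0 < y t := by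
      by_contra hcon
      push Not at hcon
      obtain ⟨s, hs, hs0⟩ := intermediate_value_Icc ht hy.continuousOn ⟨hcon, hT.le⟩
      exact hnz s hs.2 hs0
    have h2 := hab t ht
    rwa [abs_of_pos this] at h2

lemma ratio {f u g1 g2 L : ℝ → ℝ} (hf : ∀ t, HasDerivAt f (g1 t * f t) t)
    (hu : ∀ t, HasDerivAt u (g2 t * u t) t) (hu0 : ∀ t, u t ≠ 0)
    (hL : ∀ t, HasDerivAt L (g1 t - g2 t) t) (t : ℝ) :
    f t = f 0 / u 0 * Real.exp (L t - L 0) * u t := by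
  have hd : ∀ t, HasDerivAt (fun t => f t / u t * Real.exp (- L t)) 0 t := fun t => by
    have := ((hf t).div (hu t) (hu0 t)).mul ((hL t).neg.exp)
    refine this.congr_deriv ?_
    have := hu0 t
    simp only [Pi.neg_apply, Pi.div_apply]
    field_simp
    ring
  have hc := is_const_of_deriv_eq_zero (fun t => (hd t).differentiableAt) (fun t => (hd t).deriv) t 0
  have h1 : f t / u t = f 0 / u 0 * Real.exp (L t - L 0) := by
    have : f t / u t = (f t / u t * Real.exp (- L t)) * Real.exp (L t) := by
      rw [mul_assoc, ← Real.exp_add]; simp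
    rw [this, hc, mul_assoc, ← Real.exp_add]
    congr 2; ring
  rw [← h1, div_mul_cancel₀ _ (hu0 t)]

end Hub

namespace Hub

open Filter Topology

/-- The coupling constant. -/
noncomputable def cc (γ : ℝ) : ℝ := (3*γ - 4) / 2 * r6

/-- A global solution of the system on the sphere, written in components. -/
structure IsSol (γ : ℝ) (V χ : ℝ → ℝ) (φ y z w u : ℝ → ℝ) : Prop where
  dφ : ∀ t, HasDerivAt φ (2 * r6 * y t) t
  dy : ∀ t, HasDerivAt y (-y t * ((1-γ/2) * z t^2 + w t^2 + u t^2/3) - r6 * w t^2 * ld V (φ t)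
        - cc γ * z t^2 * ld χ (φ t)) t
  dz : ∀ t, HasDerivAt z (((6*y t^2+3*γ*z t^2+4*u t^2)/6 - γ/2 + cc γ * y t * ld χ (φ t)) * z t) t
  dw : ∀ t, HasDerivAt w (((6*y t^2+3*γ*z t^2+4*u t^2)/6 + r6 * y t * ld V (φ t)) * w t) t
  du : ∀ t, HasDerivAt u (((6*y t^2+3*γ*z t^2+4*u t^2)/6 - 2/3) * u t) t
  sph : ∀ t, y t^2 + z t^2 + w t^2 + u t^2 = 1
  upos : ∀ t, 0 < u t

/-- Bounds of the coefficient functions along the past orbit. -/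
structure IsBd (V χ : ℝ → ℝ) (φ : ℝ → ℝ) (M B : ℝ) : Prop where
  bφ : ∀ t ≤ 0, |φ t| ≤ M
  v1 : ∀ t ≤ 0, |ld V (φ t)| ≤ B
  x1 : ∀ t ≤ 0, |ld χ (φ t)| ≤ B
  v0 : ∀ t ≤ 0, |Real.log (V (φ t))| ≤ B
  x0 : ∀ t ≤ 0, |Real.log (χ (φ t))| ≤ B

lemma exists_bd {V χ φ : ℝ → ℝ} {M : ℝ} (hV : ContDiff ℝ 3 V) (hχ : ContDiff ℝ 3 χ)
    (hVpos : ∀ x, 0 < V x) (hχpos : ∀ x, 0 < χ x) (h : ∀ t ≤ 0, |φ t| ≤ M) :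
    ∃ B, 0 ≤ B ∧ IsBd V χ φ M B := by
  have key : ∀ f : ℝ → ℝ, Continuous f → ∃ B, ∀ t ≤ 0, |f (φ t)| ≤ B := fun f hf => by
    obtain ⟨B, hB⟩ := (isCompact_Icc (a := -M) (b := M)).exists_bound_of_continuousOn hf.continuousOn
    exact ⟨B, fun t ht => hB _ (abs_le.1 (h t ht))⟩
  obtain ⟨B1, h1⟩ := key (ld V) (ld_contDiff hV hVpos).continuous
  obtain ⟨B2, h2⟩ := key (ld χ) (ld_contDiff hχ hχpos).continuous
  obtain ⟨B3, h3⟩ := key (fun x => Real.log (V x)) (hV.continuous.log fun x => (hVpos x).ne')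
  obtain ⟨B4, h4⟩ := key (fun x => Real.log (χ x)) (hχ.continuous.log fun x => (hχpos x).ne')
  have a1 := (abs_nonneg _).trans (h1 0 le_rfl)
  have a2 := (abs_nonneg _).trans (h2 0 le_rfl)
  have a3 := (abs_nonneg _).trans (h3 0 le_rfl)
  have a4 := (abs_nonneg _).trans (h4 0 le_rfl)
  refine ⟨B1+B2+B3+B4, by positivity, h, ?_, ?_, ?_, ?_⟩ <;> intro t ht
  · linarith [h1 t ht]
  · linarith [h2 t ht]
  · linarith [h3 t ht]
  · linarith [h4 t ht]

lemma hasDerivAt_log_comp {f φ : ℝ → ℝ} {v t : ℝ} (hf : ContDiff ℝ 3 f) (hpos : ∀ x, 0 < f x)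
    (hφ : HasDerivAt φ v t) : HasDerivAt (fun t => Real.log (f (φ t))) (ld f (φ t) * v) t := by
  have h1 : HasDerivAt f (deriv f (φ t)) (φ t) :=
    ((hf.differentiable (by norm_num)) (φ t)).hasDerivAt
  refine ((h1.comp t hφ).log (hpos _).ne').congr_deriv ?_
  simp [ld]; ring

lemma sq_ratio {f u L : ℝ → ℝ} {κ B : ℝ} (hL : ∀ t ≤ 0, |L t| ≤ B)
    (h : ∀ t, f t = f 0 / u 0 * Real.exp ((κ*t + L t) - (κ*0 + L 0)) * u t) :
    ∃ C, 0 ≤ C ∧ ∀ t ≤ 0, f t ^2 ≤ C * Real.exp (2*κ*t) * u t^2 := by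
  refine ⟨(f 0 / u 0)^2 * Real.exp (4*B), by positivity, fun t ht => ?_⟩
  have h1 := abs_le.1 (hL t ht)
  have h2 := abs_le.1 (hL 0 le_rfl)
  have h3 : Real.exp ((κ*t + L t) - (κ*0 + L 0))^2 ≤ Real.exp (4*B) * Real.exp (2*κ*t) := by
    rw [← Real.exp_nat_mul, ← Real.exp_add, Real.exp_le_exp]
    push_cast; linarith
  calc f t^2 = (f 0 / u 0)^2 * u t^2 * Real.exp ((κ*t + L t) - (κ*0 + L 0))^2 := by rw [h t]; ring
    _ ≤ (f 0 / u 0)^2 * u t^2 * (Real.exp (4*B) * Real.exp (2*κ*t)) := by gcongr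
    _ = _ := by ring

variable {γ : ℝ} {V χ : ℝ → ℝ} {φ y z w u : ℝ → ℝ}

lemma w_ratio (hs : IsSol γ V χ φ y z w u) {M B : ℝ} (hb : IsBd V χ φ M B)
    (hV : ContDiff ℝ 3 V) (hVpos : ∀ x, 0 < V x) :
    ∃ C, 0 ≤ C ∧ ∀ t ≤ 0, w t ^2 ≤ C * Real.exp (2*(2/3)*t) * u t^2 := by
  have h := ratio (L := fun t => 2/3*t + 1/2 * Real.log (V (φ t))) hs.dw hs.du (fun t => (hs.upos t).ne')
    (fun t => ((((hasDerivAt_id t).const_mul (2/3:ℝ)).add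
      ((hasDerivAt_log_comp hV hVpos (hs.dφ t)).const_mul (1/2:ℝ))).congr_deriv (by ring)))
  refine sq_ratio (B := B) (L := fun t => 1/2 * Real.log (V (φ t))) (fun t ht => ?_) h
  have := hb.v0 t ht
  rw [abs_mul, abs_of_pos (by norm_num : (0:ℝ) < 1/2)]
  linarith [abs_nonneg (Real.log (V (φ t)))]

lemma z_ratio (hs : IsSol γ V χ φ y z w u) {M B : ℝ} (hb : IsBd V χ φ M B)
    (hχ : ContDiff ℝ 3 χ) (hχpos : ∀ x, 0 < χ x) :
    ∃ C, 0 ≤ C ∧ ∀ t ≤ 0, z t ^2 ≤ C * Real.exp (2*(2/3-γ/2)*t) * u t^2 := by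
  have h := ratio (L := fun t => (2/3-γ/2)*t + (3*γ-4)/4 * Real.log (χ (φ t))) hs.dz hs.du
    (fun t => (hs.upos t).ne')
    (fun t => ((((hasDerivAt_id t).const_mul (2/3-γ/2)).add
      ((hasDerivAt_log_comp hχ hχpos (hs.dφ t)).const_mul ((3*γ-4)/4))).congr_deriv (by unfold cc; ring)))
  refine sq_ratio (B := |(3*γ-4)/4| * B) (L := fun t => (3*γ-4)/4 * Real.log (χ (φ t))) (fun t ht => ?_) h
  rw [abs_mul]
  have := hb.x0 t ht
  gcongr

lemma u_ratio (hs : IsSol γ V χ φ y z w u) {M B : ℝ} (hb : IsBd V χ φ M B) (hz : ∀ t, z t ≠ 0)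
    (hχ : ContDiff ℝ 3 χ) (hχpos : ∀ x, 0 < χ x) :
    ∃ C, 0 ≤ C ∧ ∀ t ≤ 0, u t ^2 ≤ C * Real.exp (2*(γ/2-2/3)*t) * z t^2 := by
  have h := ratio (L := fun t => (γ/2-2/3)*t + (-(3*γ-4)/4) * Real.log (χ (φ t))) hs.du hs.dz hz
    (fun t => ((((hasDerivAt_id t).const_mul (γ/2-2/3)).add
      ((hasDerivAt_log_comp hχ hχpos (hs.dφ t)).const_mul (-(3*γ-4)/4))).congr_deriv (by unfold cc; ring)))
  refine sq_ratio (B := |-(3*γ-4)/4| * B) (L := fun t => (-(3*γ-4)/4) * Real.log (χ (φ t))) (fun t ht => ?_) h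
  rw [abs_mul]
  have := hb.x0 t ht
  gcongr

lemma core (hγ0 : 0 < γ) (hγ2 : γ < 2) (hs : IsSol γ V χ φ y z w u) {M B : ℝ} (hB0 : 0 ≤ B)
    (hb : IsBd V χ φ M B)
    (hχ : ContDiff ℝ 3 χ) (hχpos : ∀ x, 0 < χ x) {C α c : ℝ} (hα : 0 < α) (hC : 0 ≤ C)
    (hw : ∀ t ≤ 0, w t^2 ≤ C * Real.exp (α*t) * (1 - y t^2))
    (hc : ∀ t ≤ 0, |c * (1 - y t^2) - cc γ * z t^2| ≤ C * Real.exp (α*t) * (1 - y t^2)) :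
    Tendsto y atBot (𝓝 0) ∧ ∃ L, Tendsto (fun t => c * Real.log (χ (φ t))) atBot (𝓝 L) := by
  have hr := r6_pos
  set d0 := min (1-γ/2) (1/3) with hd0
  have hd0p : 0 < d0 := lt_min (by linarith) (by norm_num)
  have hd1 : d0 ≤ 1-γ/2 := min_le_left _ _
  have hd2 : d0 ≤ 1/3 := min_le_right _ _
  have hS : ∀ t, 0 < 1 - y t^2 := fun t => by
    have := hs.sph t
    nlinarith [sq_nonneg (z t), sq_nonneg (w t), pow_pos (hs.upos t) 2]
  have hy1 : ∀ t, |y t| ≤ 1 := fun t => by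
    rw [← sq_le_one_iff_abs_le_one]; linarith [hS t]
  set E : ℝ → ℝ := fun t => -r6 * Real.log (1 - y t^2) + c * Real.log (χ (φ t)) with hE
  set Q : ℝ → ℝ := fun t => (1-γ/2) * z t^2 + w t^2 + u t^2/3 with hQ
  set E' : ℝ → ℝ := fun t => 2*r6*y t/(1 - y t^2) * (-y t * Q t - r6 * w t^2 * ld V (φ t)
        + (c * (1 - y t^2) - cc γ * z t^2) * ld χ (φ t)) with hE'
  have hEd : ∀ t, HasDerivAt E (E' t) t := fun t => by
    have h1 := (((hs.dy t).pow 2).const_sub 1).log (hS t).ne'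
    refine ((h1.const_mul (-r6)).add
      ((hasDerivAt_log_comp hχ hχpos (hs.dφ t)).const_mul c)).congr_deriv ?_
    have := (hS t).ne'
    simp only [hE', hQ, Pi.pow_apply]
    field_simp
    push_cast
    ring
  set C' := 2*r6*(r6*C*B + C*B) with hC'
  have hC'0 : 0 ≤ C' := by positivity
  have hEle : ∀ t ≤ 0, E' t ≤ -(2*r6*d0) * y t^2 + C' * Real.exp (α*t) := fun t ht => by
    have hQl : d0 * (1 - y t^2) ≤ Q t := by
      have e : 1 - y t^2 = z t^2 + w t^2 + u t^2 := by linarith [hs.sph t]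
      rw [e]; simp only [hQ]
      nlinarith [sq_nonneg (z t), sq_nonneg (w t), sq_nonneg (u t)]
    set S := 1 - y t^2 with hSdef
    have hSp : 0 < S := hS t
    set X := - r6 * w t^2 * ld V (φ t) + (c * S - cc γ * z t^2) * ld χ (φ t) with hX
    have hXb : |X| ≤ (r6*C*B + C*B) * Real.exp (α*t) * S := by
      have a1 : |r6 * w t^2 * ld V (φ t)| ≤ r6 * (C * Real.exp (α*t) * S) * B := by
        rw [abs_mul, abs_of_nonneg (by positivity : 0 ≤ r6 * w t^2)]
        have := hb.v1 t ht
        have := hw t ht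
        gcongr
      have a2 : |(c * S - cc γ * z t^2) * ld χ (φ t)| ≤ (C * Real.exp (α*t) * S) * B := by
        rw [abs_mul]
        have := hb.x1 t ht
        have := hc t ht
        gcongr
      have a1' := abs_le.1 a1
      have a2' := abs_le.1 a2
      rw [hX, abs_le]
      constructor <;> nlinarith
    have e : E' t = -(2*r6) * y t^2 * (Q t / S) + 2*r6 * (y t * (X / S)) := by
      simp only [hE', hX, ← hSdef]
      field_simp
      ring
    have b1 : d0 ≤ Q t / S := by rw [le_div_iff₀ hSp]; exact hQl
    have b2 : |X / S| ≤ (r6*C*B + C*B) * Real.exp (α*t) := by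
      rw [abs_div, abs_of_pos hSp, div_le_iff₀ hSp]; exact hXb
    have b3 : y t * (X/S) ≤ (r6*C*B + C*B) * Real.exp (α*t) := by
      refine (le_abs_self _).trans ?_
      rw [abs_mul]
      have := mul_le_mul (hy1 t) b2 (abs_nonneg _) zero_le_one
      linarith
    rw [e]
    have b4 := mul_le_mul_of_nonneg_left b1 (by positivity : 0 ≤ 2*r6*y t^2)
    have b5 := mul_le_mul_of_nonneg_left b3 (by positivity : 0 ≤ 2*r6)
    simp only [hC']
    linarith
  have hyc : Continuous y := continuous_iff_continuousAt.2 fun t => (hs.dy t).continuousAt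
  set K := |c| * B + r6 * Real.log (4/3) with hK
  have hanti : AntitoneOn (fun t => E t - C'/α * Real.exp (α*t)) (Iic 0) :=
    antitone_past (fun t _ => (hEd t).sub (hasDerivAt_exp_mul α C' hα t))
      (fun t ht => by
        have := hEle t ht
        have : 0 ≤ (2*r6*d0) * y t^2 := by positivity
        linarith)
  have hD : ∀ t ≤ 0, E t ≤ K + C'/α := by
    intro T hT
    by_contra hcon
    push Not at hcon
    have hexp : ∀ t ≤ 0, C'/α * Real.exp (α*t) ≤ C'/α := fun t ht => by
      have : Real.exp (α*t) ≤ 1 := Real.exp_le_one_iff.2 (by nlinarith)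
      exact mul_le_of_le_one_right (by positivity) this
    refine no_escape (by positivity) hs.dφ hyc (T := T) (fun t ht => hb.bφ t (ht.trans hT)) ?_
    intro t ht
    have h1 := hanti (mem_Iic.2 (ht.trans hT)) (mem_Iic.2 hT) ht
    simp only at h1
    have h2 := hexp T hT
    have h3 : 0 ≤ C'/α * Real.exp (α*t) := by positivity
    have h4 : K < E t := by linarith
    simp only [hE, hK] at h4
    have h5 : c * Real.log (χ (φ t)) ≤ |c| * B := by
      refine (le_abs_self _).trans ?_
      rw [abs_mul]
      have := hb.x0 t (ht.trans hT)
      gcongr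
    have h6 : r6 * (Real.log (1 - y t^2) + Real.log (4/3)) < 0 := by linarith
    have h7 : Real.log (1 - y t^2) + Real.log (4/3) < 0 := by
      by_contra hh
      push Not at hh
      have := mul_nonneg hr.le hh
      linarith
    rw [← Real.log_mul (hS t).ne' (by norm_num)] at h7
    have h8 : (1 - y t^2) * (4/3) < 1 := by
      by_contra hh
      push Not at hh
      have := Real.log_nonneg hh
      linarith
    linarith
  have hy0 : Tendsto y atBot (𝓝 0) := by
    refine barbalat (D' := 1 + r6*B + |cc γ| * B) hα hC'0 (by positivity : 0 < 2*r6*d0) (fun t _ => hEd t)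
      hEle hD (fun t _ => hs.dy t) (fun t ht => ?_)
    have hsp := hs.sph t
    have hz2 : z t^2 ≤ 1 := by nlinarith [sq_nonneg (y t), sq_nonneg (w t), sq_nonneg (u t)]
    have hw2 : w t^2 ≤ 1 := by nlinarith [sq_nonneg (y t), sq_nonneg (z t), sq_nonneg (u t)]
    have hQ0 : 0 ≤ Q t := by
      have : 0 ≤ 1-γ/2 := by linarith
      simp only [hQ]; positivity
    have hQ1 : Q t ≤ 1 := by
      simp only [hQ]
      nlinarith [sq_nonneg (y t), sq_nonneg (z t), sq_nonneg (u t)]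
    have a1 : |y t * Q t| ≤ 1 := by
      rw [abs_mul, abs_of_nonneg hQ0]
      exact mul_le_one₀ (hy1 t) hQ0 hQ1
    have a2 : |r6 * w t^2 * ld V (φ t)| ≤ r6 * 1 * B := by
      rw [abs_mul, abs_of_nonneg (by positivity : 0 ≤ r6 * w t^2)]
      have := hb.v1 t ht
      gcongr
    have a3 : |cc γ * z t^2 * ld χ (φ t)| ≤ |cc γ| * 1 * B := by
      rw [abs_mul, abs_mul, abs_of_nonneg (sq_nonneg (z t))]
      have := hb.x1 t ht
      gcongr
    have a1' := abs_le.1 a1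
    have a2' := abs_le.1 a2
    have a3' := abs_le.1 a3
    simp only [hQ] at a1'
    rw [abs_le]
    constructor <;> linarith
  refine ⟨hy0, ?_⟩
  obtain ⟨L, hL⟩ := conv_past hα hC'0 (fun t _ => hEd t) (fun t ht => (hEle t ht).trans (by
    have : 0 ≤ (2*r6*d0) * y t^2 := by positivity
    linarith)) hD
  refine ⟨L, ?_⟩
  have h1 : Tendsto (fun t => r6 * Real.log (1 - y t^2)) atBot (𝓝 0) := by
    have h2 : Tendsto (fun t => 1 - y t^2) atBot (𝓝 1) := by
      simpa using (hy0.pow 2).const_sub 1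
    simpa using (h2.log one_ne_zero).const_mul r6
  have := hL.add h1
  rw [add_zero] at this
  refine this.congr (fun t => ?_)
  simp only [hE]; ring

end Hub

namespace Hub

open Filter Topology

lemma bdd_past {f : ℝ → ℝ} {l : ℝ} (hf : Continuous f) (h : Tendsto f atBot (𝓝 l)) :
    ∃ D, ∀ t ≤ 0, f t ≤ D := by
  obtain ⟨T, hT⟩ := eventually_atBot.1 (h.eventually (gt_mem_nhds (lt_add_one l)))
  obtain ⟨D, hD⟩ := (isCompact_Icc (a := T) (b := 0)).exists_bound_of_continuousOn hf.continuousOn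
  refine ⟨max D (l+1), fun t ht => ?_⟩
  rcases le_total t T with h1 | h1
  · exact (hT t h1).le.trans (le_max_right _ _)
  · exact ((le_abs_self _).trans (hD t ⟨h1, ht⟩)).trans (le_max_left _ _)

lemma limit_deriv_zero {y y' : ℝ → ℝ} {a l : ℝ} (hy : ∀ t, HasDerivAt y (y' t) t)
    (h : Tendsto y atBot (𝓝 a)) (h' : Tendsto y' atBot (𝓝 l)) : l = 0 := by
  have hmv : ∀ t : ℝ, ∃ ξ, ξ ≤ t + 1 ∧ y' ξ = y (t+1) - y t := fun t => by
    obtain ⟨ξ, hξ, e⟩ := exists_hasDerivAt_eq_slope y y' (lt_add_one t)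
      (fun s _ => (hy s).continuousAt.continuousWithinAt) (fun s _ => hy s)
    exact ⟨ξ, hξ.2.le, by simpa using e⟩
  choose ξ h1 h2 using hmv
  have hsh : Tendsto (fun t : ℝ => t + 1) atBot atBot := tendsto_atBot_add_const_right _ 1 tendsto_id
  have hξ : Tendsto ξ atBot atBot := tendsto_atBot_mono h1 hsh
  have e1 := h'.comp hξ
  have e2 : Tendsto (fun t => y (t+1) - y t) atBot (𝓝 0) := by
    simpa using (h.comp hsh).sub h
  refine tendsto_nhds_unique (e1.congr fun t => ?_) e2
  simp [h2]

lemma conv_of_comp {χ φ : ℝ → ℝ} {M l : ℝ} (hφ : Continuous φ) (hM : ∀ t ≤ 0, |φ t| ≤ M)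
    (hstat : Set.Finite {x : ℝ | deriv χ x = 0})
    (h : Tendsto (fun t => χ (φ t)) atBot (𝓝 l)) : ∃ x, Tendsto φ atBot (𝓝 x) := by
  refine tendsto_of_no_upcrossings (s := univ) dense_univ ?_ ?_ ?_
  · rintro a - b - hab ⟨h1, h2⟩
    have hconst : ∀ c ∈ Ioo a b, χ c = l := by
      intro c hc
      have hfreq : ∃ᶠ t in atBot, φ t = c := by
        rw [frequently_atBot]
        intro T
        obtain ⟨s1, hs1, e1⟩ := frequently_atBot.1 h1 T
        obtain ⟨s2, hs2, e2⟩ := frequently_atBot.1 h2 T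
        have := (isPreconnected_Iic (a := T)).intermediate_value hs1 hs2 hφ.continuousOn
        obtain ⟨s, hs, e⟩ := this ⟨e1.le.trans hc.1.le, hc.2.le.trans e2.le⟩
        exact ⟨s, hs, e⟩
      by_contra hne
      have hev := h.eventually (isOpen_ne.mem_nhds (Ne.symm hne))
      obtain ⟨t, ht1, ht2⟩ := (hfreq.and_eventually hev).exists
      rw [ht1] at ht2
      exact ht2 rfl
    have hsub : Ioo a b ⊆ {x : ℝ | deriv χ x = 0} := fun c hc => by
      have : χ =ᶠ[𝓝 c] fun _ => l := by
        filter_upwards [isOpen_Ioo.mem_nhds hc] with x hx using hconst x hx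
      simpa using this.deriv_eq
    exact (Ioo_infinite hab) (hstat.subset hsub)
  · exact isBoundedUnder_of_eventually_le (a := M)
      ((eventually_le_atBot 0).mono fun t ht => (abs_le.1 (hM t ht)).2)
  · exact isBoundedUnder_of_eventually_ge (a := -M)
      ((eventually_le_atBot 0).mono fun t ht => (abs_le.1 (hM t ht)).1)

lemma tendsto_zero_of_sq {f : ℝ → ℝ} (h : Tendsto (fun t => f t^2) atBot (𝓝 0)) :
    Tendsto f atBot (𝓝 0) := by
  have := h.sqrt
  rw [Real.sqrt_zero] at this
  simp only [Real.sqrt_sq_eq_abs] at this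
  exact (tendsto_zero_iff_abs_tendsto_zero f).2 this

lemma tendsto_one_of_sq {f : ℝ → ℝ} (hp : ∀ t, 0 < f t) (h : Tendsto (fun t => f t^2) atBot (𝓝 1)) :
    Tendsto f atBot (𝓝 1) := by
  have := h.sqrt
  rw [Real.sqrt_one] at this
  exact this.congr fun t => Real.sqrt_sq (hp t).le

lemma sq_tendsto_zero {f u : ℝ → ℝ} {C α : ℝ} (hα : 0 < α) (hC : 0 ≤ C)
    (h : ∀ t ≤ 0, f t^2 ≤ C * Real.exp (α*t) * u t^2) (hu : ∀ t, u t^2 ≤ 1) :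
    Tendsto f atBot (𝓝 0) := by
  apply tendsto_zero_of_sq
  have h1 : Tendsto (fun t => C * Real.exp (α*t)) atBot (𝓝 0) := by
    simpa using (exp_tendsto hα).const_mul C
  refine tendsto_of_tendsto_of_tendsto_of_le_of_le' tendsto_const_nhds h1
    (Eventually.of_forall fun t => sq_nonneg _) ?_
  filter_upwards [eventually_le_atBot 0] with t ht
  exact (h t ht).trans (mul_le_of_le_one_right (by positivity) (hu t))

variable {γ : ℝ} {V χ : ℝ → ℝ} {φ y z w u : ℝ → ℝ}

lemma case1 (hγ0 : 0 < γ) (hγ : γ < 4/3) (hs : IsSol γ V χ φ y z w u) {M : ℝ}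
    (hV : ContDiff ℝ 3 V) (hχ : ContDiff ℝ 3 χ)
    (hVpos : ∀ x, 0 < V x) (hχpos : ∀ x, 0 < χ x) (hM : ∀ t ≤ 0, |φ t| ≤ M) :
    ∃ x, Tendsto φ atBot (𝓝 x) ∧ Tendsto y atBot (𝓝 0) ∧ Tendsto z atBot (𝓝 0) ∧
      Tendsto w atBot (𝓝 0) ∧ Tendsto u atBot (𝓝 1) := by
  have hr := r6_pos
  obtain ⟨B, hB0, hb⟩ := exists_bd hV hχ hVpos hχpos hM
  obtain ⟨C1, hC1, hw⟩ := w_ratio hs hb hV hVpos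
  obtain ⟨C2, hC2, hz⟩ := z_ratio hs hb hχ hχpos
  set α := 4/3 - γ with hα
  have hα0 : 0 < α := by linarith
  have hw' : ∀ t ≤ 0, w t^2 ≤ C1 * Real.exp (α*t) * u t^2 := fun t ht => (hw t ht).trans (by
    have : Real.exp (2*(2/3)*t) ≤ Real.exp (α*t) := Real.exp_le_exp.2 (by nlinarith)
    gcongr)
  have hz' : ∀ t ≤ 0, z t^2 ≤ C2 * Real.exp (α*t) * u t^2 := fun t ht => by
    have e : 2*(2/3-γ/2)*t = α*t := by rw [hα]; ring
    have := hz t ht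
    rwa [e] at this
  have hS : ∀ t, u t^2 ≤ 1 - y t^2 := fun t => by
    have := hs.sph t
    nlinarith [sq_nonneg (z t), sq_nonneg (w t)]
  have hSp : ∀ t, 0 < 1 - y t^2 := fun t => (pow_pos (hs.upos t) 2).trans_le (hS t)
  have hu1 : ∀ t, u t^2 ≤ 1 := fun t => (hS t).trans (by nlinarith [sq_nonneg (y t)])
  have hwS : ∀ t ≤ 0, w t^2 ≤ C1 * Real.exp (α*t) * (1 - y t^2) := fun t ht => (hw' t ht).trans (by
    have := hS t
    gcongr)
  have hzS : ∀ t ≤ 0, z t^2 ≤ C2 * Real.exp (α*t) * (1 - y t^2) := fun t ht => (hz' t ht).trans (by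
    have := hS t
    gcongr)
  obtain ⟨hy0, -⟩ := core hγ0 (by linarith) hs hB0 hb hχ hχpos (C := C1 + |cc γ| * C2) (c := 0) hα0
    (by positivity) (fun t ht => (hwS t ht).trans (by
      have : 0 ≤ |cc γ| * C2 * Real.exp (α*t) * (1 - y t^2) := mul_nonneg (by positivity) (hSp t).le
      nlinarith)) (fun t ht => by
      rw [zero_mul, zero_sub, abs_neg, abs_mul, abs_of_nonneg (sq_nonneg (z t))]
      have h1 := mul_le_mul_of_nonneg_left (hzS t ht) (abs_nonneg (cc γ))
      have : 0 ≤ C1 * Real.exp (α*t) * (1 - y t^2) := mul_nonneg (by positivity) (hSp t).le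
      nlinarith)
  have hz0 := sq_tendsto_zero hα0 hC2 hz' hu1
  have hw0 := sq_tendsto_zero hα0 hC1 hw' hu1
  have hu0 : Tendsto u atBot (𝓝 1) := by
    apply tendsto_one_of_sq hs.upos
    have : Tendsto (fun t => 1 - y t^2 - z t^2 - w t^2) atBot (𝓝 1) := by
      simpa using (((hy0.pow 2).const_sub 1).sub (hz0.pow 2)).sub (hw0.pow 2)
    refine this.congr fun t => ?_
    linarith [hs.sph t]
  have hyc : Continuous y := continuous_iff_continuousAt.2 fun t => (hs.dy t).continuousAt
  have hp1 : ∀ t, 0 < 1 + y t := fun t => by nlinarith [hSp t]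
  have hp2 : ∀ t, 0 < 1 - y t := fun t => by nlinarith [hSp t]
  set η : ℝ → ℝ := fun t => 1/2 * (Real.log (1 + y t) - Real.log (1 - y t)) with hη
  have hηc : Continuous η := by
    have h1 : Continuous fun t => Real.log (1 + y t) := (by fun_prop : Continuous fun t => 1 + y t).log fun t => (hp1 t).ne'
    have h2 : Continuous fun t => Real.log (1 - y t) := (by fun_prop : Continuous fun t => 1 - y t).log fun t => (hp2 t).ne'
    exact (h1.sub h2).const_mul _
  have hη0 : Tendsto η atBot (𝓝 0) := by
    have h1 : Tendsto (fun t => Real.log (1 + y t)) atBot (𝓝 0) := by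
      have : Tendsto (fun t => 1 + y t) atBot (𝓝 1) := by simpa using hy0.const_add 1
      simpa using this.log one_ne_zero
    have h2 : Tendsto (fun t => Real.log (1 - y t)) atBot (𝓝 0) := by
      have : Tendsto (fun t => 1 - y t) atBot (𝓝 1) := by simpa using hy0.const_sub 1
      simpa using this.log one_ne_zero
    simpa using (h1.sub h2).const_mul (1/2)
  obtain ⟨D, hD⟩ := bdd_past hηc hη0
  set g' : ℝ → ℝ := fun t => (-y t * ((2/3-γ/2) * z t^2 + 2/3*w t^2) - r6 * w t^2 * ld V (φ t)
        - cc γ * z t^2 * ld χ (φ t)) / (1 - y t^2) with hg'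
  have hd : ∀ t, HasDerivAt (fun t => η t + φ t / (6*r6)) (g' t) t := fun t => by
    have h1 := ((hs.dy t).const_add 1).log (hp1 t).ne'
    have h2 := ((hs.dy t).const_sub 1).log (hp2 t).ne'
    refine (((h1.sub h2).const_mul (1/2)).add ((hs.dφ t).div_const (6*r6))).congr_deriv ?_
    have a1 := (hp1 t).ne'
    have a2 := (hp2 t).ne'
    have e : 1 - y t^2 = (1 + y t) * (1 - y t) := by ring
    have e2 : u t^2 = (1 + y t) * (1 - y t) - z t^2 - w t^2 := by linarith [hs.sph t]
    simp only [hg']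
    rw [e, e2]
    field_simp
    ring
  have hgle : ∀ t ≤ 0, g' t ≤ (C2 + C1 + r6*C1*B + |cc γ| * C2 * B) * Real.exp (α*t) := fun t ht => by
    simp only [hg']
    rw [div_le_iff₀ (hSp t)]
    have hy1 : |y t| ≤ 1 := by rw [← sq_le_one_iff_abs_le_one]; linarith [hSp t]
    have b1 := hzS t ht
    have b2 := hwS t ht
    have a1 : |y t * ((2/3-γ/2) * z t^2 + 2/3*w t^2)| ≤ 1 * (z t^2 + w t^2) := by
      rw [abs_mul]
      have hp : 0 ≤ (2/3-γ/2) * z t^2 + 2/3*w t^2 := by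
        have : 0 ≤ 2/3-γ/2 := by linarith
        positivity
      rw [abs_of_nonneg hp]
      have : (2/3-γ/2) * z t^2 + 2/3*w t^2 ≤ z t^2 + w t^2 := by
        nlinarith [sq_nonneg (z t), sq_nonneg (w t)]
      gcongr
    have a2 : |r6 * w t^2 * ld V (φ t)| ≤ r6 * (C1 * Real.exp (α*t) * (1 - y t^2)) * B := by
      rw [abs_mul, abs_of_nonneg (by positivity : 0 ≤ r6 * w t^2)]
      have := hb.v1 t ht
      have := hSp t
      gcongr
    have a3 : |cc γ * z t^2 * ld χ (φ t)| ≤ |cc γ| * (C2 * Real.exp (α*t) * (1 - y t^2)) * B := by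
      rw [abs_mul, abs_mul, abs_of_nonneg (sq_nonneg (z t))]
      have := hb.x1 t ht
      have := hSp t
      gcongr
    have a1' := abs_le.1 a1
    have a2' := abs_le.1 a2
    have a3' := abs_le.1 a3
    nlinarith
  obtain ⟨L, hL⟩ := conv_past (D := D + M/(6*r6)) hα0 (by positivity) (fun t _ => hd t) hgle (fun t ht => by
    have h1 := hD t ht
    have h2 := (abs_le.1 (hM t ht)).2
    have : φ t / (6*r6) ≤ M/(6*r6) := by gcongr
    linarith)
  refine ⟨6*r6*L, ?_, hy0, hz0, hw0, hu0⟩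
  have := ((hL.sub hη0).const_mul (6*r6))
  rw [sub_zero] at this
  refine this.congr fun t => ?_
  field_simp
  ring

lemma case2 (hγ : 4/3 < γ) (hγ2 : γ < 2) (hs : IsSol γ V χ φ y z w u) (hzp : ∀ t, 0 < z t) {M : ℝ}
    (hV : ContDiff ℝ 3 V) (hχ : ContDiff ℝ 3 χ)
    (hVpos : ∀ x, 0 < V x) (hχpos : ∀ x, 0 < χ x)
    (hstat : Set.Finite {x : ℝ | deriv χ x = 0}) (hM : ∀ t ≤ 0, |φ t| ≤ M) :
    ∃ x, ld χ x = 0 ∧ Tendsto φ atBot (𝓝 x) ∧ Tendsto y atBot (𝓝 0) ∧ Tendsto z atBot (𝓝 1) ∧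
      Tendsto w atBot (𝓝 0) ∧ Tendsto u atBot (𝓝 0) := by
  have hr := r6_pos
  have hcc : 0 < cc γ := by unfold cc; apply mul_pos _ hr; linarith
  obtain ⟨B, hB0, hb⟩ := exists_bd hV hχ hVpos hχpos hM
  obtain ⟨C1, hC1, hw⟩ := w_ratio hs hb hV hVpos
  obtain ⟨C2, hC2, hu⟩ := u_ratio hs hb (fun t => (hzp t).ne') hχ hχpos
  set α := γ - 4/3 with hα
  have hα0 : 0 < α := by linarith
  have hw' : ∀ t ≤ 0, w t^2 ≤ C1 * Real.exp (α*t) * u t^2 := fun t ht => (hw t ht).trans (by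
    have : Real.exp (2*(2/3)*t) ≤ Real.exp (α*t) := Real.exp_le_exp.2 (by nlinarith)
    gcongr)
  have hu' : ∀ t ≤ 0, u t^2 ≤ C2 * Real.exp (α*t) * z t^2 := fun t ht => by
    have e : 2*(γ/2-2/3)*t = α*t := by rw [hα]; ring
    have := hu t ht
    rwa [e] at this
  have hSu : ∀ t, u t^2 ≤ 1 - y t^2 := fun t => by
    have := hs.sph t
    nlinarith [sq_nonneg (z t), sq_nonneg (w t)]
  have hSz : ∀ t, z t^2 ≤ 1 - y t^2 := fun t => by
    have := hs.sph t
    nlinarith [sq_nonneg (u t), sq_nonneg (w t)]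
  have hSp : ∀ t, 0 < 1 - y t^2 := fun t => (pow_pos (hs.upos t) 2).trans_le (hSu t)
  have hu1 : ∀ t, u t^2 ≤ 1 := fun t => (hSu t).trans (by nlinarith [sq_nonneg (y t)])
  have hz1 : ∀ t, z t^2 ≤ 1 := fun t => (hSz t).trans (by nlinarith [sq_nonneg (y t)])
  have hwS : ∀ t ≤ 0, w t^2 ≤ C1 * Real.exp (α*t) * (1 - y t^2) := fun t ht => (hw' t ht).trans (by
    have := hSu t
    gcongr)
  have huS : ∀ t ≤ 0, u t^2 ≤ C2 * Real.exp (α*t) * (1 - y t^2) := fun t ht => (hu' t ht).trans (by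
    have := hSz t
    gcongr)
  obtain ⟨hy0, L, hL⟩ := core (by linarith) hγ2 hs hB0 hb hχ hχpos (C := C1 + cc γ * (C1 + C2))
    (c := cc γ) hα0
    (by positivity) (fun t ht => (hwS t ht).trans (by
      have : 0 ≤ cc γ * (C1 + C2) * Real.exp (α*t) * (1 - y t^2) := mul_nonneg (by positivity) (hSp t).le
      nlinarith)) (fun t ht => by
      have e : cc γ * (1 - y t^2) - cc γ * z t^2 = cc γ * (w t^2 + u t^2) := by
        rw [← hs.sph t]; ring
      rw [e, abs_of_nonneg (by positivity)]
      have h1 := mul_le_mul_of_nonneg_left (hwS t ht) hcc.le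
      have h2 := mul_le_mul_of_nonneg_left (huS t ht) hcc.le
      have : 0 ≤ C1 * Real.exp (α*t) * (1 - y t^2) := mul_nonneg (by positivity) (hSp t).le
      nlinarith)
  have hu0 := sq_tendsto_zero hα0 hC2 hu' hz1
  have hw0 := sq_tendsto_zero hα0 hC1 hw' hu1
  have hz0 : Tendsto z atBot (𝓝 1) := by
    apply tendsto_one_of_sq hzp
    have : Tendsto (fun t => 1 - y t^2 - u t^2 - w t^2) atBot (𝓝 1) := by
      simpa using (((hy0.pow 2).const_sub 1).sub (hu0.pow 2)).sub (hw0.pow 2)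
    refine this.congr fun t => ?_
    linarith [hs.sph t]
  have hχl : Tendsto (fun t => χ (φ t)) atBot (𝓝 (Real.exp (1/cc γ * L))) := by
    refine ((hL.const_mul (1/cc γ)).rexp).congr fun t => ?_
    rw [← mul_assoc, one_div, inv_mul_cancel₀ hcc.ne', one_mul, Real.exp_log (hχpos _)]
  have hφc : Continuous φ := continuous_iff_continuousAt.2 fun t => (hs.dφ t).continuousAt
  obtain ⟨x, hx⟩ := conv_of_comp hφc hM hstat hχl
  refine ⟨x, ?_, hx, hy0, hz0, hw0, hu0⟩
  have hV1 := ((ld_contDiff hV hVpos).continuous.tendsto x).comp hx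
  have hχ1 := ((ld_contDiff hχ hχpos).continuous.tendsto x).comp hx
  have hlim := ((hy0.neg.mul ((((hz0.pow 2).const_mul (1-γ/2)).add (hw0.pow 2)).add
    ((hu0.pow 2).div_const 3))).sub (((hw0.pow 2).const_mul r6).mul hV1)).sub
      (((hz0.pow 2).const_mul (cc γ)).mul hχ1)
  have := limit_deriv_zero hs.dy hy0 hlim
  simp at this
  rcases this with h | h
  · exact absurd h hcc.ne'
  · exact h

lemma to_sol (hχ : ContDiff ℝ 3 χ) (hχpos : ∀ x, 0 < χ x) {σ : ℝ → E5}
    (hσ : ∀ t, HasDerivAt σ (hubbleField γ V χ (σ t)) t)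
    (h0 : ss (σ 0) = 1) (hu : 0 < σ 0 4) :
    IsSol γ V χ (fun t => σ t 0) (fun t => σ t 1) (fun t => σ t 2) (fun t => σ t 3) (fun t => σ t 4) ∧
      (0 < σ 0 2 → ∀ t, 0 < σ t 2) := by
  have hσc : Continuous σ := continuous_iff_continuousAt.2 fun t => (hσ t).continuousAt
  have hl : Continuous fun t => ld χ (σ t 0) := (ld_contDiff hχ hχpos).continuous.comp (by fun_prop)
  have hq : Continuous fun t => 6*σ t 1^2 + 3*γ*σ t 2^2 + 4*σ t 4^2 := by fun_prop
  have c1 : Continuous fun t => σ t 1 := by fun_prop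
  have d0 := fun t => (hasDerivAt_coord (hσ t) 0).congr_deriv (G0 γ V χ (σ t))
  have d1 := fun t => (hasDerivAt_coord (hσ t) 1).congr_deriv (G1 γ V χ (σ t))
  have d2 := fun t => (hasDerivAt_coord (hσ t) 2).congr_deriv (G2 γ V χ (σ t))
  have d3 := fun t => (hasDerivAt_coord (hσ t) 3).congr_deriv (G3 γ V χ (σ t))
  have d4 := fun t => (hasDerivAt_coord (hσ t) 4).congr_deriv (G4 γ V χ (σ t))
  have hss : ∀ t, σ t 1^2 + σ t 2^2 + σ t 3^2 + σ t 4^2 = 1 := by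
    have hd : ∀ t, HasDerivAt (fun t => σ t 1^2 + σ t 2^2 + σ t 3^2 + σ t 4^2 - 1)
      (((6*σ t 1^2 + 3*γ*σ t 2^2 + 4*σ t 4^2)/3) * (σ t 1^2 + σ t 2^2 + σ t 3^2 + σ t 4^2 - 1)) t := by
      intro t
      refine ((((((d1 t).pow 2).add ((d2 t).pow 2)).add ((d3 t).pow 2)).add
        ((d4 t).pow 2)).sub_const 1).congr_deriv ?_
      push_cast
      ring
    intro t
    have := lin_ode (hq.div_const 3) hd t
    unfold ss at h0
    rw [h0] at this
    linarith
  have e4 : ∀ t, HasDerivAt (fun t => σ t 4)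
      (((6*σ t 1^2+3*γ*σ t 2^2+4*σ t 4^2)/6 - 2/3) * σ t 4) t := fun t =>
    (d4 t).congr_deriv (by ring)
  have e2 : ∀ t, HasDerivAt (fun t => σ t 2)
      (((6*σ t 1^2+3*γ*σ t 2^2+4*σ t 4^2)/6 - γ/2 + cc γ * σ t 1 * ld χ (σ t 0)) * σ t 2) t := fun t =>
    (d2 t).congr_deriv (by unfold cc; ring)
  refine ⟨⟨d0, fun t => (d1 t).congr_deriv ?_, e2, fun t => (d3 t).congr_deriv (by ring), e4, hss, ?_⟩, ?_⟩
  · have : σ t 1^2 = 1 - σ t 2^2 - σ t 3^2 - σ t 4^2 := by linarith [hss t]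
    have e : (σ t 1)^3 = σ t 1 * (1 - σ t 2^2 - σ t 3^2 - σ t 4^2) := by rw [← this]; ring
    rw [e]; unfold cc; ring
  · intro t
    have := lin_ode ((hq.div_const 6).sub continuous_const) e4 t
    rw [this]; positivity
  · intro h t
    have := lin_ode (((hq.div_const 6).sub continuous_const).add ((continuous_const.mul c1).mul hl)) e2 t
    rw [this]; positivity

end Hub

namespace Hub

open Filter Topology

lemma norm_le_sum (v : E5) : ‖v‖ ≤ |v 0| + |v 1| + |v 2| + |v 3| + |v 4| := by
  rw [EuclideanSpace.norm_eq, Fin.sum_univ_five]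
  simp only [Real.norm_eq_abs]
  rw [Real.sqrt_le_left (by positivity)]
  have a0 := abs_nonneg (v 0)
  have a1 := abs_nonneg (v 1)
  have a2 := abs_nonneg (v 2)
  have a3 := abs_nonneg (v 3)
  have a4 := abs_nonneg (v 4)
  have : 0 ≤ |v 0| * |v 1| + |v 0| * |v 2| + |v 0| * |v 3| + |v 0| * |v 4| + |v 1| * |v 2|
    + |v 1| * |v 3| + |v 1| * |v 4| + |v 2| * |v 3| + |v 2| * |v 4| + |v 3| * |v 4| := by positivity
  nlinarith

lemma strict_bound {f : E5 → ℝ} {f' : E5 →L[ℝ] ℝ} {e : E5} (h : HasStrictFDerivAt f f' e) {ε : ℝ}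
    (hε : 0 < ε) : ∃ N, IsOpen N ∧ e ∈ N ∧ ∀ x ∈ N, ∀ y ∈ N, |f x - f y - f' (x - y)| ≤ ε * ‖x - y‖ := by
  obtain ⟨s, hs, ha⟩ := h.approximates_deriv_on_nhds (c := ⟨ε, hε.le⟩) (Or.inr hε)
  obtain ⟨N, hN, hNo, heN⟩ := mem_nhds_iff.1 hs
  exact ⟨N, hNo, heN, fun x hx y hy => ha x (hN hx) y (hN hy)⟩

lemma local_cone (g : E5 → E5) (iA iD : Fin 5) (e : E5) (d m a b : ℝ) (hd : 0 < d) (ha : 0 < a)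
    (hb : 0 < b) (hg0 : ∀ x, g x 0 = 2 * r6 * x 1) (f1 fA f3 : E5 →L[ℝ] ℝ)
    (h1 : HasStrictFDerivAt (fun x => g x 1) f1 e) (hf1 : ∀ v, f1 v = -d * v 1 - m * v 0)
    (hA : HasStrictFDerivAt (fun x => g x iA) fA e) (hfA : ∀ v, fA v = a * v iA)
    (h3 : HasStrictFDerivAt (fun x => g x 3) f3 e) (hf3 : ∀ v, f3 v = b * v 3)
    (heD : e iD = 1) (hperm : ∀ x, ss x = x 1^2 + x iA^2 + x 3^2 + x iD^2)
    (hnorm : ∀ v : E5, ‖v‖ ≤ |v 0| + |v 1| + |v iA| + |v 3| + |v iD|) :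
    ∃ N, IsOpen N ∧ e ∈ N ∧ ∃ C, 0 ≤ C ∧ ∀ (σ ρ : ℝ → E5) (T : ℝ),
      (∀ t, HasDerivAt σ (g (σ t)) t) → (∀ t, HasDerivAt ρ (g (ρ t)) t) →
      (∀ t, ss (σ t) = 1) → (∀ t, ss (ρ t) = 1) →
      (∀ t ≤ T, σ t ∈ N) → (∀ t ≤ T, ρ t ∈ N) →
      dist (σ T) (ρ T) ≤ C * dist ![σ T 0, σ T iA, σ T 3] ![ρ T 0, ρ T iA, ρ T 3] := by
  obtain ⟨ε, hε, C, hC, hcone⟩ := cone (2*r6) d m a b (by have := r6_pos; positivity) hd ha hb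
  obtain ⟨N1, hN1, heN1, b1⟩ := strict_bound h1 (ε := ε/3) (by positivity)
  obtain ⟨NA, hNA, heNA, bA⟩ := strict_bound hA (ε := ε/3) (by positivity)
  obtain ⟨N3, hN3, heN3, b3⟩ := strict_bound h3 (ε := ε/3) (by positivity)
  set N0 : Set E5 := {x | 1/2 < x iD ∧ |x 0 - e 0| < 1} with hN0
  have hN0o : IsOpen N0 := by
    have q1 : IsOpen {x : E5 | 1/2 < x iD} := isOpen_lt continuous_const (by fun_prop)
    have q2 : IsOpen {x : E5 | |x 0 - e 0| < 1} := isOpen_lt (by fun_prop) continuous_const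
    exact q1.inter q2
  refine ⟨N1 ∩ NA ∩ N3 ∩ N0, ((hN1.inter hNA).inter hN3).inter hN0o,
    ⟨⟨⟨heN1, heNA⟩, heN3⟩, by rw [heD]; norm_num, by simp⟩, 9*(1+C), by positivity, ?_⟩
  intro σ ρ T hσ hρ sσ sρ nσ nρ
  have habs : ∀ x : E5, ss x = 1 → |x 1| ≤ 1 ∧ |x iA| ≤ 1 ∧ |x 3| ≤ 1 := fun x hx => by
    rw [hperm] at hx
    refine ⟨?_, ?_, ?_⟩ <;> rw [← sq_le_one_iff_abs_le_one] <;>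
      nlinarith [sq_nonneg (x 1), sq_nonneg (x iA), sq_nonneg (x 3), sq_nonneg (x iD)]
  have hnb : ∀ t ≤ T, ‖σ t - ρ t‖ ≤ 3 * (|σ t 0 - ρ t 0| + |σ t 1 - ρ t 1| + |σ t iA - ρ t iA|
      + |σ t 3 - ρ t 3|) := by
    intro t ht
    have hn := hnorm (σ t - ρ t)
    simp only [PiLp.sub_apply] at hn
    have e1 := sσ t
    have e2 := sρ t
    rw [hperm] at e1 e2
    obtain ⟨p1, p2, p3⟩ := habs _ (sσ t)
    obtain ⟨q1, q2, q3⟩ := habs _ (sρ t)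
    have dσ := (nσ t ht).2.1
    have dρ := (nρ t ht).2.1
    have key : (σ t iD - ρ t iD) * (σ t iD + ρ t iD) = -((σ t 1 - ρ t 1) * (σ t 1 + ρ t 1)
      + (σ t iA - ρ t iA) * (σ t iA + ρ t iA) + (σ t 3 - ρ t 3) * (σ t 3 + ρ t 3)) := by
      linear_combination e1 - e2
    have hmul : ∀ x y : ℝ, |x| ≤ 1 → |y| ≤ 1 → |(x-y)*(x+y)| ≤ 2 * |x - y| := fun x y hx hy => by
      rw [abs_mul]
      have := abs_add_le x y
      nlinarith [abs_nonneg (x-y)]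
    have m1 := hmul _ _ p1 q1
    have m2 := hmul _ _ p2 q2
    have m3 := hmul _ _ p3 q3
    have hD : |σ t iD - ρ t iD| ≤ 2 * (|σ t 1 - ρ t 1| + |σ t iA - ρ t iA| + |σ t 3 - ρ t 3|) := by
      have l1 : |σ t iD - ρ t iD| ≤ |(σ t iD - ρ t iD) * (σ t iD + ρ t iD)| := by
        rw [abs_mul]
        apply le_mul_of_one_le_right (abs_nonneg _)
        exact le_trans (by linarith) (le_abs_self _)
      rw [key, abs_neg] at l1
      have l2 := abs_add_three ((σ t 1 - ρ t 1) * (σ t 1 + ρ t 1))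
        ((σ t iA - ρ t iA) * (σ t iA + ρ t iA)) ((σ t 3 - ρ t 3) * (σ t 3 + ρ t 3))
      linarith
    linarith [abs_nonneg (σ t 0 - ρ t 0)]
  have hdiff : ∀ i t, HasDerivAt (fun t => σ t i - ρ t i) (g (σ t) i - g (ρ t) i) t := fun i t =>
    (hasDerivAt_coord (hσ t) i).sub (hasDerivAt_coord (hρ t) i)
  have hy := hcone (fun t => σ t 0 - ρ t 0) (fun t => σ t 1 - ρ t 1) (fun t => σ t iA - ρ t iA)
    (fun t => σ t 3 - ρ t 3) (fun t => g (σ t) 1 - g (ρ t) 1 - f1 (σ t - ρ t))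
    (fun t => g (σ t) iA - g (ρ t) iA - fA (σ t - ρ t))
    (fun t => g (σ t) 3 - g (ρ t) 3 - f3 (σ t - ρ t)) T 8
    (fun t _ => (hdiff 0 t).congr_deriv (by rw [hg0, hg0]; ring))
    (fun t _ => (hdiff 1 t).congr_deriv (by rw [hf1]; simp only [PiLp.sub_apply]; ring))
    (fun t _ => (hdiff iA t).congr_deriv (by rw [hfA]; simp only [PiLp.sub_apply]; ring))
    (fun t _ => (hdiff 3 t).congr_deriv (by rw [hf3]; simp only [PiLp.sub_apply]; ring))
    (fun t ht => (b1 _ (nσ t ht).1.1.1 _ (nρ t ht).1.1.1).trans (by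
      have := mul_le_mul_of_nonneg_left (hnb t ht) (by positivity : 0 ≤ ε/3)
      linarith))
    (fun t ht => (bA _ (nσ t ht).1.1.2 _ (nρ t ht).1.1.2).trans (by
      have := mul_le_mul_of_nonneg_left (hnb t ht) (by positivity : 0 ≤ ε/3)
      linarith))
    (fun t ht => (b3 _ (nσ t ht).1.2 _ (nρ t ht).1.2).trans (by
      have := mul_le_mul_of_nonneg_left (hnb t ht) (by positivity : 0 ≤ ε/3)
      linarith))
    (fun t ht => by
      obtain ⟨p1, p2, p3⟩ := habs _ (sσ t)
      obtain ⟨q1, q2, q3⟩ := habs _ (sρ t)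
      have r0 := abs_sub_le (σ t 0) (e 0) (ρ t 0)
      have r0' := (nσ t ht).2.2
      have r0'' := (nρ t ht).2.2
      rw [abs_sub_comm (ρ t 0)] at r0''
      have r1 := abs_sub (σ t 1) (ρ t 1)
      have r2 := abs_sub (σ t iA) (ρ t iA)
      have r3 := abs_sub (σ t 3) (ρ t 3)
      linarith)
  simp only at hy
  have hT := hnb T le_rfl
  set δ := dist ![σ T 0, σ T iA, σ T 3] ![ρ T 0, ρ T iA, ρ T 3] with hδ
  have k0 : |σ T 0 - ρ T 0| ≤ δ := by
    simpa [Real.dist_eq] using dist_le_pi_dist ![σ T 0, σ T iA, σ T 3] ![ρ T 0, ρ T iA, ρ T 3] 0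
  have k1 : |σ T iA - ρ T iA| ≤ δ := by
    simpa [Real.dist_eq] using dist_le_pi_dist ![σ T 0, σ T iA, σ T 3] ![ρ T 0, ρ T iA, ρ T 3] 1
  have k2 : |σ T 3 - ρ T 3| ≤ δ := by
    simpa [Real.dist_eq] using dist_le_pi_dist ![σ T 0, σ T iA, σ T 3] ![ρ T 0, ρ T iA, ρ T 3] 2
  rw [dist_eq_norm]
  have k3 : C * (|σ T 0 - ρ T 0| + |σ T iA - ρ T iA| + |σ T 3 - ρ T 3|) ≤ C * (3*δ) := by
    gcongr; linarith
  linarith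

end Hub

namespace Hub

open Filter Topology

/-- The local antilipschitz property near `e`. -/
def LocProp (g : E5 → E5) (iA : Fin 5) (e : E5) : Prop :=
    ∃ N, IsOpen N ∧ e ∈ N ∧ ∃ C, 0 ≤ C ∧ ∀ (σ ρ : ℝ → E5) (T : ℝ),
      (∀ t, HasDerivAt σ (g (σ t)) t) → (∀ t, HasDerivAt ρ (g (ρ t)) t) →
      (∀ t, ss (σ t) = 1) → (∀ t, ss (ρ t) = 1) →
      (∀ t ≤ T, σ t ∈ N) → (∀ t ≤ T, ρ t ∈ N) →
      dist (σ T) (ρ T) ≤ C * dist ![σ T 0, σ T iA, σ T 3] ![ρ T 0, ρ T iA, ρ T 3]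

lemma strict_of_line {g : E5 → E5} (hg : ContDiff ℝ 1 g) (e : E5) (i : Fin 5) (c : E5 → ℝ)
    (h : ∀ v, HasDerivAt (fun s : ℝ => g (e + s • v) i) (c v) 0) :
    ∃ f : E5 →L[ℝ] ℝ, HasStrictFDerivAt (fun x => g x i) f e ∧ ∀ v, f v = c v := by
  have hs : HasStrictFDerivAt g (fderiv ℝ g e) e := (hg.contDiffAt).hasStrictFDerivAt (by norm_num)
  have hs2 := ((EuclideanSpace.proj i : E5 →L[ℝ] ℝ).hasStrictFDerivAt (x := g e)).comp e hs
  refine ⟨_, hs2, fun v => ?_⟩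
  have hl : HasDerivAt (fun s : ℝ => e + s • v) v 0 := by
    simpa using ((hasDerivAt_id (0:ℝ)).smul_const v).const_add e
  have h3 := HasFDerivAt.comp_hasDerivAt_of_eq (0:ℝ) hs2.hasFDerivAt hl (by simp)
  exact h3.unique (h v)

variable {γ : ℝ} {V χ : ℝ → ℝ}

lemma line (e v : E5) (i : Fin 5) : HasDerivAt (fun s : ℝ => (e + s • v) i) (v i) 0 := by
  have : HasDerivAt (fun s : ℝ => e i + s * v i) (v i) 0 := by
    simpa using ((hasDerivAt_id (0:ℝ)).mul_const (v i)).const_add (e i)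
  simpa using this

lemma line_ld {f : ℝ → ℝ} (hf : ContDiff ℝ 3 f) (h : ∀ x, 0 < f x) (e v : E5) :
    HasDerivAt (fun s : ℝ => ld f ((e + s • v) 0)) (deriv (ld f) (e 0) * v 0) 0 := by
  have h1 : HasDerivAt (ld f) (deriv (ld f) (e 0)) ((e + (0:ℝ) • v) 0) := by
    simpa using (((ld_contDiff hf h).differentiable (by norm_num)) (e 0)).hasDerivAt
  exact h1.comp (0:ℝ) (line e v 0)

lemma G1_line (hV : ContDiff ℝ 3 V) (hχ : ContDiff ℝ 3 χ)
    (hVpos : ∀ x, 0 < V x) (hχpos : ∀ x, 0 < χ x) (e v : E5) (h1 : e 1 = 0) (h3 : e 3 = 0) :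
    HasDerivAt (fun s : ℝ => hubbleField γ V χ (e + s • v) 1)
      ((1/6) * (3*γ*(e 2)^2 + 4*(e 4)^2 - 6) * v 1 + (4 - 3*γ) / 2 * r6 *
        (2 * e 2 * v 2 * ld χ (e 0) + (e 2)^2 * (deriv (ld χ) (e 0) * v 0))) 0 := by
  simp only [G1]
  have l := line e v
  refine (((((l 1).pow 3).add (((((((l 2).pow 2).const_mul (3*γ)).add (((l 4).pow 2).const_mul 4)).sub_const
    6).const_mul (1/6)).mul (l 1))).sub ((((l 3).pow 2).const_mul r6).mul (line_ld hV hVpos e v))).add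
    ((((l 2).pow 2).const_mul ((4 - 3*γ) / 2 * r6)).mul (line_ld hχ hχpos e v))).congr_deriv ?_
  simp [h1, h3]
  ring

lemma G2_line (hχ : ContDiff ℝ 3 χ) (hχpos : ∀ x, 0 < χ x) (e v : E5) (h1 : e 1 = 0) (h2 : e 2 = 0)
    (h4 : e 4 = 1) :
    HasDerivAt (fun s : ℝ => hubbleField γ V χ (e + s • v) 2) ((4-3*γ)/6 * v 2) 0 := by
  simp only [G2]
  have l := line e v
  refine ((((l 2).const_mul (1/6)).mul (((((l 1).pow 2).const_mul 6).add ((((l 2).pow 2).sub_const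
    1).const_mul (3*γ))).add (((l 4).pow 2).const_mul 4))).sub
    ((((l 1).const_mul ((4 - 3*γ) / 2 * r6)).mul (l 2)).mul (line_ld hχ hχpos e v))).congr_deriv ?_
  simp [h1, h2, h4]
  ring

lemma G3_line (hV : ContDiff ℝ 3 V) (hVpos : ∀ x, 0 < V x) (e v : E5) (h1 : e 1 = 0) (h3 : e 3 = 0) :
    HasDerivAt (fun s : ℝ => hubbleField γ V χ (e + s • v) 3)
      ((1/6) * (3*γ*(e 2)^2 + 4*(e 4)^2) * v 3) 0 := by
  simp only [G3]
  have l := line e v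
  refine ((((l 3).const_mul (1/6)).mul (((((l 1).pow 2).const_mul 6).add (((l 2).pow 2).const_mul (3*γ))).add
    (((l 4).pow 2).const_mul 4))).add
    ((((l 1).const_mul r6).mul (l 3)).mul (line_ld hV hVpos e v))).congr_deriv ?_
  simp [h1, h3]
  ring

lemma G4_line (e v : E5) (h1 : e 1 = 0) (h4 : e 4 = 0) (h2 : e 2 = 1) :
    HasDerivAt (fun s : ℝ => hubbleField γ V χ (e + s • v) 4) ((3*γ-4)/6 * v 4) 0 := by
  simp only [G4]
  have l := line e v
  refine (((l 4).const_mul (1/6)).mul ((((((l 1).pow 2).const_mul 6).add (((l 2).pow 2).const_mul (3*γ))).add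
    (((l 4).pow 2).const_mul 4)).sub_const 4)).congr_deriv ?_
  simp [h1, h2, h4]
  ring

lemma loc1 (hγ : γ < 4/3) (hV : ContDiff ℝ 3 V) (hχ : ContDiff ℝ 3 χ)
    (hVpos : ∀ x, 0 < V x) (hχpos : ∀ x, 0 < χ x) (e : E5) (h1 : e 1 = 0) (h2 : e 2 = 0) (h3 : e 3 = 0)
    (h4 : e 4 = 1) : LocProp (hubbleField γ V χ) 2 e := by
  have hg : ContDiff ℝ 1 (hubbleField γ V χ) := G_contDiff hV hχ hVpos hχpos
  obtain ⟨f1, a1, b1⟩ := strict_of_line hg e 1 _ (fun v => G1_line hV hχ hVpos hχpos e v h1 h3)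
  obtain ⟨f2, a2, b2⟩ := strict_of_line hg e 2 _ (fun v => G2_line hχ hχpos e v h1 h2 h4)
  obtain ⟨f3, a3, b3⟩ := strict_of_line hg e 3 _ (fun v => G3_line hV hVpos e v h1 h3)
  refine local_cone _ 2 4 e (1/3) 0 ((4-3*γ)/6) (2/3) (by norm_num) (by linarith) (by norm_num)
    (G0 γ V χ) f1 f2 f3 a1 (fun v => ?_) a2 b2 a3 (fun v => ?_) h4 (fun x => rfl) norm_le_sum
  · rw [b1, h2, h4]; ring
  · rw [b3, h2, h4]; ring

lemma loc2 (hγ : 4/3 < γ) (hγ2 : γ < 2) (hV : ContDiff ℝ 3 V) (hχ : ContDiff ℝ 3 χ)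
    (hVpos : ∀ x, 0 < V x) (hχpos : ∀ x, 0 < χ x) (e : E5) (h0 : ld χ (e 0) = 0)
    (h1 : e 1 = 0) (h2 : e 2 = 1) (h3 : e 3 = 0)
    (h4 : e 4 = 0) : LocProp (hubbleField γ V χ) 4 e := by
  have hg : ContDiff ℝ 1 (hubbleField γ V χ) := G_contDiff hV hχ hVpos hχpos
  obtain ⟨f1, a1, b1⟩ := strict_of_line hg e 1 _ (fun v => G1_line hV hχ hVpos hχpos e v h1 h3)
  obtain ⟨f2, a2, b2⟩ := strict_of_line hg e 4 _ (fun v => G4_line e v h1 h4 h2)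
  obtain ⟨f3, a3, b3⟩ := strict_of_line hg e 3 _ (fun v => G3_line hV hVpos e v h1 h3)
  refine local_cone _ 4 2 e (1-γ/2) (cc γ * deriv (ld χ) (e 0)) ((3*γ-4)/6) (γ/2) (by linarith)
    (by linarith) (by linarith)
    (G0 γ V χ) f1 f2 f3 a1 (fun v => ?_) a2 b2 a3 (fun v => ?_) h2 (fun x => ?_) (fun v => ?_)
  · rw [b1, h2, h4, h0]; unfold cc; ring
  · rw [b3, h2, h4]; ring
  · unfold ss; ring
  · linarith [norm_le_sum v]

end Hub

namespace Hub

open Filter Topology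

lemma tendsto_E5 {σ : ℝ → E5} {e : E5} (h : ∀ i, Tendsto (fun t => σ t i) atBot (𝓝 (e i))) :
    Tendsto σ atBot (𝓝 e) :=
  ((PiLp.continuous_toLp 2 (fun _ : Fin 5 => ℝ)).tendsto (fun i => e i)).comp (tendsto_pi_nhds.2 h)

lemma sphere_abs {x : E5} (h : ss x = 1) : |x 1| ≤ 1 ∧ |x 2| ≤ 1 ∧ |x 3| ≤ 1 ∧ |x 4| ≤ 1 := by
  unfold ss at h
  refine ⟨?_, ?_, ?_, ?_⟩ <;> rw [← sq_le_one_iff_abs_le_one] <;>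
    nlinarith [sq_nonneg (x 1), sq_nonneg (x 2), sq_nonneg (x 3), sq_nonneg (x 4)]

lemma piece {g : E5 → E5} (hg : ContDiff ℝ 1 g) (iA : Fin 5) (N : Set E5) (C : ℝ) (hC : 0 ≤ C)
    (hN : ∀ (σ ρ : ℝ → E5) (T : ℝ),
      (∀ t, HasDerivAt σ (g (σ t)) t) → (∀ t, HasDerivAt ρ (g (ρ t)) t) →
      (∀ t, ss (σ t) = 1) → (∀ t, ss (ρ t) = 1) →
      (∀ t ≤ T, σ t ∈ N) → (∀ t ≤ T, ρ t ∈ N) →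
      dist (σ T) (ρ T) ≤ C * dist ![σ T 0, σ T iA, σ T 3] ![ρ T 0, ρ T iA, ρ T 3])
    (Φ : E5 → ℝ → E5) (S : Set E5) (T M : ℝ) (hT : T ≤ 0)
    (h0 : ∀ p ∈ S, Φ p 0 = p) (hd : ∀ p ∈ S, ∀ t, HasDerivAt (Φ p) (g (Φ p t)) t)
    (hs : ∀ p ∈ S, ∀ t, ss (Φ p t) = 1) (hM : ∀ p ∈ S, ∀ t ≤ 0, |Φ p t 0| ≤ M)
    (hNT : ∀ p ∈ S, ∀ t ≤ T, Φ p t ∈ N) : μH[4] S = 0 := by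
  obtain ⟨K, hK⟩ := (hg.locallyLipschitz.locallyLipschitzOn (s := Metric.closedBall (0:E5) (M+4))
    ).exists_lipschitzOnWith_of_compact (isCompact_closedBall _ _)
  have hmem : ∀ p ∈ S, ∀ t ≤ 0, Φ p t ∈ Metric.closedBall (0:E5) (M+4) := fun p hp t ht => by
    rw [mem_closedBall_zero_iff]
    obtain ⟨a1, a2, a3, a4⟩ := sphere_abs (hs p hp t)
    linarith [norm_le_sum (Φ p t), hM p hp t ht]
  refine null_of_antilip (fun p => ![Φ p T 0, Φ p T iA, Φ p T 3]) (C * Real.exp (K * (0 - T))) ?_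
  intro p hp q hq
  have hc : ∀ p ∈ S, Continuous (Φ p) := fun p hp =>
    continuous_iff_continuousAt.2 fun t => (hd p hp t).continuousAt
  have h1 := hN (Φ p) (Φ q) T (hd p hp) (hd q hq) (hs p hp) (hs q hq) (hNT p hp) (hNT q hq)
  have h2 := dist_le_of_trajectories_ODE_of_mem (v := fun _ => g) (K := K) (a := T) (b := 0)
    (s := fun _ => Metric.closedBall (0:E5) (M+4)) (f := Φ p) (g := Φ q) (fun _ _ => hK)
    (hc p hp).continuousOn (fun t _ => (hd p hp t).hasDerivWithinAt) (fun t ht => hmem p hp t ht.2.le)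
    (hc q hq).continuousOn (fun t _ => (hd q hq t).hasDerivWithinAt) (fun t ht => hmem q hq t ht.2.le)
    h1 0 (right_mem_Icc.2 hT)
  rw [h0 p hp, h0 q hq] at h2
  linarith

lemma assemble {g : E5 → E5} (hg : ContDiff ℝ 1 g) (iA : Fin 5) (Q : Set E5)
    (hloc : ∀ e ∈ Q, LocProp g iA e) (Φ : E5 → ℝ → E5) (S : Set E5)
    (h0 : ∀ p ∈ S, Φ p 0 = p) (hd : ∀ p ∈ S, ∀ t, HasDerivAt (Φ p) (g (Φ p t)) t)
    (hs : ∀ p ∈ S, ∀ t, ss (Φ p t) = 1) (hM : ∀ p ∈ S, ∃ M : ℝ, ∀ t ≤ 0, |Φ p t 0| ≤ M)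
    (hlim : ∀ p ∈ S, ∃ e ∈ Q, Tendsto (Φ p) atBot (𝓝 e)) : μH[4] S = 0 := by
  classical
  have hloc' : ∀ e : E5, ∃ N, e ∈ Q → IsOpen N ∧ e ∈ N ∧ ∃ C, 0 ≤ C ∧ ∀ (σ ρ : ℝ → E5) (T : ℝ),
      (∀ t, HasDerivAt σ (g (σ t)) t) → (∀ t, HasDerivAt ρ (g (ρ t)) t) →
      (∀ t, ss (σ t) = 1) → (∀ t, ss (ρ t) = 1) →
      (∀ t ≤ T, σ t ∈ N) → (∀ t ≤ T, ρ t ∈ N) →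
      dist (σ T) (ρ T) ≤ C * dist ![σ T 0, σ T iA, σ T 3] ![ρ T 0, ρ T iA, ρ T 3] := fun e => by
    by_cases he : e ∈ Q
    · obtain ⟨N, h⟩ := hloc e he
      exact ⟨N, fun _ => h⟩
    · exact ⟨∅, fun h => absurd h he⟩
  choose N hN using hloc'
  obtain ⟨c, hcQ, hcc, hcov⟩ := TopologicalSpace.countable_cover_nhdsWithin (f := N) (s := Q)
    (fun e he => mem_nhdsWithin_of_mem_nhds ((hN e he).1.mem_nhds (hN e he).2.1))
  have hsub : S ⊆ ⋃ e ∈ c, ⋃ n : ℕ, ⋃ M : ℕ,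
      {p | p ∈ S ∧ (∀ t ≤ 0, |Φ p t 0| ≤ (M:ℝ)) ∧ ∀ t ≤ -(n:ℝ), Φ p t ∈ N e} := by
    intro p hp
    obtain ⟨e', he', hl⟩ := hlim p hp
    obtain ⟨e, hec, he⟩ := mem_iUnion₂.1 (hcov he')
    obtain ⟨T, hT⟩ := eventually_atBot.1 (hl.eventually ((hN e (hcQ hec)).1.mem_nhds he))
    obtain ⟨M, hM⟩ := hM p hp
    obtain ⟨M', hM'⟩ := exists_nat_ge M
    obtain ⟨n, hn⟩ := exists_nat_ge (-T)
    simp only [mem_iUnion]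
    exact ⟨e, hec, n, M', hp, fun t ht => (hM t ht).trans hM', fun t ht => hT t (by linarith)⟩
  refine measure_mono_null hsub ((measure_biUnion_null_iff hcc).2 fun e he =>
    measure_iUnion_null fun n => measure_iUnion_null fun M => ?_)
  obtain ⟨-, -, C, hC, hcone⟩ := hN e (hcQ he)
  exact piece hg iA (N e) C hC hcone Φ _ (-(n:ℝ)) M (by simp) (fun p hp => h0 p hp.1)
    (fun p hp => hd p hp.1) (fun p hp => hs p hp.1) (fun p hp => hp.2.1) (fun p hp => hp.2.2)

lemma zero_part : μH[4] {p : E5 | ss p = 1 ∧ p 2 = 0 ∧ 0 < p 4} = 0 := by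
  have hsub : {p : E5 | ss p = 1 ∧ p 2 = 0 ∧ 0 < p 4} ⊆
      ⋃ n : ℕ, {p : E5 | ss p = 1 ∧ p 2 = 0 ∧ 1/((n:ℝ)+1) < p 4} := by
    rintro p ⟨h1, h2, h3⟩
    obtain ⟨n, hn⟩ := exists_nat_one_div_lt h3
    exact mem_iUnion.2 ⟨n, h1, h2, hn⟩
  refine measure_mono_null hsub (measure_iUnion_null fun n => ?_)
  refine null_of_antilip (fun p => ![p 0, p 1, p 3]) (3 + 2*((n:ℝ)+1)) ?_
  rintro p ⟨p1, p2, p3⟩ q ⟨q1, q2, q3⟩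
  obtain ⟨a1, -, a3, -⟩ := sphere_abs p1
  obtain ⟨b1, -, b3, -⟩ := sphere_abs q1
  set δ := dist ![p 0, p 1, p 3] ![q 0, q 1, q 3] with hδ
  have k0 : |p 0 - q 0| ≤ δ := by
    simpa [Real.dist_eq] using dist_le_pi_dist ![p 0, p 1, p 3] ![q 0, q 1, q 3] 0
  have k1 : |p 1 - q 1| ≤ δ := by
    simpa [Real.dist_eq] using dist_le_pi_dist ![p 0, p 1, p 3] ![q 0, q 1, q 3] 1
  have k3 : |p 3 - q 3| ≤ δ := by
    simpa [Real.dist_eq] using dist_le_pi_dist ![p 0, p 1, p 3] ![q 0, q 1, q 3] 2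
  unfold ss at p1 q1
  have key : (p 4 - q 4) * (p 4 + q 4) = -((p 1 - q 1) * (p 1 + q 1) + (p 3 - q 3) * (p 3 + q 3)) := by
    rw [p2] at p1
    rw [q2] at q1
    linear_combination p1 - q1
  have hmul : ∀ x y : ℝ, |x| ≤ 1 → |y| ≤ 1 → |(x-y)*(x+y)| ≤ 2 * |x - y| := fun x y hx hy => by
    rw [abs_mul]
    have := abs_add_le x y
    nlinarith [abs_nonneg (x-y)]
  have m1 := hmul _ _ a1 b1
  have m3 := hmul _ _ a3 b3
  have l1 : |p 4 - q 4| * (p 4 + q 4) ≤ 4 * δ := by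
    have e : |(p 4 - q 4) * (p 4 + q 4)| = |p 4 - q 4| * (p 4 + q 4) := by
      rw [abs_mul]
      congr 1
      apply abs_of_pos
      have : 0 < 1/((n:ℝ)+1) := by positivity
      linarith
    rw [← e, key, abs_neg]
    have := abs_add_le ((p 1 - q 1) * (p 1 + q 1)) ((p 3 - q 3) * (p 3 + q 3))
    linarith
  have l2 : |p 4 - q 4| * (2 * (1/((n:ℝ)+1))) ≤ 4 * δ := le_trans (by gcongr; linarith) l1
  have l3 : |p 4 - q 4| ≤ 2*((n:ℝ)+1) * δ := by
    have hn : (0:ℝ) < (n:ℝ)+1 := by positivity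
    have e : |p 4 - q 4| = (|p 4 - q 4| * (2 * (1/((n:ℝ)+1)))) * (((n:ℝ)+1)/2) := by field_simp
    rw [e]
    have := mul_le_mul_of_nonneg_right l2 (by positivity : 0 ≤ ((n:ℝ)+1)/2)
    linarith
  have hn := norm_le_sum (p - q)
  simp only [PiLp.sub_apply, p2, q2, sub_zero, abs_zero] at hn
  rw [dist_eq_norm]
  have : 0 ≤ δ := dist_nonneg
  linarith

end Hub


/-- (Theorem 3.6) If `χ` and `V` are positive `C³` functions, `χ` has finitely many
stationary points and is bounded away from zero on compact sets, and
`γ ∈ (0, 4/3) ∪ (4/3, 2)`, then the set of points `p ∈ Σ₊` whose past orbit has bounded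
scalar field `σ₁` has four-dimensional Hausdorff measure zero; i.e. for almost all
`p ∈ Σ₊` the scalar field diverges into the past. -/
theorem stmt_11
    (γ : ℝ) (hγ0 : 0 < γ) (hγ2 : γ < 2) (hγ43 : γ ≠ 4/3)
    (V χ : ℝ → ℝ) (hV : ContDiff ℝ 3 V) (hχ : ContDiff ℝ 3 χ)
    (hVpos : ∀ x, 0 < V x) (hχpos : ∀ x, 0 < χ x)
    (hχstat : Set.Finite {x : ℝ | deriv χ x = 0})
    (hχcpt : ∀ K : Set ℝ, IsCompact K → ∃ c > 0, ∀ x ∈ K, c ≤ χ x) :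
    μH[4] {p : EuclideanSpace ℝ (Fin 5) |
        (p 1^2 + p 2^2 + p 3^2 + p 4^2 = 1 ∧ 0 ≤ p 2 ∧ 0 ≤ p 3 ∧ 0 < p 4) ∧
        ∃ M : ℝ, ∀ (a b : ℝ) (σ : ℝ → EuclideanSpace ℝ (Fin 5)),
          a < 0 → 0 < b → σ 0 = p →
          (∀ t ∈ Ioo a b, HasDerivAt σ (hubbleField γ V χ (σ t)) t) →
          ∀ t ∈ Ioo a b, t ≤ 0 → |σ t 0| ≤ M} = 0 := by
  have hg : ContDiff ℝ 1 (hubbleField γ V χ) := Hub.G_contDiff hV hχ hVpos hχpos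
  have hex : ∀ p : Hub.E5, ∃ σ : ℝ → Hub.E5, Hub.ss p = 1 →
      σ 0 = p ∧ ∀ t, HasDerivAt σ (hubbleField γ V χ (σ t)) t := fun p => by
    by_cases hp : Hub.ss p = 1
    · obtain ⟨σ, h⟩ := Hub.exists_global hV hχ hVpos hχpos p hp
      exact ⟨σ, fun _ => h⟩
    · exact ⟨fun _ => 0, fun h => absurd h hp⟩
  choose Φ hΦ using hex
  set S : Set Hub.E5 := {p | Hub.ss p = 1 ∧ 0 < p 4 ∧ ∃ M : ℝ, ∀ t ≤ 0, |Φ p t 0| ≤ M} with hS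
  have hsol := fun p (hp : p ∈ S) => Hub.to_sol hχ hχpos (hΦ p hp.1).2
    (by rw [(hΦ p hp.1).1]; exact hp.1) (by rw [(hΦ p hp.1).1]; exact hp.2.1)
  have hsub : {p : EuclideanSpace ℝ (Fin 5) |
        (p 1^2 + p 2^2 + p 3^2 + p 4^2 = 1 ∧ 0 ≤ p 2 ∧ 0 ≤ p 3 ∧ 0 < p 4) ∧
        ∃ M : ℝ, ∀ (a b : ℝ) (σ : ℝ → EuclideanSpace ℝ (Fin 5)),
          a < 0 → 0 < b → σ 0 = p →
          (∀ t ∈ Ioo a b, HasDerivAt σ (hubbleField γ V χ (σ t)) t) →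
          ∀ t ∈ Ioo a b, t ≤ 0 → |σ t 0| ≤ M} ⊆ {p | p ∈ S ∧ 0 ≤ p 2} := by
    rintro p ⟨⟨h1, h2, h3, h4⟩, M, hM⟩
    obtain ⟨e0, ed⟩ := hΦ p h1
    exact ⟨⟨h1, h4, M, fun t ht => hM (t-1) 1 (Φ p) (by linarith) one_pos e0 (fun s _ => ed s) t
      ⟨by linarith, by linarith⟩ ht⟩, h2⟩
  refine measure_mono_null hsub ?_
  rcases lt_or_gt_of_ne hγ43 with hγ | hγ
  · refine Hub.assemble hg 2 {e | e 1 = 0 ∧ e 2 = 0 ∧ e 3 = 0 ∧ e 4 = 1}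
      (fun e he => Hub.loc1 hγ hV hχ hVpos hχpos e he.1 he.2.1 he.2.2.1 he.2.2.2) Φ _
      (fun p hp => (hΦ p hp.1.1).1) (fun p hp => (hΦ p hp.1.1).2) (fun p hp => (hsol p hp.1).1.sph)
      (fun p hp => hp.1.2.2) ?_
    rintro p ⟨hp, -⟩
    obtain ⟨M, hM⟩ := hp.2.2
    obtain ⟨x, l0, l1, l2, l3, l4⟩ := Hub.case1 hγ0 hγ (hsol p hp).1 hV hχ hVpos hχpos hM
    refine ⟨!₂[x, 0, 0, 0, 1], by simp, Hub.tendsto_E5 fun i => ?_⟩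
    fin_cases i
    · exact l0
    · exact l1
    · exact l2
    · exact l3
    · exact l4
  · have hsub2 : {p | p ∈ S ∧ 0 ≤ p 2} ⊆
        {p : Hub.E5 | Hub.ss p = 1 ∧ p 2 = 0 ∧ 0 < p 4} ∪ {p | p ∈ S ∧ 0 < p 2} := by
      rintro p ⟨hp, h2⟩
      rcases h2.eq_or_lt with h | h
      · exact Or.inl ⟨hp.1, h.symm, hp.2.1⟩
      · exact Or.inr ⟨hp, h⟩
    refine measure_mono_null hsub2 (measure_union_null Hub.zero_part ?_)
    refine Hub.assemble hg 4 {e | Hub.ld χ (e 0) = 0 ∧ e 1 = 0 ∧ e 2 = 1 ∧ e 3 = 0 ∧ e 4 = 0}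
      (fun e he => Hub.loc2 hγ hγ2 hV hχ hVpos hχpos e he.1 he.2.1 he.2.2.1 he.2.2.2.1 he.2.2.2.2) Φ _
      (fun p hp => (hΦ p hp.1.1).1) (fun p hp => (hΦ p hp.1.1).2) (fun p hp => (hsol p hp.1).1.sph)
      (fun p hp => hp.1.2.2) ?_
    rintro p ⟨hp, hp2⟩
    obtain ⟨M, hM⟩ := hp.2.2
    obtain ⟨x, hx, l0, l1, l2, l3, l4⟩ := Hub.case2 hγ hγ2 (hsol p hp).1
      ((hsol p hp).2 (by rw [(hΦ p hp.1).1]; exact hp2)) hV hχ hVpos hχpos hχstat hM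
    refine ⟨!₂[x, 0, 1, 0, 0], by simpa using hx, Hub.tendsto_E5 fun i => ?_⟩
    fin_cases i
    · exact l0
    · exact l1
    · exact l2
    · exact l3
    · exact l4
end

section
/- (Proposition 4.1) Let γ ∈ (0, 2). The point q := (u, σ_2, σ_4, σ_5) = (0, 0, 1, 0) is an equilibrium point of the quadratic-gravity system, and it is not Lyapunov stable: there exists ε > 0 such that for every δ > 0 there exist a point p with ‖p − q‖ < δ, a time T > 0, and a solution x : [0, T] → ℝ^4 of the system with x(0) = p and ‖x(T) − q‖ ≥ ε. -/
open Set

/-- Truncation of `u` to `[-1, -η]`. -/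
noncomputable def qgClamp (η u : ℝ) : ℝ := max (min u (-η)) (-1)

/-- The truncated planar field on the invariant circle `σ2 = sin θ`, `σ4 = cos θ`, `σ5 = 0`. -/
noncomputable def qgField (η : ℝ) (y : ℝ × ℝ) : ℝ × ℝ :=
  (-(2/3) * (qgClamp η y.1 * (1 - qgClamp η y.1)) * Real.sin y.2,
    Real.cos y.2 * ((2/3) * qgClamp η y.1 - Real.sin y.2))

lemma qgClamp_lip (η u v : ℝ) : |qgClamp η u - qgClamp η v| ≤ |u - v| := by
  unfold qgClamp
  refine (abs_max_sub_max_le_abs _ _ _).trans ?_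
  refine (abs_min_sub_min_le_max _ _ _ _).trans ?_
  simp

lemma qgClamp_bd {η : ℝ} (h1 : η ≤ 1) (u : ℝ) : -1 ≤ qgClamp η u ∧ qgClamp η u ≤ -η := by
  unfold qgClamp
  exact ⟨le_max_right _ _, max_le (min_le_right _ _) (by linarith)⟩

lemma qgField_norm {η : ℝ} (h0 : 0 < η) (h1 : η ≤ 1) (y : ℝ × ℝ) : ‖qgField η y‖ ≤ 2 := by
  obtain ⟨hc1, hc2⟩ := qgClamp_bd h1 y.1
  have hs := Real.abs_sin_le_one y.2
  have hk := Real.abs_cos_le_one y.2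
  unfold qgField
  generalize qgClamp η y.1 = c at *
  rw [Prod.norm_def]
  simp only [Real.norm_eq_abs]
  refine max_le ?_ ?_
  · rw [abs_mul]
    have : |-(2/3) * (c * (1 - c))| ≤ 2 := by rw [abs_le]; constructor <;> nlinarith
    nlinarith [abs_nonneg (Real.sin y.2), abs_nonneg (-(2/3) * (c * (1 - c)))]
  · rw [abs_mul]
    have : |(2/3) * c - Real.sin y.2| ≤ 2 := by
      rw [abs_le] at *; constructor <;> linarith [hs.1, hs.2]
    nlinarith [abs_nonneg (Real.cos y.2), abs_nonneg ((2/3) * c - Real.sin y.2)]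

lemma qg_abs_mul_le {a b A B : ℝ} (ha : |a| ≤ A) (hb : |b| ≤ B) : |a * b| ≤ A * B := by
  rw [abs_mul]
  exact mul_le_mul ha hb (abs_nonneg _) ((abs_nonneg _).trans ha)

lemma qgField_lip {η : ℝ} (h0 : 0 < η) (h1 : η ≤ 1) : LipschitzWith 6 (qgField η) := by
  refine LipschitzWith.of_dist_le_mul fun x y => ?_
  obtain ⟨hc1, hc2⟩ := qgClamp_bd h1 x.1
  obtain ⟨hd1, hd2⟩ := qgClamp_bd h1 y.1
  have hD1 : |x.1 - y.1| ≤ dist x y := by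
    rw [Prod.dist_eq]; exact le_max_left _ _
  have hD2 : |x.2 - y.2| ≤ dist x y := by
    rw [Prod.dist_eq]; exact le_max_right _ _
  have hcl := (qgClamp_lip η x.1 y.1).trans hD1
  have hsl := (Real.abs_sin_sub_sin_le x.2 y.2).trans hD2
  have hkl := (Real.abs_cos_sub_cos_le x.2 y.2).trans hD2
  have hs := Real.abs_sin_le_one x.2
  have hs' := Real.abs_sin_le_one y.2
  have hk := Real.abs_cos_le_one y.2
  rw [Prod.dist_eq]
  unfold qgField
  simp only [Real.dist_eq]
  generalize dist x y = D at *
  generalize qgClamp η x.1 = c at *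
  generalize qgClamp η y.1 = d at *
  generalize Real.sin x.2 = s at *
  generalize Real.sin y.2 = s' at *
  generalize Real.cos x.2 = k at *
  generalize Real.cos y.2 = k' at *
  have hD : 0 ≤ D := (abs_nonneg _).trans hD1
  push_cast
  refine max_le ?_ ?_
  · have e : -(2/3) * (c * (1 - c)) * s - -(2/3) * (d * (1 - d)) * s'
        = (c - d) * (-(2/3) * (1 - c - d) * s) + (s - s') * (-(2/3) * (d * (1 - d))) := by ring
    have a1 : |-(2/3) * (1 - c - d)| ≤ 2 := by rw [abs_le]; constructor <;> linarith
    have a2 := qg_abs_mul_le a1 hs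
    have a3 : |-(2/3) * (d * (1 - d))| ≤ 2 := by rw [abs_le]; constructor <;> nlinarith
    rw [e]
    refine (abs_add_le _ _).trans ?_
    linarith [qg_abs_mul_le hcl a2, qg_abs_mul_le hsl a3]
  · have e : k * ((2/3) * c - s) - k' * ((2/3) * d - s')
        = (k - k') * ((2/3) * c - s) + k' * ((2/3) * (c - d) - (s - s')) := by ring
    have a1 : |(2/3) * c - s| ≤ 2 := by
      rw [abs_le] at *; constructor <;> linarith [hs.1, hs.2]
    have a2 : |(2/3) * (c - d) - (s - s')| ≤ 2 * D := by
      rw [abs_le] at *; constructor <;> linarith [hcl.1, hcl.2, hsl.1, hsl.2]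
    rw [e]
    refine (abs_add_le _ _).trans ?_
    linarith [qg_abs_mul_le hkl a1, qg_abs_mul_le hk a2]

/-- Solutions of the truncated field exist on arbitrarily long intervals. -/
lemma qgField_exists {η : ℝ} (h0 : 0 < η) (h1 : η ≤ 1) (y0 : ℝ × ℝ) (T : ℝ) (hT : 0 < T) :
    ∃ y : ℝ → ℝ × ℝ, y 0 = y0 ∧ ∀ t ∈ Icc (0:ℝ) T, HasDerivAt y (qgField η (y t)) t := by
  have hm : (0:ℝ) ∈ Icc (-1 : ℝ) (T + 1) := ⟨by norm_num, by linarith⟩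
  have hpl : IsPicardLindelof (fun _ => qgField η) (⟨0, hm⟩ : Icc (-1 : ℝ) (T + 1)) y0
      (Real.toNNReal (2 * (T + 1))) 0 2 6 := by
    refine ⟨fun t _ => (qgField_lip h0 h1).lipschitzOnWith, fun x _ => continuousOn_const,
      fun t _ x _ => by simpa using qgField_norm h0 h1 x, ?_⟩
    rw [Real.coe_toNNReal _ (by linarith)]
    have : max (T + 1 - 0) (0 - (-1 : ℝ)) ≤ T + 1 := max_le (by linarith) (by linarith)
    push_cast
    linarith
  obtain ⟨y, hy0, hy⟩ := hpl.exists_eq_forall_mem_Icc_hasDerivWithinAt₀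
  refine ⟨y, hy0, fun t ht => ?_⟩
  exact (hy t ⟨by linarith [ht.1], by linarith [ht.2]⟩).hasDerivAt
    (Icc_mem_nhds (by linarith [ht.1]) (by linarith [ht.2]))

lemma qg_escape {η : ℝ} (h0 : 0 < η) (h1 : η < 1/2) :
    ∃ (T : ℝ) (u θ : ℝ → ℝ), 0 < T ∧ u 0 = -η ∧ θ 0 = -η ∧ u T = -(1/2) ∧
      (∀ t ∈ Icc (0:ℝ) T, HasDerivAt u (-(2/3) * (u t * (1 - u t)) * Real.sin (θ t)) t) ∧
      (∀ t ∈ Icc (0:ℝ) T,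
        HasDerivAt θ (Real.cos (θ t) * ((2/3) * u t - Real.sin (θ t))) t) := by
  set S : ℝ := 3 / η ^ 2 with hS
  have hS0 : 0 < S := by positivity
  obtain ⟨y, hy0, hy⟩ := qgField_exists h0 (by linarith : η ≤ 1) (-η, -η) S hS0
  have hu : ∀ t ∈ Icc (0:ℝ) S, HasDerivAt (fun t => (y t).1) (qgField η (y t)).1 t :=
    fun t ht => (hy t ht).fst
  have hθ : ∀ t ∈ Icc (0:ℝ) S, HasDerivAt (fun t => (y t).2) (qgField η (y t)).2 t :=
    fun t ht => (hy t ht).snd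
  have hb := fun t => qgClamp_bd (by linarith : η ≤ 1) (y t).1
  have hsin : ∀ t ∈ Icc (0:ℝ) S, HasDerivAt (fun t => Real.sin (y t).2)
      (Real.cos (y t).2 * (qgField η (y t)).2) t := fun t ht => (hθ t ht).sin
  have hs : ∀ t ∈ Icc (0:ℝ) S, Real.sin (y t).2 ≤ -(η/2) := by
    have := image_le_of_deriv_right_lt_deriv_boundary (f := fun t => Real.sin (y t).2)
      (f' := fun t => Real.cos (y t).2 * (qgField η (y t)).2) (a := 0) (b := S)
      (B := fun _ => -(η/2)) (B' := fun _ => 0)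
      (fun t ht => (hsin t ht).continuousAt.continuousWithinAt)
      (fun t ht => (hsin t ⟨ht.1, ht.2.le⟩).hasDerivWithinAt) ?_
      (fun x => hasDerivAt_const _ _) ?_
    · exact fun t ht => this ht
    · simp only [hy0]
      have hpi : 2 < Real.pi := by linarith [Real.pi_gt_three]
      have h := Real.mul_le_sin h0.le (by linarith : η ≤ Real.pi / 2)
      have h4 : (1/2 : ℝ) ≤ 2 / Real.pi := by
        rw [le_div_iff₀ (by linarith)]; linarith [Real.pi_le_four]
      rw [Real.sin_neg]
      nlinarith
    · intro t ht hst
      have hc := Real.sin_sq_add_cos_sq (y t).2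
      simp only [qgField]
      have hb2 := (hb t).2
      rw [hst] at hc ⊢
      have : 0 < Real.cos (y t).2 ^ 2 := by nlinarith
      have : (2/3) * qgClamp η (y t).1 - -(η/2) < 0 := by linarith
      nlinarith
  have hu' : ∀ t ∈ Icc (0:ℝ) S, (qgField η (y t)).1 ≤ -(η^2/3) := by
    intro t ht
    have h := hs t ht
    obtain ⟨hb1, hb2⟩ := hb t
    simp only [qgField]
    have h2 : qgClamp η (y t).1 * (1 - qgClamp η (y t).1) ≤ -η := by nlinarith
    nlinarith
  have hcont : ContinuousOn (fun t => (y t).1) (Icc 0 S) :=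
    fun t ht => (hu t ht).continuousAt.continuousWithinAt
  have hmv := (convex_Icc (0:ℝ) S).image_sub_le_mul_sub_of_deriv_le hcont
    (fun t ht => (hu t (interior_subset ht)).differentiableAt.differentiableWithinAt)
    (C := -(η^2/3))
    (fun t ht => by rw [(hu t (interior_subset ht)).deriv]; exact hu' t (interior_subset ht))
  have hu0 : (y 0).1 = -η := by rw [hy0]
  have hend : (y S).1 ≤ -(1/2) := by
    have h := hmv 0 ⟨le_rfl, hS0.le⟩ S ⟨hS0.le, le_rfl⟩ hS0.le
    have e : -(η^2/3) * (S - 0) = -1 := by rw [hS]; field_simp; ring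
    rw [e] at h
    linarith
  obtain ⟨T, hT, huT⟩ := intermediate_value_Icc' hS0.le hcont
    (show -(1/2 : ℝ) ∈ Icc _ _ from ⟨hend, by simp only [hu0]; linarith⟩)
  simp only at huT
  have hTpos : 0 < T := by
    rcases hT.1.eq_or_lt with h | h
    · rw [← h, hu0] at huT; linarith
    · exact h
  have hcl : ∀ t ∈ Icc (0:ℝ) T, qgClamp η (y t).1 = (y t).1 := by
    intro t ht
    have htS : t ∈ Icc (0:ℝ) S := ⟨ht.1, ht.2.trans hT.2⟩
    have ha := hmv 0 ⟨le_rfl, hS0.le⟩ t htS ht.1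
    have hb := hmv t htS T hT ht.2
    have hη2 : 0 < η^2/3 := by positivity
    unfold qgClamp
    rw [min_eq_left, max_eq_left]
    · nlinarith [ht.2]
    · nlinarith [ht.1]
  refine ⟨T, fun t => (y t).1, fun t => (y t).2, hTpos, hu0, by simp [hy0], huT, ?_, ?_⟩
  · intro t ht
    have h := hu t ⟨ht.1, ht.2.trans hT.2⟩
    simpa only [qgField, hcl t ht] using h
  · intro t ht
    have h := hθ t ⟨ht.1, ht.2.trans hT.2⟩
    simpa only [qgField, hcl t ht] using h

/-- (Proposition 4.1) For `γ ∈ (0,2)`, the point `q = (0, 0, 1, 0)` (the de Sitter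
solution) is an equilibrium point of the quadratic-gravity system, and it is not
Lyapunov stable: there exists `ε > 0` such that for every `δ > 0` some solution starting
within distance `δ` of `q` gets at distance at least `ε` from `q` in finite time. -/
theorem stmt_15
    (γ : ℝ) (hγ0 : 0 < γ) (hγ2 : γ < 2)
    (F : ℝ × ℝ × ℝ × ℝ → ℝ × ℝ × ℝ × ℝ)
    (hF : ∀ u σ2 σ4 σ5 : ℝ, F (u, σ2, σ4, σ5) =
      ((2/3) * u^2 * σ2 - (2/3) * u * σ2,
       (2/3) * u * σ4^2 + (1 - γ/2) * σ2^3 + (1/6) * (3*γ - 4) * σ2^2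
         + σ2 * (-(γ/2) * σ4^2 + (1/6) * (4 - 3*γ) * σ5^2 + (γ - 2)/2)
         + (1/6) * (3*γ - 4) * σ4^2 + (1/6) * (3*γ - 4) * σ5^2 + (1/6) * (4 - 3*γ),
       -(2/3) * u * σ2 * σ4 + (1 - γ/2) * σ2^2 * σ4 - (γ/2) * σ4^3
         + σ4 * ((1/6) * (4 - 3*γ) * σ5^2 + γ/2),
       (1 - γ/2) * σ2^2 * σ5 - (γ/2) * σ4^2 * σ5 + (1/6) * (4 - 3*γ) * σ5^3
         + (1/6) * (3*γ - 4) * σ5)) :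
    -- `q = (0,0,1,0)` is an equilibrium point
    F ((0:ℝ), (0:ℝ), (1:ℝ), (0:ℝ)) = 0
    -- `q` is not Lyapunov stable
    ∧ ∃ ε > 0, ∀ δ > 0,
        ∃ (p : ℝ × ℝ × ℝ × ℝ) (T : ℝ) (x : ℝ → ℝ × ℝ × ℝ × ℝ),
          dist p ((0:ℝ), (0:ℝ), (1:ℝ), (0:ℝ)) < δ ∧ 0 < T ∧ x 0 = p ∧
          (∀ t ∈ Icc (0:ℝ) T, HasDerivAt x (F (x t)) t) ∧
          ε ≤ dist (x T) ((0:ℝ), (0:ℝ), (1:ℝ), (0:ℝ)) := by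
  refine ⟨by rw [hF]; ext <;> simp <;> ring, 1/2, by norm_num, fun δ hδ => ?_⟩
  set η : ℝ := min (δ/2) (1/4) with hη
  have h0 : 0 < η := lt_min (by linarith) (by norm_num)
  have h1 : η ≤ 1/4 := min_le_right _ _
  have h2 : η ≤ δ/2 := min_le_left _ _
  obtain ⟨T, u, θ, hT, hu0, hθ0, huT, hu, hθ⟩ := qg_escape h0 (by linarith)
  refine ⟨_, T, fun t => (u t, Real.sin (θ t), Real.cos (θ t), 0), ?_, hT, rfl, ?_, ?_⟩
  · simp only [hu0, hθ0, Prod.dist_eq, Real.dist_eq, Real.sin_neg, Real.cos_neg]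
    have hs := Real.abs_sin_le_abs (x := η)
    rw [abs_of_pos h0] at hs
    refine max_lt ?_ (max_lt ?_ (max_lt ?_ ?_))
    · rw [sub_zero, abs_neg, abs_of_pos h0]; linarith
    · rw [sub_zero, abs_neg]; linarith
    · have h3 := Real.one_sub_sq_div_two_le_cos (x := η)
      have h4 := Real.cos_le_one η
      rw [abs_lt]; constructor <;> nlinarith
    · simpa using hδ
  · intro t ht
    have hut := hu t ht
    have hθt := hθ t ht
    have key := hut.prodMk (hθt.sin.prodMk (hθt.cos.prodMk (hasDerivAt_const t (0:ℝ))))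
    refine key.congr_deriv ?_
    rw [hF]
    have hc : Real.cos (θ t) ^ 2 = 1 - Real.sin (θ t) ^ 2 := by
      linarith [Real.sin_sq_add_cos_sq (θ t)]
    refine Prod.ext ?_ (Prod.ext ?_ (Prod.ext ?_ ?_))
    · simp only; ring
    · simp only
      linear_combination ((2/3) * u t - Real.sin (θ t) - (2/3) * u t
        + γ/2 * Real.sin (θ t) - (1/6) * (3*γ - 4)) * hc
    · simp only
      linear_combination (γ/2 * Real.cos (θ t)) * hc
    · simp only; ring
  · simp only [Prod.dist_eq, Real.dist_eq, huT]
    refine le_max_of_le_left ?_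
    norm_num
end
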